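/- Every strongly involutive link (L, τ) is equivariantly isotopic to the equivariant closure of two palindromic braids α and β. In particular, the equivariant closure map from pairs of palindromic braids to strongly involutive links up to Sakuma equivalence is surjective. -/

import Mathlib

open Set

noncomputable section

/-- Points of `ℝ³`, written `(x, y, z)`. -/
abbrev R3 := ℝ × ℝ × ℝ

/-- The involution of `ℝ³` given by the π-rotation around the y-axis. -/
def tau : R3 → R3 := fun p => (-p.1, p.2.1, -p.2.2)

/-- The fixed-point axis `𝐚` of `tau` (the y-axis). -/
def axisA : Set R3 := {p | p.1 = 0 ∧ p.2.2 = 0}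

/-- The braid axis `𝐛` (the z-axis). -/
def axisB : Set R3 := {p | p.1 = 0 ∧ p.2.1 = 0}

/-- Orthogonal projection to the (x,y)-plane (the plane of link diagrams). -/
def proj (p : R3) : ℝ × ℝ := (p.1, p.2.1)

/-- Planar cross product, used to detect the sense of rotation around the origin. -/
def cross2 (u v : ℝ × ℝ) : ℝ := u.1 * v.2 - u.2 * v.1

/-- An oriented edge is positive if its projection runs counterclockwise around the origin. -/
def PosEdge (e : R3 × R3) : Prop := 0 < cross2 (proj e.1) (proj e.2)

/-- An oriented edge is negative if its projection runs clockwise around the origin. -/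
def NegEdge (e : R3 × R3) : Prop := cross2 (proj e.1) (proj e.2) < 0

/-- The (possibly degenerate) triangle with vertices `a`, `b`, `c`. -/
def tri (a b c : R3) : Set R3 := convexHull ℝ ({a, b, c} : Set R3)

/-- A polygonal link, presented by its finite list of oriented edges. -/
abbrev PolyLink := List (R3 × R3)

/-- The underlying subset of `ℝ³` of a polygonal link. -/
def carrier (L : PolyLink) : Set R3 := ⋃ e ∈ L, segment ℝ e.1 e.2

/-- The edge list describes an embedded disjoint union of polygonal circles. -/
def IsLink (L : PolyLink) : Prop :=
  L.Nodup ∧ (∀ e ∈ L, e.1 ≠ e.2) ∧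
  (∀ e ∈ L, ∀ f ∈ L, e ≠ f →
    segment ℝ e.1 e.2 ∩ segment ℝ f.1 f.2 ⊆ ({e.1, e.2} : Set R3) ∩ ({f.1, f.2} : Set R3)) ∧
  (∀ e ∈ L, ∃! f, f ∈ L ∧ f.1 = e.2) ∧
  (∀ e ∈ L, ∃! f, f ∈ L ∧ f.2 = e.1)

/-- `L` is preserved setwise by `tau`, with the orientation reversed. -/
def StronglyInvolutive (L : PolyLink) : Prop := ∀ e ∈ L, (tau e.2, tau e.1) ∈ L

/-- The standing assumption on diagrams: no edge projects into a line through the origin,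
and the projection has only double points. -/
def GoodDiagram (L : PolyLink) : Prop :=
  (∀ e ∈ L, cross2 (proj e.1) (proj e.2) ≠ 0) ∧
  (∀ p : ℝ × ℝ, ({x ∈ carrier L | proj x = p}).ncard ≤ 2)

open scoped Classical in
/-- The complexity `h(L)`: the number of negative edges of `L`. -/
def hNeg (L : PolyLink) : ℕ := L.countP fun e => decide (NegEdge e)

/-! ### The elementary moves -/

/-- The result of the triangle move `E_{a,c}^b`: the edge `(a,c)` is replaced by
`(a,b)` and `(b,c)`. -/
def applyE (a c b : R3) (L : PolyLink) : PolyLink := L.erase (a, c) ++ [(a, b), (b, c)]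

/-- The move `E_{a,c}^b` is defined: `a, c` are consecutive vertices and the result is a link. -/
def MoveEOk (a c b : R3) (L : PolyLink) : Prop := (a, c) ∈ L ∧ IsLink (applyE a c b L)

/-- Admissibility of `E_{a,c}^b` (not through `∞`): `[a,b,c] ∩ L = [a,c]`. -/
def AdmE (a c b : R3) (L : PolyLink) : Prop :=
  MoveEOk a c b L ∧ tri a b c ∩ carrier L = segment ℝ a c

/-- Admissibility of an `E` move going through `∞`: the plane through `a`, `b`, `c` meets
`L ∖ [a,c]` only inside the interior of the triangle `[a,b,c]`. -/
def AdmEInf (a c b : R3) (L : PolyLink) : Prop :=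
  MoveEOk a c b L ∧ ¬ Collinear ℝ ({a, b, c} : Set R3) ∧ b ∉ carrier L ∧
  (affineSpan ℝ ({a, b, c} : Set R3) : Set R3) ∩ (carrier L \ segment ℝ a c)
    ⊆ intrinsicInterior ℝ (tri a b c)

/-- The equivariant triangle move `Ẽ_{a,c}^b = E_{τ(a),τ(c)}^{τ(b)} ∘ E_{a,c}^b`. -/
def applyEtil (a c b : R3) (L : PolyLink) : PolyLink :=
  applyE (tau c) (tau a) (tau b) (applyE a c b L)

/-- Admissibility of the equivariant triangle move `Ẽ_{a,c}^b`. -/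
def AdmEtil (a c b : R3) (L : PolyLink) : Prop :=
  AdmE a c b L ∧ AdmE (tau c) (tau a) (tau b) (applyE a c b L)

/-- The quadrilateral `Q` with vertices `a`, `b`, `c`, `τ(a)` of a `D` move. -/
def quadD (a c b : R3) : Set R3 := convexHull ℝ ({a, b, c, tau a} : Set R3)

/-- The τ-symmetric quadrilateral move `D_{a,c}^b`, replacing `[a,c] ∪ [c,τ(a)]` by
`[a,b] ∪ [b,τ(a)]`, where `b` lies on the axis `𝐚`. -/
def applyD (a c b : R3) (L : PolyLink) : PolyLink :=
  ((L.erase (a, c)).erase (c, tau a)) ++ [(a, b), (b, tau a)]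

/-- The move `D_{a,c}^b` is defined. -/
def MoveDOk (a c b : R3) (L : PolyLink) : Prop :=
  (a, c) ∈ L ∧ (c, tau a) ∈ L ∧ b ∈ axisA ∧ Coplanar ℝ ({a, b, c, tau a} : Set R3) ∧
  IsLink (applyD a c b L)

/-- Admissibility of `D_{a,c}^b` (not through `∞`): `Q ∩ L = [a,c] ∪ [c,τ(a)]`. -/
def AdmD (a c b : R3) (L : PolyLink) : Prop :=
  MoveDOk a c b L ∧ quadD a c b ∩ carrier L = segment ℝ a c ∪ segment ℝ c (tau a)

/-- Admissibility of a `D` move going through `∞`: the closure of `(α ∖ Q) ∩ L` equals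
`[a,c] ∪ [c,τ(a)]`, where `α` is the plane of `Q`. -/
def AdmDInf (a c b : R3) (L : PolyLink) : Prop :=
  MoveDOk a c b L ∧
  closure (((affineSpan ℝ ({a, b, c, tau a} : Set R3) : Set R3) \ quadD a c b) ∩ carrier L)
    = segment ℝ a c ∪ segment ℝ c (tau a)

/-! ### `R`-type moves (all involved edges positive) -/

/-- An `R̃` move: an admissible `Ẽ_{a,c}^b` whose edges `ab`, `ac`, `cb` are all positive. -/
def AdmRtil (a c b : R3) (L : PolyLink) : Prop :=
  AdmEtil a c b L ∧ PosEdge (a, b) ∧ PosEdge (a, c) ∧ PosEdge (c, b)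

/-- An `R` move: an admissible `D_{a,c}^b` (not through `∞`) with `ac`, `ab` positive. -/
def AdmR (a c b : R3) (L : PolyLink) : Prop :=
  AdmD a c b L ∧ PosEdge (a, c) ∧ PosEdge (a, b)

/-! ### `W`-type moves -/

/-- The move `W̃_{a,d}^{b,c} = Ẽ_{b,d}^c ∘ Ẽ_{a,d}^b`. -/
def applyWtil (a d b c : R3) (L : PolyLink) : PolyLink := applyEtil b d c (applyEtil a d b L)

/-- Admissibility of `W̃_{a,d}^{b,c}`. -/
def AdmWtil (a d b c : R3) (L : PolyLink) : Prop :=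
  PosEdge (a, b) ∧ PosEdge (b, c) ∧ PosEdge (c, d) ∧ PosEdge (a, d) ∧ PosEdge (d, b) ∧
  AdmEtil a d b L ∧ AdmEtil b d c (applyEtil a d b L)

/-- The move `W_{a,d}^{b,c} = D_{b,d}^c ∘ Ẽ_{a,d}^b` (with `c = τ(c)`, `d = τ(d)`). -/
def applyW (a d b c : R3) (L : PolyLink) : PolyLink := applyD b d c (applyEtil a d b L)

/-- Admissibility of `W_{a,d}^{b,c}` not going through `∞`. -/
def AdmW (a d b c : R3) (L : PolyLink) : Prop :=
  c = tau c ∧ d = tau d ∧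
  PosEdge (a, b) ∧ PosEdge (d, b) ∧ PosEdge (c, a) ∧ PosEdge (b, c) ∧
  AdmEtil a d b L ∧ AdmD b d c (applyEtil a d b L)

/-- Admissibility of `W_{a,d}^{b,c}` going through `∞`. -/
def AdmWInf (a d b c : R3) (L : PolyLink) : Prop :=
  c = tau c ∧ d = tau d ∧
  PosEdge (a, b) ∧ PosEdge (d, b) ∧ PosEdge (c, a) ∧ PosEdge (b, c) ∧
  AdmEtil a d b L ∧ AdmDInf b d c (applyEtil a d b L)

/-- The support of `W̃_{a,d}^{b,c}`. -/
def suppWtil (a d b c : R3) : Set R3 := convexHull ℝ ({a, b, c, d} : Set R3)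

/-- The support of a `W` move not going through `∞`. -/
def suppW (a d b c : R3) : Set R3 := convexHull ℝ ({a, b, c, tau a, tau b} : Set R3)

/-- The hexagon `[a,c,τ(a),b,τ(b),d]`. -/
def hexW (a d b c : R3) : Set R3 := convexHull ℝ ({a, c, tau a, b, tau b, d} : Set R3)

/-- The support of a `W` move going through `∞`. -/
def suppWInf (a d b c : R3) : Set R3 := closure ((hexW a d b c)ᶜ)

/-- An empty `W̃` move: admissible, its support meets `L` only in `[a,d]`, and meets `𝐚`
at most in an endpoint of `[a,d]` lying on `𝐚`. -/
def EmptyWtil (a d b c : R3) (L : PolyLink) : Prop :=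
  AdmWtil a d b c L ∧
  suppWtil a d b c ∩ carrier L = segment ℝ a d ∧
  (suppWtil a d b c ∩ axisA = ∅ ∨
    (a ∈ axisA ∧ suppWtil a d b c ∩ axisA = {a}) ∨
    (d ∈ axisA ∧ suppWtil a d b c ∩ axisA = {d}))

/-- An empty `W` move (not through `∞`): admissible and its support meets `L` only in
the two consumed edges. -/
def EmptyW (a d b c : R3) (L : PolyLink) : Prop :=
  AdmW a d b c L ∧ suppW a d b c ∩ carrier L = segment ℝ a d ∪ segment ℝ d (tau a)

/-- An empty `W` move through `∞`. -/
def EmptyWInf (a d b c : R3) (L : PolyLink) : Prop :=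
  AdmWInf a d b c L ∧ suppWInf a d b c ∩ carrier L = segment ℝ a d ∪ segment ℝ d (tau a)

/-- A really empty `W̃` move. -/
def ReallyEmptyWtil (a d b c : R3) (L : PolyLink) : Prop :=
  EmptyWtil a d b c L ∧
  proj '' suppWtil a d b c ∩ proj '' carrier L = proj '' segment ℝ a d ∧
  (suppWtil a d b c ∩ axisA = ∅ ∨
    (a ∈ axisA ∧ suppWtil a d b c ∩ axisA = {a}) ∨
    (d ∈ axisA ∧ suppWtil a d b c ∩ axisA = {d}))

/-- A really empty `W` move not going through `∞`. -/
def ReallyEmptyW (a d b c : R3) (L : PolyLink) : Prop :=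
  EmptyW a d b c L ∧
  proj '' hexW a d b c ∩ proj '' carrier L
    = proj '' segment ℝ a d ∪ proj '' segment ℝ d (tau a)

/-- The quadrilateral with vertices `b`, `c`, `d`, `τ(b)`. -/
def quadInf (a d b c : R3) : Set R3 := convexHull ℝ ({b, c, d, tau b} : Set R3)

/-- A really empty `W` move going through `∞`. -/
def ReallyEmptyWInf (a d b c : R3) (L : PolyLink) : Prop :=
  EmptyWInf a d b c L ∧
  proj '' (carrier L \ (segment ℝ a d ∪ tau '' segment ℝ a d)) ∩ proj '' tri a b d = ∅ ∧
  proj '' carrier L ⊆ proj '' quadInf a d b c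

/-- A `W̃` move is of crossing type if the projections of `[a,b]` and `[d,c]` cross. -/
def CrossingType (a d b c : R3) : Prop :=
  (proj '' openSegment ℝ a b ∩ proj '' openSegment ℝ d c).Nonempty

/-- A `W` move is of type A if `π(b)` and `π(c)` lie on the same side of the projection of
the line through `a` and `τ(a)` (and `c ∉ [a,b,τ(a),τ(b)]`). -/
def TypeA (a d b c : R3) : Prop :=
  c ∉ convexHull ℝ ({a, b, tau a, tau b} : Set R3) ∧
  0 < (b.2.1 - a.2.1) * (c.2.1 - a.2.1)

/-- A `W` move is of type B if `π(b)` and `π(c)` lie on opposite sides of the projection of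
the line through `a` and `τ(a)` (and `c ∉ [a,b,τ(a),τ(b)]`). -/
def TypeB (a d b c : R3) : Prop :=
  c ∉ convexHull ℝ ({a, b, tau a, tau b} : Set R3) ∧
  (b.2.1 - a.2.1) * (c.2.1 - a.2.1) < 0

/-! ### Sawtooth moves -/

/-- The data of a sawtooth move `S̃_{p₀,…,p_m}^{q₁,…,q_m}`. -/
structure Sawtooth where
  m : ℕ
  p : Fin (m + 1) → R3
  q : Fin m → R3

/-- The edge `e = p₀ p_m` on which the sawtooth move is performed. -/
def Sawtooth.e (S : Sawtooth) : R3 × R3 := (S.p 0, S.p (Fin.last S.m))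

/-- The `i`-th tooth `[pᵢ, pᵢ₊₁, qᵢ₊₁]` of a sawtooth move. -/
def Sawtooth.tooth (S : Sawtooth) (i : Fin S.m) : Set R3 :=
  tri (S.p i.castSucc) (S.p i.succ) (S.q i)

/-- Subdivide the edge `e = p₀p_m` (and its mirror image) at the points `pᵢ` (resp. `τ(pᵢ)`);
this adds the `pᵢ` to the vertices of `L`. -/
def subdivide (m : ℕ) (p : Fin (m + 1) → R3) (L : PolyLink) : PolyLink :=
  ((L.erase (p 0, p (Fin.last m))).erase (tau (p (Fin.last m)), tau (p 0)))
    ++ ((List.finRange m).map fun i => (p i.castSucc, p i.succ))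
    ++ ((List.finRange m).map fun i => (tau (p i.succ), tau (p i.castSucc)))

/-- Apply a sequence of `Ẽ` moves. -/
def applyEtilSeq : List (R3 × R3 × R3) → PolyLink → PolyLink
  | [], L => L
  | (a, c, b) :: t, L => applyEtilSeq t (applyEtil a c b L)

/-- Each `Ẽ` move of a sequence is admissible on the link it is applied to. -/
def AdmEtilSeq : List (R3 × R3 × R3) → PolyLink → Prop
  | [], _ => True
  | (a, c, b) :: t, L => AdmEtil a c b L ∧ AdmEtilSeq t (applyEtil a c b L)

/-- The list of `Ẽ` moves constituting a sawtooth move. -/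
def Sawtooth.data (S : Sawtooth) : List (R3 × R3 × R3) :=
  (List.finRange S.m).map fun i => (S.p i.castSucc, S.p i.succ, S.q i)

/-- The result of a sawtooth move: `Ẽ_{p_{m-1},p_m}^{q_m} ∘ ⋯ ∘ Ẽ_{p₀,p₁}^{q₁}` after
subdividing the edge `e`. -/
def Sawtooth.apply (S : Sawtooth) (L : PolyLink) : PolyLink :=
  applyEtilSeq S.data (subdivide S.m S.p L)

/-- Admissibility of a sawtooth move on `L`. -/
def Sawtooth.Adm (S : Sawtooth) (L : PolyLink) : Prop :=
  0 < S.m ∧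
  S.e ∈ L ∧
  NegEdge S.e ∧
  (∀ i : Fin (S.m + 1), i ≠ 0 → i ≠ Fin.last S.m →
    S.p i ∈ openSegment ℝ (S.p 0) (S.p (Fin.last S.m))) ∧
  (∀ i : Fin S.m, NegEdge (S.p i.castSucc, S.p i.succ)) ∧
  (∀ i : Fin S.m, S.q i ∉ segment ℝ (S.p 0) (S.p (Fin.last S.m))) ∧
  (∀ i : Fin S.m, PosEdge (S.p i.castSucc, S.q i) ∧ PosEdge (S.q i, S.p i.succ)) ∧
  AdmEtilSeq S.data (subdivide S.m S.p L) ∧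
  (∀ i j : Fin S.m, i ≠ j → S.tooth i ∩ tau '' S.tooth j = ∅)

/-! ### `S³` and equivariant isotopy -/

/-- `S³` as the one-point compactification of `ℝ³`. -/
abbrev S3 := OnePoint R3

/-- The inclusion `ℝ³ ⊆ S³`. -/
def embS3 : R3 → S3 := OnePoint.some

/-- The extension of `tau` to `S³`, fixing `∞`. -/
def tauS3 : S3 → S3 := OnePoint.map tau

/-- The braid axis `𝐛 = (z-axis) ∪ {∞}` inside `S³`. -/
def axisBS3 : Set S3 := embS3 '' axisB ∪ {OnePoint.infty}

/-- Two subsets of `ℝ³` are equivariantly isotopic: there is an ambient isotopy of `S³`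
commuting with `τ` at every time and carrying the first onto the second. -/
def EquivIsotopicSets (A B : Set R3) : Prop :=
  ∃ H : ℝ → S3 ≃ₜ S3,
    Continuous (fun q : ℝ × S3 => H q.1 q.2) ∧
    H 0 = Homeomorph.refl S3 ∧
    (∀ t, ∀ x : S3, H t (tauS3 x) = tauS3 (H t x)) ∧
    H 1 '' (embS3 '' A) = embS3 '' B


/-- The involution `ρ` of `I × D²`: `(x,(y,z)) ↦ (1-x,(y,-z))`. -/
def rho : R3 → R3 := fun p => (1 - p.1, p.2.1, -p.2.2)

/-- Membership in the disk `D²`. -/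
def inDisk (u : ℝ × ℝ) : Prop := u.1 ^ 2 + u.2 ^ 2 ≤ 1

/-- The solid cylinder `I × D² ⊆ ℝ³`. -/
def Cyl : Set R3 := {p | p.1 ∈ Icc (0:ℝ) 1 ∧ inDisk (p.2.1, p.2.2)}

/-- The base points `p₁, …, p_m` on the horizontal diameter of `D²`. -/
def basePt (m : ℕ) (i : Fin m) : ℝ := -1 + 2 * ((i : ℕ) + 1) / (m + 1)

/-- A function `ℝ → ℝ²` is a PL path: affine on each interval of a finite subdivision
of `[0,1]`. -/
def IsPLPath (f : ℝ → ℝ × ℝ) : Prop :=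
  ∃ (k : ℕ) (t : Fin (k + 1) → ℝ),
    t 0 = 0 ∧ t (Fin.last k) = 1 ∧ Monotone t ∧
    ∀ j : Fin k, ∃ u v : ℝ × ℝ, ∀ s ∈ Icc (t j.castSucc) (t j.succ), f s = u + s • v

/-- A geometric braid on `m` strands in `I × D²`: each strand is (the graph of) a PL path
in the disk, strands are disjoint, start at the base points and end at a permutation
of the base points. (Parametrising strands by the `I`-coordinate makes every component
strictly monotone in the `I`-direction and excludes closed components.) -/
structure GeomBraid (m : ℕ) where
  f : Fin m → ℝ → ℝ × ℝ
  pl : ∀ i, IsPLPath (f i)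
  disj : ∀ t ∈ Icc (0:ℝ) 1, ∀ i j : Fin m, i ≠ j → f i t ≠ f j t
  inD : ∀ i, ∀ t ∈ Icc (0:ℝ) 1, inDisk (f i t)
  start : ∀ i, f i 0 = (basePt m i, 0)
  finish : ∃ σ : Equiv.Perm (Fin m), ∀ i, f i 1 = (basePt m (σ i), 0)

/-- The subset of `I × D² ⊆ ℝ³` underlying a geometric braid. -/
def GeomBraid.carrier {m : ℕ} (g : GeomBraid m) : Set R3 :=
  {p | ∃ i : Fin m, ∃ t ∈ Icc (0:ℝ) 1, p = (t, (g.f i t).1, (g.f i t).2)}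

/-- A symmetric representative: the geometric braid is fixed setwise by `ρ`. -/
def GeomBraid.Symmetric {m : ℕ} (g : GeomBraid m) : Prop := rho '' g.carrier = g.carrier

/-- Two strand families are homotopic through configurations, relative to endpoints;
this is equality in the braid group. -/
def BraidHomotopic (m : ℕ) (f g : Fin m → ℝ → ℝ × ℝ) : Prop :=
  (∀ i, f i 0 = g i 0) ∧ (∀ i, f i 1 = g i 1) ∧
  ∃ F : ℝ → Fin m → ℝ → ℝ × ℝ,
    (∀ i, ContinuousOn (fun q : ℝ × ℝ => F q.1 i q.2) (Icc 0 1 ×ˢ Icc 0 1)) ∧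
    (∀ i, ∀ t ∈ Icc (0:ℝ) 1, F 0 i t = f i t ∧ F 1 i t = g i t) ∧
    (∀ s ∈ Icc (0:ℝ) 1, ∀ i, F s i 0 = f i 0 ∧ F s i 1 = f i 1) ∧
    (∀ s ∈ Icc (0:ℝ) 1, ∀ t ∈ Icc (0:ℝ) 1, ∀ i j : Fin m, i ≠ j → F s i t ≠ F s j t) ∧
    (∀ s ∈ Icc (0:ℝ) 1, ∀ t ∈ Icc (0:ℝ) 1, ∀ i, inDisk (F s i t))

/-- Two geometric braids represent the same braid. -/
def SameBraid {m : ℕ} (a b : GeomBraid m) : Prop := BraidHomotopic m a.f b.f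

/-- `f` is piecewise linear on `s`: it agrees with affine maps on the cells of a finite
cover of `s` by compact convex sets. -/
def IsPLOn (f : R3 → R3) (s : Set R3) : Prop :=
  ∃ (k : ℕ) (P : Fin k → Set R3) (g : Fin k → (R3 →ᵃ[ℝ] R3)),
    s = ⋃ i, P i ∧ (∀ i, IsCompact (P i) ∧ Convex ℝ (P i)) ∧
    ∀ i, EqOn f (g i) (P i)

/-! ### The equivariant closure -/

/-- Embedding of `I × D²` onto the solid cylinder `B₁`. -/
def iota1 (p : R3) : R3 := (p.1 - 1/2, p.2.1 - 2, p.2.2)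

/-- Embedding of `I × D²` onto the solid cylinder `B₂`. -/
def iota2 (p : R3) : R3 := (p.1 - 1/2, p.2.1 + 2, p.2.2)

def pathSegs (l : List R3) : List (R3 × R3) := l.zip l.tail

/-- The polygonal arc through the vertices of `l`. -/
def pathCarrier (l : List R3) : Set R3 := ⋃ e ∈ pathSegs l, segment ℝ e.1 e.2

def arcStart (m : ℕ) (i : Fin m) : R3 := (-(1:ℝ)/2, basePt m i + 2, 0)
def arcEnd (m : ℕ) (i : Fin m) : R3 := (-(1:ℝ)/2, basePt m i - 2, 0)

/-- A connecting arc `γᵢ` of the equivariant closure: a polygonal arc in the `(x,y)`-plane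
from the `i`-th endpoint of `B₂` to the `i`-th endpoint of `B₁`, projecting monotonically
to the `y`-axis. -/
def IsConnArc (m : ℕ) (i : Fin m) (l : List R3) : Prop :=
  l.head? = some (arcStart m i) ∧ l.getLast? = some (arcEnd m i) ∧
  (∀ p ∈ l, p.2.2 = 0) ∧
  l.Chain' (fun p q : R3 => q.2.1 < p.2.1)

/-- `L` is an equivariant closure of the (carriers of the) geometric braids `A` and `B`:
`A` is embedded in `B₁`, `B` in `B₂`, and corresponding endpoints are joined by arcs
`γᵢ` in the `(x,y)`-plane monotone over the `y`-axis, together with their `τ`-images. -/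
def IsEqClosure (m : ℕ) (A B : Set R3) (L : Set R3) : Prop :=
  ∃ g : Fin m → List R3,
    (∀ i, IsConnArc m i (g i)) ∧
    (∀ i j, i ≠ j → pathCarrier (g i) ∩ pathCarrier (g j) = ∅) ∧
    (∀ i j, pathCarrier (g i) ∩ tau '' pathCarrier (g j) = ∅) ∧
    (∀ i, pathCarrier (g i) ∩ (iota1 '' A ∪ iota2 '' B) ⊆ {arcStart m i, arcEnd m i}) ∧
    L = iota1 '' A ∪ iota2 '' B ∪ (⋃ i, pathCarrier (g i)) ∪ (⋃ i, tau '' pathCarrier (g i))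

/-! ### The braid group and the algebraic Markov moves -/

/-- The braid relations on the Artin generators `σ₀, …, σ_{n-1}` (for the braid group on
`n+1` strands). -/
def braidRels (n : ℕ) : Set (FreeGroup (Fin n)) :=
  {r | ∃ i j : Fin n, ((i : ℕ) + 2 ≤ (j : ℕ) ∨ (j : ℕ) + 2 ≤ (i : ℕ)) ∧
      r = .of i * .of j * (.of i)⁻¹ * (.of j)⁻¹} ∪
  {r | ∃ i j : Fin n, (j : ℕ) = (i : ℕ) + 1 ∧
      r = .of i * .of j * .of i * ((.of j) * (.of i) * (.of j))⁻¹}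

/-- The braid group on `n+1` strands, with `n` Artin generators. -/
abbrev BraidGroup (n : ℕ) := PresentedGroup (braidRels n)

/-- The projection from words to braids. -/
def bmk (n : ℕ) : FreeGroup (Fin n) →* BraidGroup n := PresentedGroup.mk (braidRels n)

/-- The reverse of a word: the word read from right to left. -/
def revF {n : ℕ} : FreeGroup (Fin n) → FreeGroup (Fin n) :=
  fun w => ((FreeGroup.lift fun i => MulOpposite.op (FreeGroup.of i)) w).unop

/-- A braid is palindromic if it is represented by a word equal, in the braid group,
to its reverse. -/
def Palindromic {n : ℕ} (β : BraidGroup n) : Prop :=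
  ∃ w : FreeGroup (Fin n), bmk n w = β ∧ bmk n (revF w) = β

/-- The inclusion `S : Bₙ → Bₙ₊₁`, `σᵢ ↦ σᵢ₊₁` (at the level of words). -/
def mapS {n : ℕ} : FreeGroup (Fin n) →* FreeGroup (Fin (n + 1)) :=
  FreeGroup.lift fun i => FreeGroup.of i.succ

/-- The inclusion `E : Bₙ → Bₙ₊₁`, `σᵢ ↦ σᵢ` (at the level of words). -/
def mapE {n : ℕ} : FreeGroup (Fin n) →* FreeGroup (Fin (n + 1)) :=
  FreeGroup.lift fun i => FreeGroup.of i.castSucc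

def mapS2 {n : ℕ} : FreeGroup (Fin n) →* FreeGroup (Fin (n + 2)) := mapS.comp mapS

/-- The letter `σᵢ^{±1}`. -/
def genW {n : ℕ} (p : Fin n × Bool) : FreeGroup (Fin n) :=
  cond p.2 (FreeGroup.of p.1) (FreeGroup.of p.1)⁻¹

/-- The word `Δ = σ_{j₁}^{ε₁} ⋯ σ_{j_k}^{ε_k}`. -/
def deltaWord {n : ℕ} (d : List (Fin n × Bool)) : FreeGroup (Fin n) := (d.map genW).prod

/-- `Δ` is a product of distinct pairwise-commuting Artin generators. -/
def IsDelta {n : ℕ} (d : List (Fin n × Bool)) : Prop :=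
  d.Pairwise fun p q => (p.1 : ℕ) + 2 ≤ (q.1 : ℕ) ∨ (q.1 : ℕ) + 2 ≤ (p.1 : ℕ)

/-- The bottom generator `σ₁^{±1}` of `B_{n+2}`. -/
def sigmaBot (n : ℕ) (ε : Bool) : FreeGroup (Fin (n + 1)) := genW (⟨0, n.succ_pos⟩, ε)

/-- The top generator `σ_{n+1}^{±1}` of `B_{n+2}`. -/
def sigmaTop (n : ℕ) (ε : Bool) : FreeGroup (Fin (n + 1)) := genW (Fin.last n, ε)

def sigma2 (n : ℕ) (ε : Bool) : FreeGroup (Fin (n + 2)) :=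
  genW (⟨1, by omega⟩, ε)

def sigma1' (n : ℕ) (ε : Bool) : FreeGroup (Fin (n + 2)) :=
  genW (⟨0, by omega⟩, ε)

/-- A state: a pair of (palindromic) braids on a common number of strands. -/
abbrev MPair := Σ n : ℕ, BraidGroup n × BraidGroup n

/-- Equivariant conjugation: `(α, β) ↦ (γ α γ̄, γ̄⁻¹ β γ⁻¹)`. -/
def ConjStep (P Q : MPair) : Prop :=
  ∃ (n : ℕ) (α β : BraidGroup n) (g : FreeGroup (Fin n)),
    P = ⟨n, (α, β)⟩ ∧
    Q = ⟨n, (bmk n g * α * bmk n (revF g), (bmk n (revF g))⁻¹ * β * (bmk n g)⁻¹)⟩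

/-- Stabilization of type `S` on a fixed point. -/
def StabSStep (P Q : MPair) : Prop :=
  ∃ (n : ℕ) (x w : FreeGroup (Fin n)) (d : List (Fin n × Bool)) (ε : Bool),
    IsDelta d ∧ (∀ p ∈ d, (p.1 : ℕ) ≠ 0) ∧
    ((P = ⟨n, (bmk n (x * deltaWord d * revF x), bmk n w)⟩ ∧
      Q = ⟨n + 1, (bmk (n + 1) (mapS x * mapS (deltaWord d) * sigmaBot n ε * mapS (revF x)),
        bmk (n + 1) (mapS w))⟩) ∨
     (P = ⟨n, (bmk n w, bmk n (x * deltaWord d * revF x))⟩ ∧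
      Q = ⟨n + 1, (bmk (n + 1) (mapS w),
        bmk (n + 1) (mapS x * mapS (deltaWord d) * sigmaBot n ε * mapS (revF x)))⟩))

/-- Stabilization of type `E` on a fixed point. -/
def StabEStep (P Q : MPair) : Prop :=
  ∃ (n : ℕ) (x w : FreeGroup (Fin n)) (d : List (Fin n × Bool)) (ε : Bool),
    IsDelta d ∧ (∀ p ∈ d, (p.1 : ℕ) + 1 ≠ n) ∧
    ((P = ⟨n, (bmk n (x * deltaWord d * revF x), bmk n w)⟩ ∧
      Q = ⟨n + 1, (bmk (n + 1) (mapE x * mapE (deltaWord d) * sigmaTop n ε * mapE (revF x)),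
        bmk (n + 1) (mapE w))⟩) ∨
     (P = ⟨n, (bmk n w, bmk n (x * deltaWord d * revF x))⟩ ∧
      Q = ⟨n + 1, (bmk (n + 1) (mapE w),
        bmk (n + 1) (mapE x * mapE (deltaWord d) * sigmaTop n ε * mapE (revF x)))⟩))

/-- Double stabilization. -/
def DoubleStep (P Q : MPair) : Prop :=
  ∃ (n : ℕ) (x y : FreeGroup (Fin n)) (d d' : List (Fin n × Bool)) (ε η : Bool),
    IsDelta d ∧ IsDelta d' ∧
    P = ⟨n, (bmk n (x * deltaWord d * revF x), bmk n (y * deltaWord d' * revF y))⟩ ∧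
    Q = ⟨n + 2, (bmk (n + 2) (mapS2 x * mapS2 (deltaWord d) * sigma1' n ε * mapS2 (revF x)),
      bmk (n + 2) (sigma2 n η * mapS2 y * mapS2 (deltaWord d') * sigma1' n (!ε) *
        mapS2 (revF y) * sigma2 n η))⟩

/-- One equivariant Markov move: equivariant conjugation, (de-)stabilization of type `S`
or `E` on a fixed point, or double stabilization. -/
def MarkovRel (P Q : MPair) : Prop :=
  ConjStep P Q ∨ ConjStep Q P ∨ StabSStep P Q ∨ StabSStep Q P ∨
  StabEStep P Q ∨ StabEStep Q P ∨ DoubleStep P Q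

/-! ### Geometric realization of words -/

/-- The motion of the `n+1` base points realizing one letter `σ_k^{±1}`. -/
def letterMotion (n : ℕ) (k : Fin n) (ε : Bool) (i : Fin (n + 1)) (t : ℝ) : ℝ × ℝ :=
  let c : ℝ := (basePt (n + 1) k.castSucc + basePt (n + 1) k.succ) / 2
  let r : ℝ := (basePt (n + 1) k.succ - basePt (n + 1) k.castSucc) / 2
  let s : ℝ := cond ε 1 (-1)
  if i = k.castSucc then (c - r * Real.cos (Real.pi * t), s * r * Real.sin (Real.pi * t))
  else if i = k.succ then (c + r * Real.cos (Real.pi * t), -s * r * Real.sin (Real.pi * t))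
  else (basePt (n + 1) i, 0)

/-- The strand paths realizing a word, parametrized on `[0, length]`. -/
def wordPathN (n : ℕ) : List (Fin n × Bool) → Fin (n + 1) → ℝ → ℝ × ℝ
  | [], i, _ => (basePt (n + 1) i, 0)
  | ℓ :: rest, i, t =>
      if t ≤ 1 then letterMotion n ℓ.1 ℓ.2 i t
      else wordPathN n rest (Equiv.swap ℓ.1.castSucc ℓ.1.succ i) (t - 1)

/-- The standard geometric realization of a word, parametrized on `[0,1]`. -/
def wordPath (n : ℕ) (w : List (Fin n × Bool)) (i : Fin (n + 1)) (t : ℝ) : ℝ × ℝ :=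
  wordPathN n w i (t * w.length)

/-- A geometric braid represents an element of the braid group if it is braid-homotopic
to the standard realization of some word for that element. -/
def Represents {n : ℕ} (g : GeomBraid (n + 1)) (β : BraidGroup n) : Prop :=
  ∃ w : FreeGroup (Fin n), bmk n w = β ∧
    BraidHomotopic (n + 1) g.f (wordPath n w.toWord)

/-! ### Equivariant isotopies of `S³` -/

theorem tau_tau (p : R3) : tau (tau p) = p := by simp [tau]

theorem tauS3_coe (p : R3) : tauS3 (p : S3) = ((tau p : R3) : S3) := rfl

namespace EquivIsotopicSets

theorem refl (A : Set R3) : EquivIsotopicSets A A :=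
  ⟨fun _ => Homeomorph.refl S3, continuous_snd, rfl, fun _ _ => rfl, by simp⟩

theorem symm {A B : Set R3} (h : EquivIsotopicSets A B) : EquivIsotopicSets B A := by
  obtain ⟨H, hc, h0, heq, h1⟩ := h
  refine ⟨fun t => (H 1).symm.trans (H (1 - t)), ?_, ?_, ?_, ?_⟩
  · exact hc.comp ((continuous_const.sub continuous_fst).prodMk
      ((H 1).symm.continuous.comp continuous_snd))
  · ext x; simp
  · intro t x
    have : (H 1).symm (tauS3 x) = tauS3 ((H 1).symm x) := by
      rw [Homeomorph.symm_apply_eq, heq]; simp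
    simp [this, heq]
  · rw [← h1]
    simp [h0, image_image]

theorem trans {A B C : Set R3} (h : EquivIsotopicSets A B) (h' : EquivIsotopicSets B C) :
    EquivIsotopicSets A C := by
  obtain ⟨H, hc, h0, heq, h1⟩ := h
  obtain ⟨G, gc, g0, geq, g1⟩ := h'
  refine ⟨fun t => (H t).trans (G t), ?_, ?_, ?_, ?_⟩
  · exact gc.comp (continuous_fst.prodMk hc)
  · ext x; simp [h0, g0]
  · intro t x; simp [heq, geq]
  · rw [← g1, ← h1, image_image]; simp [image_image]

end EquivIsotopicSets

/-- Clamping the time parameter to `[0, 1]`. -/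
def clamp (t : ℝ) : ℝ := max 0 (min t 1)

theorem clamp_nonneg (t : ℝ) : 0 ≤ clamp t := le_max_left _ _

theorem clamp_le_one (t : ℝ) : clamp t ≤ 1 := max_le zero_le_one (min_le_right _ _)

theorem continuous_clamp : Continuous clamp := by unfold clamp; fun_prop

theorem tau_add (p q : R3) : tau (p + q) = tau p + tau q := by
  ext <;> simp [tau] <;> ring

theorem tau_smul (c : ℝ) (p : R3) : tau (c • p) = c • tau p := by
  ext <;> simp [tau]

theorem continuous_tau : Continuous tau := by unfold tau; fun_prop

theorem exists_homeomorph_of_lipschitz {D : R3 → R3} {K : NNReal} (hK : K < 1)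
    (hD : LipschitzWith K D) (t : ℝ) :
    ∃ h : R3 ≃ₜ R3, ∀ x, h x = x + clamp t • D x := by
  have happ : ApproximatesLinearOn (fun x => x + clamp t • D x)
      (ContinuousLinearEquiv.refl ℝ R3 : R3 →L[ℝ] R3) univ K := by
    intro x _ y _
    have h1 : x + clamp t • D x - (y + clamp t • D y)
        - (ContinuousLinearEquiv.refl ℝ R3 : R3 →L[ℝ] R3) (x - y)
        = clamp t • (D x - D y) := by
      simp only [ContinuousLinearEquiv.coe_refl, ContinuousLinearMap.id_apply, smul_sub]; abel
    rw [h1, norm_smul, Real.norm_of_nonneg (clamp_nonneg t)]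
    have h2 := hD.norm_sub_le x y
    have h3 := clamp_le_one t
    nlinarith [norm_nonneg (D x - D y)]
  refine ⟨happ.toHomeomorph _ (Or.inr ?_), fun x => rfl⟩
  have : ‖((ContinuousLinearEquiv.refl ℝ R3).symm : R3 →L[ℝ] R3)‖₊ = 1 := by
    ext; simp
  rw [this]; simpa using hK

/-- A set is equivariantly isotopic to its image under an equivariant map which differs from the
identity by a contraction. -/
theorem EquivIsotopicSets.of_lipschitz {D : R3 → R3} {K : NNReal} (hK : K < 1)
    (hD : LipschitzWith K D) (hτ : ∀ x, D (tau x) = tau (D x)) (A : Set R3) :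
    EquivIsotopicSets A ((fun x => x + D x) '' A) := by
  choose h hh using exists_homeomorph_of_lipschitz hK hD
  have hcoe : ∀ t (x : R3), (h t).onePointCongr (x : S3) = ((h t x : R3) : S3) := fun _ _ => rfl
  have hinf : ∀ t, (h t).onePointCongr (OnePoint.infty : S3) = OnePoint.infty := fun _ => rfl
  refine ⟨fun t => (h t).onePointCongr, ?_, ?_, ?_, ?_⟩
  · rw [continuous_iff_continuousAt]
    rintro ⟨t, x⟩
    induction x using OnePoint.rec with
    | infty =>
      unfold ContinuousAt
      simp only [hinf]
      rw [(OnePoint.hasBasis_nhds_infty (X := R3)).tendsto_right_iff]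
      rintro s ⟨-, hs⟩
      obtain ⟨R, hR⟩ := hs.isBounded.subset_closedBall 0
      have hb : ∀ u (x : R3), (R + ‖D 0‖) / (1 - K) < ‖x‖ → h u x ∉ s := by
        intro u x hx hxs
        have hK' : (0:ℝ) < 1 - K := by simpa using hK
        rw [div_lt_iff₀ hK'] at hx
        have h1 := hR hxs
        rw [mem_closedBall_zero_iff, hh] at h1
        have h2 := hD.norm_sub_le x 0
        have h3 : ‖x‖ ≤ ‖x + clamp u • D x‖ + ‖clamp u • D x‖ := by
          have := norm_sub_le (x + clamp u • D x) (clamp u • D x)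
          simpa using this
        rw [norm_smul, Real.norm_of_nonneg (clamp_nonneg u)] at h3
        have h4 : ‖D x‖ ≤ ‖D x - D 0‖ + ‖D 0‖ := by
          have := norm_add_le (D x - D 0) (D 0); simpa using this
        rw [sub_zero] at h2
        have h5 : clamp u * ‖D x‖ ≤ ‖D x‖ :=
          mul_le_of_le_one_left (norm_nonneg _) (clamp_le_one u)
        nlinarith
      have hopen : ∀ᶠ x : S3 in nhds OnePoint.infty,
          x ∈ (OnePoint.some '' (Metric.closedBall (0:R3) ((R + ‖D 0‖) / (1 - K)))ᶜ ∪
            {OnePoint.infty} : Set S3) :=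
        (OnePoint.hasBasis_nhds_infty (X := R3)).mem_of_mem
          ⟨Metric.isClosed_closedBall, isCompact_closedBall _ _⟩
      have := hopen.prod_inr_nhds t
      filter_upwards [this] with q hq
      rcases hq with ⟨x, hx, hxq⟩ | hq
      · left
        refine ⟨h q.1 x, hb _ _ ?_, ?_⟩
        · simpa using hx
        · rw [← hxq, hcoe]
      · right
        rw [mem_singleton_iff] at hq ⊢
        rw [hq, hinf]
    | coe x =>
      have e1 : Topology.IsOpenEmbedding (Prod.map id (OnePoint.some) : ℝ × R3 → ℝ × S3) :=
        Topology.IsOpenEmbedding.id.prodMap OnePoint.isOpenEmbedding_coe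
      have := e1.continuousAt_iff (x := (t, x)) (g := fun q : ℝ × S3 => (h q.1).onePointCongr q.2)
      refine this.1 ?_
      have e2 : ((fun q : ℝ × S3 => (h q.1).onePointCongr q.2) ∘
          (Prod.map id (OnePoint.some) : ℝ × R3 → ℝ × S3))
          = fun q : ℝ × R3 => ((q.2 + clamp q.1 • D q.2 : R3) : S3) := by
        ext q; simp [hh]
      rw [e2]
      have := hD.continuous
      exact (OnePoint.continuous_coe.comp (continuous_snd.add
        ((continuous_clamp.comp continuous_fst).smul (this.comp continuous_snd)))).continuousAt
  · ext x
    induction x using OnePoint.rec with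
    | infty => rfl
    | coe x => rw [hcoe, hh]; simp [clamp]
  · intro t x
    induction x using OnePoint.rec with
    | infty => rfl
    | coe x => rw [tauS3_coe, hcoe, hcoe, tauS3_coe, hh, hh, hτ, tau_add, tau_smul]
  · have : clamp 1 = 1 := by simp [clamp]
    simp [image_image, embS3, hh, this]

/-! ### Embedded linear graphs and small perturbations -/

/-- The value at parameter `s` of the linear interpolation of `d` along the edge `e`. -/
def lin (d : R3 → R3) (e : R3 × R3) (s : ℝ) : R3 := d e.1 + s • (d e.2 - d e.1)

/-- The underlying set of a collection of edges. -/
def car (E : Set (R3 × R3)) : Set R3 := ⋃ e ∈ E, segment ℝ e.1 e.2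

theorem mem_car {E : Set (R3 × R3)} {x : R3} :
    x ∈ car E ↔ ∃ e ∈ E, x ∈ segment ℝ e.1 e.2 := by simp [car]

/-- The vertices of a collection of edges. -/
def vts (E : Set (R3 × R3)) : Set R3 := {v | ∃ e ∈ E, v = e.1 ∨ v = e.2}

/-- A finite collection of non-degenerate segments meeting only in common endpoints. -/
structure Emb (E : Set (R3 × R3)) : Prop where
  fin : E.Finite
  ne : ∀ e ∈ E, e.1 ≠ e.2
  emb : ∀ e ∈ E, ∀ f ∈ E, e ≠ f → ∀ x ∈ segment ℝ e.1 e.2, x ∈ segment ℝ f.1 f.2 →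
    (x = e.1 ∨ x = e.2) ∧ (x = f.1 ∨ x = f.2)

theorem lin_swap (d : R3 → R3) (e : R3 × R3) (s : ℝ) : lin d e.swap s = lin d e (1 - s) := by
  simp only [lin, Prod.fst_swap, Prod.snd_swap]; module

theorem mem_segment_iff_lin {e : R3 × R3} {x : R3} :
    x ∈ segment ℝ e.1 e.2 ↔ ∃ s ∈ Icc (0:ℝ) 1, lin id e s = x := by
  rw [segment_eq_image']; rfl

/-- Interpolated displacements along `e` and `f` are Lipschitz, uniformly in the displacement. -/
def PairBound (e f : R3 × R3) : Prop :=
  ∃ M : ℝ, 0 ≤ M ∧ ∀ (d : R3 → R3) (δ : ℝ), ‖d e.1‖ ≤ δ → ‖d e.2‖ ≤ δ → ‖d f.1‖ ≤ δ →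
    ‖d f.2‖ ≤ δ → ∀ s ∈ Icc (0:ℝ) 1, ∀ r ∈ Icc (0:ℝ) 1,
      ‖lin d e s - lin d f r‖ ≤ M * δ * ‖lin id e s - lin id f r‖

namespace PairBound

theorem symm {e f : R3 × R3} (h : PairBound e f) : PairBound f e := by
  obtain ⟨M, hM, h⟩ := h
  refine ⟨M, hM, fun d δ h1 h2 h3 h4 s hs r hr => ?_⟩
  have := h d δ h3 h4 h1 h2 r hr s hs
  rwa [norm_sub_rev (lin d f s), norm_sub_rev (lin id f s)]

theorem of_swap {e f : R3 × R3} (h : PairBound e.swap f) : PairBound e f := by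
  obtain ⟨M, hM, h⟩ := h
  refine ⟨M, hM, fun d δ h1 h2 h3 h4 s hs r hr => ?_⟩
  have := h d δ h2 h1 h3 h4 (1 - s) ⟨by linarith [hs.2], by linarith [hs.1]⟩ r hr
  simpa [lin_swap] using this

theorem self {e : R3 × R3} (he : e.1 ≠ e.2) : PairBound e e := by
  have hp : 0 < ‖e.2 - e.1‖ := norm_pos_iff.2 (sub_ne_zero.2 he.symm)
  refine ⟨2 / ‖e.2 - e.1‖, by positivity, fun d δ h1 h2 _ _ s _ r _ => ?_⟩
  have e1 : lin d e s - lin d e r = (s - r) • (d e.2 - d e.1) := by simp only [lin]; module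
  have e2 : lin id e s - lin id e r = (s - r) • (e.2 - e.1) := by simp only [lin, id]; module
  rw [e1, e2, norm_smul, norm_smul]
  have h3 : ‖d e.2 - d e.1‖ ≤ 2 * δ := (norm_sub_le _ _).trans (by linarith)
  calc ‖s - r‖ * ‖d e.2 - d e.1‖ ≤ ‖s - r‖ * (2 * δ) := by gcongr
    _ = _ := by field_simp

theorem norm_lin_le {d : R3 → R3} {e : R3 × R3} {δ s : ℝ} (h1 : ‖d e.1‖ ≤ δ) (h2 : ‖d e.2‖ ≤ δ)
    (hs : s ∈ Icc (0:ℝ) 1) : ‖lin d e s‖ ≤ δ := by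
  have e1 : lin d e s = (1 - s) • d e.1 + s • d e.2 := by simp only [lin]; module
  rw [e1]
  refine (norm_add_le _ _).trans ?_
  rw [norm_smul, norm_smul, Real.norm_of_nonneg hs.1, Real.norm_of_nonneg (by linarith [hs.2])]
  nlinarith [hs.1, hs.2]

theorem of_disjoint {e f : R3 × R3}
    (h : ∀ x ∈ segment ℝ e.1 e.2, x ∉ segment ℝ f.1 f.2) : PairBound e f := by
  have hcont : Continuous fun q : ℝ × ℝ => ‖lin id e q.1 - lin id f q.2‖ := by
    unfold lin; fun_prop
  obtain ⟨q, hq, hmin⟩ := (isCompact_Icc.prod isCompact_Icc :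
    IsCompact (Icc (0:ℝ) 1 ×ˢ Icc (0:ℝ) 1)).exists_isMinOn ⟨(0, 0), by simp⟩ hcont.continuousOn
  have hpos : 0 < ‖lin id e q.1 - lin id f q.2‖ := by
    rw [norm_pos_iff, sub_ne_zero]
    intro heq
    exact h _ (mem_segment_iff_lin.2 ⟨q.1, hq.1, rfl⟩) (mem_segment_iff_lin.2 ⟨q.2, hq.2, heq.symm⟩)
  refine ⟨2 / ‖lin id e q.1 - lin id f q.2‖, by positivity,
    fun d δ h1 h2 h3 h4 s hs r hr => ?_⟩
  have hδ : 0 ≤ δ := (norm_nonneg _).trans h1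
  have h5 : ‖lin id e q.1 - lin id f q.2‖ ≤ ‖lin id e s - lin id f r‖ :=
    hmin (show (s, r) ∈ _ from ⟨hs, hr⟩)
  calc ‖lin d e s - lin d f r‖ ≤ δ + δ :=
        (norm_sub_le _ _).trans (add_le_add (norm_lin_le h1 h2 hs) (norm_lin_le h3 h4 hr))
    _ = 2 / ‖lin id e q.1 - lin id f q.2‖ * δ * ‖lin id e q.1 - lin id f q.2‖ := by
        field_simp; ring
    _ ≤ _ := by gcongr

theorem of_shared {p a b : R3} (ha : a ≠ p) (hb : b ≠ p)
    (h : ∀ x ∈ segment ℝ p a, x ∈ segment ℝ p b → x = p) : PairBound (p, a) (p, b) := by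
  have hcont : Continuous fun s : ℝ => ‖s • (a - p) - (1 - s) • (b - p)‖ := by fun_prop
  obtain ⟨q, hq, hmin⟩ := (isCompact_Icc :
    IsCompact (Icc (0:ℝ) 1)).exists_isMinOn ⟨0, by simp⟩ hcont.continuousOn
  have hpos : 0 < ‖q • (a - p) - (1 - q) • (b - p)‖ := by
    rw [norm_pos_iff, sub_ne_zero]
    intro heq
    have h1 : p + q • (a - p) = p :=
      h _ (by rw [segment_eq_image']; exact ⟨q, hq, rfl⟩)
        (by rw [segment_eq_image', heq]; exact ⟨1 - q, ⟨by linarith [hq.2], by linarith [hq.1]⟩, rfl⟩)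
    have h2 : q • (a - p) = 0 := by simpa using h1
    have h3 : q = 0 := (smul_eq_zero.1 h2).resolve_right (sub_ne_zero.2 ha)
    rw [h3] at heq
    exact sub_ne_zero.2 hb (by simpa using heq.symm)
  set c := ‖q • (a - p) - (1 - q) • (b - p)‖ with hc
  have hbd : ∀ s ≥ 0, ∀ r ≥ 0, c * (s + r) ≤ ‖s • (a - p) - r • (b - p)‖ := by
    intro s hs r hr
    rcases (add_nonneg hs hr).eq_or_lt with h0 | h0
    · have h1 : s = 0 := by linarith
      have h2 : r = 0 := by linarith
      simp [h1, h2]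
    · have h1 := hmin (show s / (s + r) ∈ _ from ⟨by positivity, by rw [div_le_one h0]; linarith⟩)
      have e1 : s • (a - p) - r • (b - p)
          = (s + r) • ((s / (s + r)) • (a - p) - (1 - s / (s + r)) • (b - p)) := by
        rw [smul_sub (s + r), smul_smul, smul_smul]
        congr 2 <;> field_simp
        ring
      rw [e1, norm_smul, Real.norm_of_nonneg h0.le, mul_comm]
      exact mul_le_mul_of_nonneg_left h1 h0.le
  refine ⟨2 / c, by positivity, fun d δ h1 h2 h3 h4 s hs r hr => ?_⟩
  have hδ : 0 ≤ δ := (norm_nonneg _).trans h1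
  have e1 : lin d (p, a) s - lin d (p, b) r = s • (d a - d p) - r • (d b - d p) := by
    simp only [lin]; module
  have e2 : lin id (p, a) s - lin id (p, b) r = s • (a - p) - r • (b - p) := by
    simp only [lin, id]; module
  rw [e1, e2]
  have n1 : ‖d a - d p‖ ≤ 2 * δ := (norm_sub_le _ _).trans (by simp at h1 h2; linarith)
  have n2 : ‖d b - d p‖ ≤ 2 * δ := (norm_sub_le _ _).trans (by simp at h3 h4; linarith)
  calc ‖s • (d a - d p) - r • (d b - d p)‖ ≤ s * (2 * δ) + r * (2 * δ) := by
        refine (norm_sub_le _ _).trans ?_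
        rw [norm_smul, norm_smul, Real.norm_of_nonneg hs.1, Real.norm_of_nonneg hr.1]
        have := hs.1; have := hr.1
        gcongr
    _ = 2 / c * δ * (c * (s + r)) := by field_simp
    _ ≤ _ := by gcongr; exact hbd s hs.1 r hr.1

end PairBound

theorem Emb.pairBound {E : Set (R3 × R3)} (hE : Emb E) {e f : R3 × R3} (he : e ∈ E) (hf : f ∈ E) :
    PairBound e f := by
  by_cases hef : e = f
  · subst hef; exact PairBound.self (hE.ne e he)
  by_cases hd : ∀ x ∈ segment ℝ e.1 e.2, x ∉ segment ℝ f.1 f.2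
  · exact PairBound.of_disjoint hd
  push Not at hd
  obtain ⟨p, hpe, hpf⟩ := hd
  have huniq : ∀ x ∈ segment ℝ e.1 e.2, x ∈ segment ℝ f.1 f.2 → x = p := by
    intro x hxe hxf
    by_contra hxp
    have hm : ∀ u v : R3, x ∈ segment ℝ u v → p ∈ segment ℝ u v →
        midpoint ℝ x p ∈ segment ℝ u v := fun u v h1 h2 =>
      (convex_segment u v).segment_subset h1 h2 (midpoint_mem_segment x p)
    have h1 := (hE.emb e he f hf hef _ (hm _ _ hxe hpe) (hm _ _ hxf hpf)).1
    have h2 := (hE.emb e he f hf hef x hxe hxf).1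
    have h3 := (hE.emb e he f hf hef p hpe hpf).1
    have n1 : midpoint ℝ x p ≠ x := by simpa [midpoint_eq_left_iff] using hxp
    have n2 : midpoint ℝ x p ≠ p := by simpa [midpoint_eq_right_iff] using hxp
    rcases h1 with h1 | h1 <;> rcases h2 with h2 | h2 <;> rcases h3 with h3 | h3 <;> simp_all
  have hne := hE.ne e he
  have hnf := hE.ne f hf
  obtain ⟨h1, h2⟩ := hE.emb e he f hf hef p hpe hpf
  have key : ∀ e' f' : R3 × R3, p = e'.1 → p = f'.1 → e'.1 ≠ e'.2 → f'.1 ≠ f'.2 →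
      (∀ x ∈ segment ℝ e'.1 e'.2, x ∈ segment ℝ f'.1 f'.2 → x = p) → PairBound e' f' := by
    rintro ⟨a, b⟩ ⟨c, d⟩ rfl h3 h4 h5 h6
    simp only at h3 h4 h5 h6
    subst h3
    exact PairBound.of_shared h4.symm h5.symm h6
  rcases h1 with h1 | h1 <;> rcases h2 with h2 | h2
  · exact key e f h1 h2 hne hnf huniq
  · refine (PairBound.of_swap (PairBound.symm (key e f.swap h1 h2 hne hnf.symm ?_))).symm
    simpa [segment_symm] using huniq
  · refine PairBound.of_swap (key e.swap f h1 h2 hne.symm hnf ?_)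
    simpa [segment_symm] using huniq
  · refine PairBound.of_swap (PairBound.of_swap (PairBound.symm
      (key e.swap f.swap h1 h2 hne.symm hnf.symm ?_))).symm
    simpa [segment_symm] using huniq

/-- The edges are permuted by the orientation-reversing action of `tau`. -/
def TauSym (E : Set (R3 × R3)) : Prop := ∀ e ∈ E, (tau e.2, tau e.1) ∈ E

theorem tau_sub (p q : R3) : tau (p - q) = tau p - tau q := by
  ext <;> simp [tau] <;> ring

theorem norm_tau (p : R3) : ‖tau p‖ = ‖p‖ := by
  simp [tau, Prod.norm_def]

theorem tau_lin (d : R3 → R3) (e : R3 × R3) (s : ℝ) (h1 : d (tau e.1) = tau (d e.1))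
    (h2 : d (tau e.2) = tau (d e.2)) :
    lin d (tau e.2, tau e.1) (1 - s) = tau (lin d e s) := by
  simp only [lin, h1, h2, tau_add, tau_smul, tau_sub]; module

theorem lipschitz_extend {s : Set R3} {f : R3 → R3} {K : NNReal} (h : LipschitzOnWith K f s) :
    ∃ g : R3 → R3, LipschitzWith K g ∧ EqOn f g s := by
  have h1 : LipschitzOnWith K (fun x => (f x).1) s := by
    simpa [Function.comp_def] using LipschitzWith.prod_fst.comp_lipschitzOnWith h
  have h' : LipschitzOnWith K (fun x => (f x).2) s := by
    simpa [Function.comp_def] using LipschitzWith.prod_snd.comp_lipschitzOnWith h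
  have h2 : LipschitzOnWith K (fun x => (f x).2.1) s := by
    simpa [Function.comp_def] using LipschitzWith.prod_fst.comp_lipschitzOnWith h'
  have h3 : LipschitzOnWith K (fun x => (f x).2.2) s := by
    simpa [Function.comp_def] using LipschitzWith.prod_snd.comp_lipschitzOnWith h'
  obtain ⟨g1, l1, e1⟩ := h1.extend_real
  obtain ⟨g2, l2, e2⟩ := h2.extend_real
  obtain ⟨g3, l3, e3⟩ := h3.extend_real
  refine ⟨fun x => (g1 x, g2 x, g3 x), ?_, fun x hx => ?_⟩
  · simpa using l1.prodMk (l2.prodMk l3)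
  · exact Prod.ext (e1 hx) (Prod.ext (e2 hx) (e3 hx))

theorem lipschitz_symmetrize {g : R3 → R3} {K : NNReal} (h : LipschitzWith K g) :
    LipschitzWith K (fun x => (1/2 : ℝ) • (g x + tau (g (tau x)))) := by
  refine LipschitzWith.of_dist_le_mul fun x y => ?_
  rw [dist_eq_norm, dist_eq_norm]
  have e1 : (1/2 : ℝ) • (g x + tau (g (tau x))) - (1/2 : ℝ) • (g y + tau (g (tau y)))
      = (1/2 : ℝ) • ((g x - g y) + tau (g (tau x) - g (tau y))) := by
    rw [tau_sub]; module
  have h1 := h.norm_sub_le x y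
  have h2 := h.norm_sub_le (tau x) (tau y)
  rw [← tau_sub, norm_tau] at h2
  rw [e1, norm_smul]
  have h3 := norm_add_le (g x - g y) (tau (g (tau x) - g (tau y)))
  rw [norm_tau] at h3
  norm_num
  linarith

/-- The image of a collection of edges under a map of the vertices. -/
def imgE {V : Type*} (P : V → R3) (E : Set (V × V)) : Set (R3 × R3) := Prod.map P P '' E

theorem lin_add (d d' : R3 → R3) (e : R3 × R3) (s : ℝ) :
    lin d e s + lin d' e s = lin (fun v => d v + d' v) e s := by
  simp only [lin]; module

theorem lin_map (P : R3 → R3) (e : R3 × R3) (s : ℝ) :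
    lin id (Prod.map P P e) s = lin P e s := rfl

theorem exists_uniform_pairBound {E : Set (R3 × R3)} (hE : Emb E) :
    ∃ M : ℝ, 0 ≤ M ∧ ∀ (d : R3 → R3) (δ : ℝ), (∀ v ∈ vts E, ‖d v‖ ≤ δ) →
      ∀ e ∈ E, ∀ f ∈ E, ∀ s ∈ Icc (0:ℝ) 1, ∀ r ∈ Icc (0:ℝ) 1,
      ‖lin d e s - lin d f r‖ ≤ M * δ * ‖lin id e s - lin id f r‖ := by
  have hp : ∀ p : (R3 × R3) × (R3 × R3), ∃ M : ℝ, p ∈ E ×ˢ E →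
      ∀ (d : R3 → R3) (δ : ℝ), (∀ v ∈ vts E, ‖d v‖ ≤ δ) →
      ∀ s ∈ Icc (0:ℝ) 1, ∀ r ∈ Icc (0:ℝ) 1,
      ‖lin d p.1 s - lin d p.2 r‖ ≤ M * δ * ‖lin id p.1 s - lin id p.2 r‖ := by
    rintro ⟨e, f⟩
    by_cases h : (e, f) ∈ E ×ˢ E
    · obtain ⟨M, _, hM⟩ := hE.pairBound h.1 h.2
      exact ⟨M, fun _ d δ hd => hM d δ (hd _ ⟨e, h.1, Or.inl rfl⟩) (hd _ ⟨e, h.1, Or.inr rfl⟩)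
        (hd _ ⟨f, h.2, Or.inl rfl⟩) (hd _ ⟨f, h.2, Or.inr rfl⟩)⟩
    · exact ⟨0, fun h' => absurd h' h⟩
  choose M hM using hp
  obtain ⟨C, hC⟩ := ((hE.fin.prod hE.fin).image M).bddAbove
  refine ⟨max C 0, le_max_right _ _, fun d δ hd e he f hf s hs r hr => ?_⟩
  have hδ : 0 ≤ δ := (norm_nonneg _).trans (hd _ ⟨e, he, Or.inl rfl⟩)
  have h1 : M (e, f) ≤ max C 0 :=
    (hC (mem_image_of_mem M (show (e, f) ∈ E ×ˢ E from ⟨he, hf⟩))).trans (le_max_left _ _)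
  refine (hM (e, f) ⟨he, hf⟩ d δ hd s hs r hr).trans ?_
  gcongr

/-- Small equivariant perturbations of the vertices of an embedded graph are realized by
equivariant ambient isotopies. -/
theorem Emb.exists_perturb {E : Set (R3 × R3)} (hE : Emb E) (hS : TauSym E) :
    ∃ δ > 0, ∀ P : R3 → R3, (∀ v ∈ vts E, ‖P v - v‖ ≤ δ) →
      (∀ v ∈ vts E, P (tau v) = tau (P v)) →
      InjOn P (vts E) ∧ Emb (imgE P E) ∧ EquivIsotopicSets (car E) (car (imgE P E)) := by
  obtain ⟨M, hM, hb⟩ := exists_uniform_pairBound hE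
  refine ⟨1 / (2 * (M + 1)), by positivity, fun P hP hτ => ?_⟩
  set δ : ℝ := 1 / (2 * (M + 1)) with hδ
  set d : R3 → R3 := fun v => P v - v with hd
  have hK : M * δ ≤ 1 / 2 := by
    rw [hδ, mul_one_div, div_le_div_iff₀ (by positivity) (by positivity)]; linarith
  have hb' : ∀ e ∈ E, ∀ f ∈ E, ∀ s ∈ Icc (0:ℝ) 1, ∀ r ∈ Icc (0:ℝ) 1,
      ‖lin d e s - lin d f r‖ ≤ 1 / 2 * ‖lin id e s - lin id f r‖ := by
    intro e he f hf s hs r hr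
    exact (hb d δ hP e he f hf s hs r hr).trans (by gcongr)
  have hex : ∀ x, ∃ y, x ∈ car E → ∃ e ∈ E, ∃ s ∈ Icc (0:ℝ) 1, lin id e s = x ∧ lin d e s = y := by
    intro x
    by_cases hx : x ∈ car E
    · obtain ⟨e, he, hxe⟩ := mem_car.1 hx
      obtain ⟨s, hs, hxs⟩ := mem_segment_iff_lin.1 hxe
      exact ⟨lin d e s, fun _ => ⟨e, he, s, hs, hxs, rfl⟩⟩
    · exact ⟨0, fun h => absurd h hx⟩
  choose D0 hD0 using hex
  have hlip : LipschitzOnWith (1/2 : NNReal) D0 (car E) := by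
    refine LipschitzOnWith.of_dist_le_mul fun x hx y hy => ?_
    obtain ⟨e, he, s, hs, h1, h2⟩ := hD0 x hx
    obtain ⟨f, hf, r, hr, h3, h4⟩ := hD0 y hy
    rw [dist_eq_norm, dist_eq_norm, ← h2, ← h4, ← h1, ← h3]
    simpa using hb' e he f hf s hs r hr
  have hmem : ∀ e ∈ E, ∀ s ∈ Icc (0:ℝ) 1, lin id e s ∈ car E := fun e he s hs =>
    mem_car.2 ⟨e, he, mem_segment_iff_lin.2 ⟨s, hs, rfl⟩⟩
  have hval : ∀ e ∈ E, ∀ s ∈ Icc (0:ℝ) 1, D0 (lin id e s) = lin d e s := by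
    intro e he s hs
    obtain ⟨f, hf, r, hr, h3, h4⟩ := hD0 _ (hmem e he s hs)
    have := hb' e he f hf s hs r hr
    rw [h3, sub_self, norm_zero, mul_zero] at this
    rw [← h4]
    exact (sub_eq_zero.1 (norm_le_zero_iff.1 this)).symm
  obtain ⟨D1, l1, e1⟩ := lipschitz_extend hlip
  set D : R3 → R3 := fun x => (1/2 : ℝ) • (D1 x + tau (D1 (tau x))) with hD
  have l2 : LipschitzWith (1/2 : NNReal) D := lipschitz_symmetrize l1
  have hDτ : ∀ x, D (tau x) = tau (D x) := by
    intro x; simp only [hD, tau_smul, tau_add, tau_tau, add_comm]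
  have hdτ : ∀ v ∈ vts E, d (tau v) = tau (d v) := fun v hv => by
    simp only [hd, hτ v hv, tau_sub]
  have hDval : ∀ e ∈ E, ∀ s ∈ Icc (0:ℝ) 1, D (lin id e s) = lin d e s := by
    intro e he s hs
    have h1 := hS e he
    have hs' : 1 - s ∈ Icc (0:ℝ) 1 := ⟨by linarith [hs.2], by linarith [hs.1]⟩
    have h2 : tau (lin id e s) = lin id (tau e.2, tau e.1) (1 - s) :=
      (tau_lin id e s rfl rfl).symm
    have h3 := hdτ e.1 ⟨e, he, Or.inl rfl⟩
    have h4 := hdτ e.2 ⟨e, he, Or.inr rfl⟩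
    simp only [hD]
    rw [← e1 (hmem e he s hs), h2, ← e1 (hmem _ h1 _ hs'), hval e he s hs, hval _ h1 _ hs',
      tau_lin d e s h3 h4, tau_tau]
    module
  set h : R3 → R3 := fun x => x + D x with hh
  have hhval : ∀ e ∈ E, ∀ s ∈ Icc (0:ℝ) 1, h (lin id e s) = lin id (Prod.map P P e) s := by
    intro e he s hs
    simp only [hh]
    rw [hDval e he s hs, lin_add, lin_map]
    congr 1
    ext1 v; simp [hd]
  have hhinj : Function.Injective h := by
    intro x y hxy
    have h1 := l2.norm_sub_le x y
    have h2 : D x - D y = -(x - y) := by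
      simp only [hh] at hxy
      have : D x - D y = (x + D x) - (y + D y) - (x - y) := by abel
      rw [this, hxy]; simp
    rw [h2, norm_neg] at h1
    have h3 : ‖x - y‖ ≤ 0 := by
      have : ((1/2 : NNReal) : ℝ) = 1/2 := by simp
      rw [this] at h1; linarith
    exact sub_eq_zero.1 (norm_le_zero_iff.1 h3)
  have hvt : ∀ v ∈ vts E, h v = P v := by
    rintro v ⟨e, he, rfl | rfl⟩
    · have := hhval e he 0 (by simp); simpa [lin] using this
    · have := hhval e he 1 (by simp); simpa [lin] using this
  have hseg : ∀ e ∈ E, ∀ x ∈ segment ℝ (P e.1) (P e.2), ∃ u ∈ segment ℝ e.1 e.2, h u = x := by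
    intro e he x hx
    obtain ⟨s, hs, hxs⟩ := (mem_segment_iff_lin (e := Prod.map P P e)).1 hx
    exact ⟨lin id e s, mem_segment_iff_lin.2 ⟨s, hs, rfl⟩, by rw [hhval e he s hs, hxs]⟩
  refine ⟨?_, ⟨hE.fin.image _, ?_, ?_⟩, ?_⟩
  · intro u hu v hv huv
    rw [← hvt u hu, ← hvt v hv] at huv
    exact hhinj huv
  · rintro _ ⟨e, he, rfl⟩ heq
    simp only [Prod.map_fst, Prod.map_snd] at heq
    rw [← hvt e.1 ⟨e, he, Or.inl rfl⟩, ← hvt e.2 ⟨e, he, Or.inr rfl⟩] at heq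
    exact hE.ne e he (hhinj heq)
  · rintro _ ⟨e, he, rfl⟩ _ ⟨f, hf, rfl⟩ hne x hxe hxf
    obtain ⟨u, hu, rfl⟩ := hseg e he x hxe
    obtain ⟨u', hu', hux⟩ := hseg f hf _ hxf
    obtain rfl := hhinj hux
    have := hE.emb e he f hf (fun hh => hne (by rw [hh])) u' hu hu'
    simp only [Prod.map_fst, Prod.map_snd]
    rw [← hvt e.1 ⟨e, he, Or.inl rfl⟩, ← hvt e.2 ⟨e, he, Or.inr rfl⟩,
      ← hvt f.1 ⟨f, hf, Or.inl rfl⟩, ← hvt f.2 ⟨f, hf, Or.inr rfl⟩]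
    simpa only [hhinj.eq_iff] using this
  · have : car (imgE P E) = h '' car E := by
      ext x
      constructor
      · intro hx
        obtain ⟨_, ⟨e, he, rfl⟩, hxe⟩ := mem_car.1 hx
        obtain ⟨u, hu, rfl⟩ := hseg e he x hxe
        exact ⟨u, mem_car.2 ⟨e, he, hu⟩, rfl⟩
      · rintro ⟨u, hu, rfl⟩
        obtain ⟨e, he, hxe⟩ := mem_car.1 hu
        obtain ⟨s, hs, rfl⟩ := mem_segment_iff_lin.1 hxe
        rw [hhval e he s hs]
        exact mem_car.2 ⟨_, ⟨e, he, rfl⟩, mem_segment_iff_lin.2 ⟨s, hs, rfl⟩⟩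
    rw [this]
    refine EquivIsotopicSets.of_lipschitz ?_ l2 hDτ _
    rw [← NNReal.coe_lt_coe]; norm_num

/-- A continuous equivariant family of linear embeddings of a graph is realized by an equivariant
ambient isotopy. -/
theorem equivIsotopic_of_family {V : Type*} (σ : V → V) (E : Set (V × V)) (P : ℝ → V → R3)
    (hE : ∀ e ∈ E, (σ e.2, σ e.1) ∈ E) (hc : ∀ v, Continuous fun t => P t v)
    (hσ : ∀ t v, P t (σ v) = tau (P t v))
    (hinj : ∀ t ∈ Icc (0:ℝ) 1, InjOn (P t) {v | ∃ e ∈ E, v = e.1 ∨ v = e.2})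
    (hemb : ∀ t ∈ Icc (0:ℝ) 1, Emb (imgE (P t) E)) :
    EquivIsotopicSets (car (imgE (P 0) E)) (car (imgE (P 1) E)) := by
  classical
  have hfin : E.Finite := by
    have h0 : (0:ℝ) ∈ Icc (0:ℝ) 1 := by simp
    refine Set.Finite.of_finite_image (hemb 0 h0).fin ?_
    intro e he f hf hef
    simp only [Prod.map, Prod.mk.injEq] at hef
    exact Prod.ext (hinj 0 h0 ⟨e, he, Or.inl rfl⟩ ⟨f, hf, Or.inl rfl⟩ hef.1)
      (hinj 0 h0 ⟨e, he, Or.inr rfl⟩ ⟨f, hf, Or.inr rfl⟩ hef.2)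
  have hsym : ∀ t, TauSym (imgE (P t) E) := by
    rintro t _ ⟨e, he, rfl⟩
    exact ⟨_, hE e he, by simp [hσ]⟩
  refine (isPreconnected_Icc (a := (0:ℝ)) (b := 1)).induction₂
    (fun t t' => EquivIsotopicSets (car (imgE (P t) E)) (car (imgE (P t') E)))
    (fun t ht => ?_) (fun _ _ _ _ _ _ => EquivIsotopicSets.trans)
    (fun _ _ _ _ => EquivIsotopicSets.symm) (x := (0:ℝ)) (y := 1) (by simp) (by simp)
  obtain ⟨δ, hδ, hpert⟩ := (hemb t ht).exists_perturb (hsym t)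
  have hev : ∀ᶠ t' in nhds t, ∀ e ∈ E, ‖P t' e.1 - P t e.1‖ < δ ∧ ‖P t' e.2 - P t e.2‖ < δ := by
    rw [Filter.eventually_all_finite hfin]
    intro e _
    have hv : ∀ v, ∀ᶠ t' in nhds t, ‖P t' v - P t v‖ < δ := fun v => by
      have := (hc v).continuousAt.tendsto (x := t)
      have := Metric.tendsto_nhds.1 this δ hδ
      simpa [dist_eq_norm] using this
    exact (hv _).and (hv _)
  filter_upwards [nhdsWithin_le_nhds hev] with t' ht'
  have hex : ∀ x, ∃ y, ∀ v, (∃ e ∈ E, v = e.1 ∨ v = e.2) → P t v = x → y = P t' v := by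
    intro x
    by_cases hx : ∃ v, (∃ e ∈ E, v = e.1 ∨ v = e.2) ∧ P t v = x
    · obtain ⟨v, hv, rfl⟩ := hx
      exact ⟨P t' v, fun w hw hwv => by rw [hinj t ht hw hv hwv]⟩
    · push Not at hx
      exact ⟨0, fun v hv h => absurd h (hx v hv)⟩
  choose Q hQ using hex
  have hvt : ∀ x ∈ vts (imgE (P t) E), ∃ v, (∃ e ∈ E, v = e.1 ∨ v = e.2) ∧ P t v = x := by
    rintro x ⟨_, ⟨e, he, rfl⟩, rfl | rfl⟩
    · exact ⟨e.1, ⟨e, he, Or.inl rfl⟩, rfl⟩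
    · exact ⟨e.2, ⟨e, he, Or.inr rfl⟩, rfl⟩
  obtain ⟨-, -, h3⟩ := hpert Q (fun x hx => by
      obtain ⟨v, hv, rfl⟩ := hvt x hx
      rw [hQ _ v hv rfl]
      obtain ⟨e, he, rfl | rfl⟩ := hv
      · exact (ht' e he).1.le
      · exact (ht' e he).2.le) (fun x hx => by
      obtain ⟨v, hv, rfl⟩ := hvt x hx
      have hv' : ∃ e ∈ E, σ v = e.1 ∨ σ v = e.2 := by
        obtain ⟨e, he, rfl | rfl⟩ := hv
        · exact ⟨_, hE e he, Or.inr rfl⟩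
        · exact ⟨_, hE e he, Or.inl rfl⟩
      rw [hQ _ v hv rfl, ← hσ, hQ _ (σ v) hv' rfl, hσ])
  have : imgE Q (imgE (P t) E) = imgE (P t') E := by
    simp only [imgE, image_image]
    refine image_congr fun e he => ?_
    simp only [Prod.map, hQ _ e.1 ⟨e, he, Or.inl rfl⟩ rfl, hQ _ e.2 ⟨e, he, Or.inr rfl⟩ rfl]
  rwa [this] at h3

/-! ### Strongly involutive links as sets of edges -/

/-- The image of an oriented edge under the orientation-reversing action of `tau`. -/
def rv (e : R3 × R3) : R3 × R3 := (tau e.2, tau e.1)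

theorem rv_rv (e : R3 × R3) : rv (rv e) = e := by simp [rv, tau_tau]

theorem tau_eq_iff {p q : R3} : tau p = q ↔ p = tau q :=
  ⟨fun h => by rw [← h, tau_tau], fun h => by rw [h, tau_tau]⟩

theorem tau_injective : Function.Injective tau := fun p q h => by
  rw [← tau_tau p, h, tau_tau]

theorem tau_mem_segment {a b x : R3} (h : x ∈ segment ℝ a b) :
    tau x ∈ segment ℝ (tau a) (tau b) := by
  obtain ⟨s, t, hs, ht, hst, rfl⟩ := h
  exact ⟨s, t, hs, ht, hst, by rw [tau_add, tau_smul, tau_smul]⟩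

theorem mem_segment_rv {e : R3 × R3} {x : R3} :
    x ∈ segment ℝ (rv e).1 (rv e).2 ↔ tau x ∈ segment ℝ e.1 e.2 := by
  constructor
  · intro h
    have := tau_mem_segment h
    rw [segment_symm]
    simpa [rv, tau_tau] using this
  · intro h
    have := tau_mem_segment h
    rw [segment_symm, tau_tau] at this
    exact this

/-- A collection of edges together with its `tau`-images. -/
def dbl (W : Set (R3 × R3)) : Set (R3 × R3) := W ∪ rv '' W

theorem mem_dbl {W : Set (R3 × R3)} {e : R3 × R3} : e ∈ dbl W ↔ e ∈ W ∨ rv e ∈ W := by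
  constructor
  · rintro (h | ⟨f, hf, rfl⟩)
    · exact Or.inl h
    · right; rwa [rv_rv]
  · rintro (h | h)
    · exact Or.inl h
    · exact Or.inr ⟨_, h, rv_rv e⟩

theorem tauSym_dbl (W : Set (R3 × R3)) : TauSym (dbl W) := fun e he => by
  have : rv e ∈ dbl W := by rw [mem_dbl, rv_rv]; exact (mem_dbl.1 he).symm
  exact this

theorem TauSym.union {A B : Set (R3 × R3)} (hA : TauSym A) (hB : TauSym B) : TauSym (A ∪ B) :=
  fun e he => he.imp (hA e) (hB e)

theorem dbl_union (A B : Set (R3 × R3)) : dbl (A ∪ B) = dbl A ∪ dbl B := by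
  ext e; simp only [mem_dbl, mem_union]; tauto

theorem car_union (A B : Set (R3 × R3)) : car (A ∪ B) = car A ∪ car B := by
  ext x; simp only [mem_car, mem_union]; constructor
  · rintro ⟨e, he | he, h⟩
    exacts [Or.inl ⟨e, he, h⟩, Or.inr ⟨e, he, h⟩]
  · rintro (⟨e, he, h⟩ | ⟨e, he, h⟩)
    exacts [⟨e, Or.inl he, h⟩, ⟨e, Or.inr he, h⟩]

theorem car_mono {A B : Set (R3 × R3)} (h : A ⊆ B) : car A ⊆ car B :=
  fun _ hx => by
    obtain ⟨e, he, hxe⟩ := mem_car.1 hx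
    exact mem_car.2 ⟨e, h he, hxe⟩

theorem mem_car_dbl {W : Set (R3 × R3)} {x : R3} : x ∈ car (dbl W) ↔ x ∈ car W ∨ tau x ∈ car W := by
  simp only [mem_car, mem_dbl]
  constructor
  · rintro ⟨e, he | he, h⟩
    · exact Or.inl ⟨e, he, h⟩
    · refine Or.inr ⟨_, he, mem_segment_rv.2 (by rwa [tau_tau])⟩
  · rintro (⟨e, he, h⟩ | ⟨e, he, h⟩)
    · exact ⟨e, Or.inl he, h⟩
    · exact ⟨rv e, Or.inr (by rwa [rv_rv]), mem_segment_rv.2 h⟩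

theorem TauSym.tau_mem_car {X : Set (R3 × R3)} (h : TauSym X) {x : R3} (hx : x ∈ car X) :
    tau x ∈ car X := by
  obtain ⟨e, he, hxe⟩ := mem_car.1 hx
  exact mem_car.2 ⟨rv e, h e he, mem_segment_rv.2 (by rwa [tau_tau])⟩

theorem vts_subset_car {X : Set (R3 × R3)} : vts X ⊆ car X := by
  rintro v ⟨e, he, rfl | rfl⟩
  · exact mem_car.2 ⟨e, he, left_mem_segment _ _ _⟩
  · exact mem_car.2 ⟨e, he, right_mem_segment _ _ _⟩

/-- Every vertex has exactly one incoming and one outgoing edge. -/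
structure Comb (E : Set (R3 × R3)) : Prop where
  out : ∀ e ∈ E, ∀ f ∈ E, e.1 = f.1 → e = f
  inn : ∀ e ∈ E, ∀ f ∈ E, e.2 = f.2 → e = f
  next : ∀ e ∈ E, ∃ f ∈ E, f.1 = e.2
  prev : ∀ e ∈ E, ∃ f ∈ E, f.2 = e.1

/-- The edge set of a strongly involutive polygonal link. -/
structure Lk (E : Set (R3 × R3)) : Prop where
  emb : Emb E
  comb : Comb E
  sym : TauSym E

theorem Comb.replace {X : Set (R3 × R3)} {a b c : R3} (h : Comb (insert (a, c) X))
    (hac : (a, c) ∉ X) (hb : b ∉ vts (insert (a, c) X)) :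
    Comb (insert (a, b) (insert (b, c) X)) := by
  have hb1 : ∀ e ∈ insert (a, c) X, b ≠ e.1 := fun e he h => hb ⟨e, he, Or.inl h⟩
  have hb2 : ∀ e ∈ insert (a, c) X, b ≠ e.2 := fun e he h => hb ⟨e, he, Or.inr h⟩
  have m0 : (a, c) ∈ insert (a, c) X := mem_insert _ _
  have mX : ∀ e ∈ X, e ∈ insert (a, c) X := fun e he => mem_insert_of_mem _ he
  have oa : ∀ e ∈ X, e.1 ≠ a := fun e he h1 => hac (h.out _ m0 e (mX e he) h1.symm ▸ he)
  have ic : ∀ e ∈ X, e.2 ≠ c := fun e he h1 => hac (h.inn _ m0 e (mX e he) h1.symm ▸ he)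
  have ba := hb1 _ m0
  have bc := hb2 _ m0
  simp only at ba bc
  refine ⟨?_, ?_, ?_, ?_⟩
  · rintro e (rfl | rfl | he) f (rfl | rfl | hf) hef
    all_goals first | rfl | skip
    · exact absurd hef.symm ba
    · exact absurd hef.symm (oa f hf)
    · exact absurd hef ba
    · exact absurd hef (hb1 f (mX f hf))
    · exact absurd hef (oa e he)
    · exact absurd hef.symm (hb1 e (mX e he))
    · exact h.out e (mX e he) f (mX f hf) hef
  · rintro e (rfl | rfl | he) f (rfl | rfl | hf) hef
    all_goals first | rfl | skip
    · exact absurd hef bc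
    · exact absurd hef (hb2 f (mX f hf))
    · exact absurd hef.symm bc
    · exact absurd hef.symm (ic f hf)
    · exact absurd hef.symm (hb2 e (mX e he))
    · exact absurd hef (ic e he)
    · exact h.inn e (mX e he) f (mX f hf) hef
  · have key : ∀ e ∈ insert (a, c) X, ∃ f ∈ insert (a, b) (insert (b, c) X), f.1 = e.2 := by
      intro e he
      obtain ⟨f, rfl | hf, hfe⟩ := h.next e he
      · exact ⟨(a, b), by simp, hfe⟩
      · exact ⟨f, by simp [hf], hfe⟩
    rintro e (rfl | rfl | he)
    · exact ⟨(b, c), by simp, rfl⟩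
    · exact key (a, c) m0
    · exact key e (mX e he)
  · have key : ∀ e ∈ insert (a, c) X, ∃ f ∈ insert (a, b) (insert (b, c) X), f.2 = e.1 := by
      intro e he
      obtain ⟨f, rfl | hf, hfe⟩ := h.prev e he
      · exact ⟨(b, c), by simp, hfe⟩
      · exact ⟨f, by simp [hf], hfe⟩
    rintro e (rfl | rfl | he)
    · exact key (a, c) m0
    · exact ⟨(a, b), by simp, rfl⟩
    · exact key e (mX e he)

/-- `e` and `f` meet only in common endpoints. -/
def Meet (e f : R3 × R3) : Prop := ∀ x ∈ segment ℝ e.1 e.2, x ∈ segment ℝ f.1 f.2 →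
    (x = e.1 ∨ x = e.2) ∧ (x = f.1 ∨ x = f.2)

theorem Meet.symm {e f : R3 × R3} (h : Meet e f) : Meet f e :=
  fun x h1 h2 => (h x h2 h1).symm

theorem Meet.rv {e f : R3 × R3} (h : Meet e f) : Meet (rv e) (rv f) := fun x h1 h2 => by
  have := h (tau x) (mem_segment_rv.1 h1) (mem_segment_rv.1 h2)
  simp only [tau_eq_iff] at this
  exact ⟨this.1.symm, this.2.symm⟩

theorem Emb.mono {A B : Set (R3 × R3)} (hB : Emb B) (h : A ⊆ B) : Emb A :=
  ⟨hB.fin.subset h, fun e he => hB.ne e (h he), fun e he f hf => hB.emb e (h he) f (h hf)⟩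

theorem Emb.union {A B : Set (R3 × R3)} (hA : Emb A) (hB : Emb B)
    (h : ∀ e ∈ A, ∀ f ∈ B, Meet e f) : Emb (A ∪ B) := by
  refine ⟨hA.fin.union hB.fin, ?_, ?_⟩
  · rintro e (he | he)
    exacts [hA.ne e he, hB.ne e he]
  · rintro e (he | he) f (hf | hf) hne
    · exact hA.emb e he f hf hne
    · exact h e he f hf
    · exact (h f hf e he).symm
    · exact hB.emb e he f hf hne

theorem Emb.dbl {W : Set (R3 × R3)} (hW : Emb W) (h : ∀ e ∈ W, ∀ f ∈ W, Meet e (rv f)) :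
    Emb (dbl W) := by
  refine hW.union ⟨hW.fin.image _, ?_, ?_⟩ ?_
  · rintro _ ⟨e, he, rfl⟩ h1
    exact hW.ne e he (tau_injective h1).symm
  · rintro _ ⟨e, he, rfl⟩ _ ⟨f, hf, rfl⟩ hne
    have : Meet e f := hW.emb e he f hf (fun h => hne (by rw [h]))
    exact this.rv
  · rintro e he _ ⟨f, hf, rfl⟩
    exact h e he f hf

/-- The corner `a b c` is not folded. -/
def Nd (a b c : R3) : Prop := ∀ s ≥ (0:ℝ), ∀ r ≥ (0:ℝ), s • (a - b) = r • (c - b) → s = 0 ∧ r = 0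

namespace Nd

variable {a b c : R3}

theorem symm (h : Nd a b c) : Nd c b a := fun s hs r hr e => (h r hr s hs e.symm).symm

theorem left_ne (h : Nd a b c) : a ≠ b := by
  rintro rfl
  have := (h 1 zero_le_one 0 le_rfl (by simp)).1
  norm_num at this

theorem right_ne (h : Nd a b c) : c ≠ b := h.symm.left_ne

theorem notMem (h : Nd a b c) : c ∉ segment ℝ a b := by
  intro hc
  rw [segment_symm, segment_eq_image'] at hc
  obtain ⟨s, hs, e⟩ := hc
  have := (h s hs.1 1 zero_le_one (by rw [← e]; module)).2
  norm_num at this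

theorem notMem' (h : Nd a b c) : a ∉ segment ℝ b c := by
  rw [segment_symm]; exact h.symm.notMem

theorem eq_of_mem (h : Nd a b c) {x : R3} (h1 : x ∈ segment ℝ a b) (h2 : x ∈ segment ℝ b c) :
    x = b := by
  rw [segment_symm, segment_eq_image'] at h1
  rw [segment_eq_image'] at h2
  obtain ⟨s, hs, rfl⟩ := h1
  obtain ⟨r, hr, e⟩ := h2
  have := (h s hs.1 r hr.1 (add_left_cancel e).symm).1
  simp [this]

/-- Unfolding an edge towards the corner. -/
theorem interp (h : Nd a b c) {t : ℝ} (ht : t ∈ Icc (0:ℝ) 1) :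
    Nd a ((1 - t) • midpoint ℝ a c + t • b) c := by
  intro s hs r hr e
  have e' : (s * (1 + t) + r * (1 - t)) • (a - b) = (s * (1 - t) + r * (1 + t)) • (c - b) := by
    rw [midpoint_eq_smul_add] at e
    have := congrArg (fun x => (2:ℝ) • x) e
    simp only [invOf_eq_inv] at this
    rw [← sub_eq_zero] at this ⊢
    rw [← this]
    module
  have h1 : 0 ≤ 1 - t := by linarith [ht.2]
  have h2 : 0 ≤ t := ht.1
  obtain ⟨k1, k2⟩ := h _ (by positivity) _ (by positivity) e'
  constructor <;> nlinarith [mul_nonneg hs h1, mul_nonneg hr h1, mul_nonneg hs h2, mul_nonneg hr h2]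

end Nd

theorem mem_tri_left (a b c : R3) : a ∈ tri a b c := subset_convexHull _ _ (by simp)
theorem mem_tri_mid (a b c : R3) : b ∈ tri a b c := subset_convexHull _ _ (by simp)
theorem mem_tri_right (a b c : R3) : c ∈ tri a b c := subset_convexHull _ _ (by simp)

theorem convex_tri (a b c : R3) : Convex ℝ (tri a b c) := convex_convexHull _ _

theorem tri_subset {a b c : R3} {T : Set R3} (hT : Convex ℝ T) (ha : a ∈ T) (hb : b ∈ T)
    (hc : c ∈ T) : tri a b c ⊆ T := by
  refine convexHull_min ?_ hT
  rintro x (rfl | rfl | rfl) <;> assumption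

theorem car_pair (e f : R3 × R3) : car {e, f} = segment ℝ e.1 e.2 ∪ segment ℝ f.1 f.2 := by
  ext x; simp [mem_car]

theorem car_singleton (e : R3 × R3) : car {e} = segment ℝ e.1 e.2 := by
  ext x; simp [mem_car]

/-- Replacing an edge and its `tau`-image by the two other sides of an unobstructed triangle. -/
theorem Lk.replace {X : Set (R3 × R3)} {a b c : R3} (h : Lk (X ∪ dbl {(a, c)})) (hX : TauSym X)
    (nd : Nd a b c) (h1 : ∀ x ∈ tri a b c, x ∈ car X → x = a ∨ x = c)
    (h2 : ∀ x ∈ tri a b c, tau x ∈ tri a b c → (x = a ∧ tau a = a) ∨ (x = c ∧ tau c = c)) :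
    Lk (X ∪ dbl {(a, b), (b, c)}) := by
  have mac : (a, c) ∈ X ∪ dbl {(a, c)} := Or.inr (by simp [mem_dbl])
  have hac_ne : a ≠ c := h.emb.ne _ mac
  have hac : (a, c) ∉ X := fun hm => by
    have hmid := midpoint_mem_segment (𝕜 := ℝ) a c
    rcases h1 _ ((convex_tri a b c).segment_subset (mem_tri_left _ _ _) (mem_tri_right _ _ _) hmid)
      (mem_car.2 ⟨_, hm, hmid⟩) with h | h
    · exact hac_ne ((midpoint_eq_left_iff ℝ).1 h)
    · exact hac_ne ((midpoint_eq_right_iff ℝ).1 h)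
  have sab : segment ℝ a b ⊆ tri a b c :=
    (convex_tri a b c).segment_subset (mem_tri_left _ _ _) (mem_tri_mid _ _ _)
  have sbc : segment ℝ b c ⊆ tri a b c :=
    (convex_tri a b c).segment_subset (mem_tri_mid _ _ _) (mem_tri_right _ _ _)
  have hbX : b ∉ car X := fun hb => by
    rcases h1 b (mem_tri_mid _ _ _) hb with h | h
    exacts [nd.left_ne h.symm, nd.right_ne h.symm]
  have hbτ : tau b ∉ tri a b c := fun hb => by
    rcases h2 b (mem_tri_mid _ _ _) hb with h | h
    exacts [nd.left_ne h.1.symm, nd.right_ne h.1.symm]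
  have mab : ∀ x ∈ segment ℝ a b, x ∈ car X → x = a := fun x hx hX' =>
    (h1 x (sab hx) hX').resolve_right (fun h => nd.notMem (h ▸ hx))
  have mbc : ∀ x ∈ segment ℝ b c, x ∈ car X → x = c := fun x hx hX' =>
    (h1 x (sbc hx) hX').resolve_left (fun h => nd.notMem' (h ▸ hx))
  have tab : ∀ x ∈ segment ℝ a b, tau x ∈ tri a b c → x = a ∧ tau a = a := fun x hx hX' =>
    (h2 x (sab hx) hX').resolve_right (fun h => nd.notMem (h.1 ▸ hx))
  have tbc : ∀ x ∈ segment ℝ b c, tau x ∈ tri a b c → x = c ∧ tau c = c := fun x hx hX' =>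
    (h2 x (sbc hx) hX').resolve_left (fun h => nd.notMem' (h.1 ▸ hx))
  have hrv : rv (a, c) ≠ (a, c) := fun h => by
    simp only [rv, Prod.mk.injEq] at h
    rcases h2 a (mem_tri_left _ _ _) (by rw [h.2]; exact mem_tri_right _ _ _) with k | k
    · exact hac_ne (k.2.symm.trans h.2)
    · exact hac_ne k.1
  have rX : ∀ e, e ∈ X → rv e ∈ X := hX
  have embX : Emb X := h.emb.mono subset_union_left
  have neX : ∀ f ∈ X, (a, c) ≠ f := fun f hf h => hac (h ▸ hf)
  have cross : ∀ f ∈ X, ∀ e ∈ ({(a, b), (b, c)} : Set (R3 × R3)), Meet f e := by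
    rintro f hf e (rfl | rfl) x hxf hxe
    · have hx := mab x hxe (mem_car.2 ⟨f, hf, hxf⟩)
      refine ⟨?_, Or.inl hx⟩
      exact (h.emb.emb _ mac f (Or.inl hf) (neX f hf) x (hx ▸ left_mem_segment _ _ _) hxf).2
    · have hx := mbc x hxe (mem_car.2 ⟨f, hf, hxf⟩)
      refine ⟨?_, Or.inr hx⟩
      exact (h.emb.emb _ mac f (Or.inl hf) (neX f hf) x (hx ▸ right_mem_segment _ _ _) hxf).2
  refine ⟨embX.union (Emb.dbl ⟨by simp, ?_, ?_⟩ ?_) ?_, ?_, hX.union (tauSym_dbl _)⟩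
  · rintro e (rfl | rfl)
    exacts [nd.left_ne, nd.right_ne.symm]
  · rintro e (rfl | rfl) f (rfl | rfl) hne x hx hx'
    · exact absurd rfl hne
    · have := nd.eq_of_mem hx hx'; exact ⟨Or.inr this, Or.inl this⟩
    · have := nd.eq_of_mem hx' hx; exact ⟨Or.inl this, Or.inr this⟩
    · exact absurd rfl hne
  · rintro e (rfl | rfl) f (rfl | rfl) x hx hx'
    · have hx' := mem_segment_rv.1 hx'
      obtain ⟨k1, k2⟩ := tab x hx (sab hx')
      exact ⟨Or.inl k1, Or.inr (k1.trans k2.symm)⟩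
    · have hx' := mem_segment_rv.1 hx'
      obtain ⟨k1, k2⟩ := tab x hx (sbc hx')
      exact absurd hx' (by rw [k1, k2]; exact nd.notMem')
    · have hx' := mem_segment_rv.1 hx'
      obtain ⟨k1, k2⟩ := tbc x hx (sab hx')
      exact absurd hx' (by rw [k1, k2]; exact nd.notMem)
    · have hx' := mem_segment_rv.1 hx'
      obtain ⟨k1, k2⟩ := tbc x hx (sbc hx')
      exact ⟨Or.inr k1, Or.inl (k1.trans k2.symm)⟩
  · rintro f hf e he
    rcases mem_dbl.1 he with he | he
    · exact cross f hf e he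
    · have := (cross (rv f) (rX f hf) (rv e) he).rv
      rwa [rv_rv, rv_rv] at this
  · have d1 : X ∪ dbl {(a, c)} = insert (a, c) (insert (tau c, tau a) X) := by
      ext e; simp [dbl, rv]; tauto
    have d2 : X ∪ dbl {(a, b), (b, c)} =
        insert (tau c, tau b) (insert (tau b, tau a) (insert (a, b) (insert (b, c) X))) := by
      ext e; simp [dbl, image_pair, rv]; tauto
    have hb1 : b ∉ vts (X ∪ dbl {(a, c)}) := by
      rintro ⟨e, he | he, hbe⟩
      · exact hbX (vts_subset_car ⟨e, he, hbe⟩)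
      · rcases mem_dbl.1 he with h | h
        · rw [mem_singleton_iff] at h; subst h
          rcases hbe with h | h
          exacts [nd.left_ne h.symm, nd.right_ne h.symm]
        · rw [mem_singleton_iff] at h
          have : e = (tau c, tau a) := by rw [← rv_rv e, h]; rfl
          subst this
          rcases hbe with h | h
          · exact hbτ (by rw [h, tau_tau]; exact mem_tri_right _ _ _)
          · exact hbτ (by rw [h, tau_tau]; exact mem_tri_left _ _ _)
    have nb : b ≠ tau b := fun h => hbτ (by rw [← h]; exact mem_tri_mid _ _ _)
    have hc := h.comb
    rw [d1] at hc hb1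
    have hc2 := hc.replace (b := b) (by
      rintro (h | h)
      · exact hrv h.symm
      · exact hac h) hb1
    have d3 : insert (a, b) (insert (b, c) (insert (tau c, tau a) X))
        = insert (tau c, tau a) (insert (a, b) (insert (b, c) X)) := by
      ext e; simp; tauto
    rw [d3] at hc2
    rw [d2]
    have hτb : ∀ e ∈ X, tau b ≠ e.1 ∧ tau b ≠ e.2 := fun e he => by
      constructor <;> intro h <;>
      · apply hbX
        have : tau b ∈ car X := vts_subset_car ⟨e, he, by simp [h]⟩
        simpa [tau_tau] using hX.tau_mem_car this
    refine hc2.replace ?_ ?_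
    · rintro (h | h | h)
      · simp only [Prod.mk.injEq] at h
        exact hbτ (by rw [tau_eq_iff.1 h.2]; exact mem_tri_left _ _ _)
      · simp only [Prod.mk.injEq] at h
        exact hbτ (by rw [← h.1, tau_tau]; exact mem_tri_right _ _ _)
      · have := rX _ h
        simp [rv, tau_tau] at this
        exact hac this
    · rintro ⟨e, rfl | rfl | rfl | he, hbe⟩
      · simp only [tau_injective.eq_iff] at hbe
        rcases hbe with h | h
        exacts [nd.right_ne h.symm, nd.left_ne h.symm]
      · rcases hbe with h | h
        · exact hbτ (h ▸ mem_tri_left _ _ _)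
        · exact nb h.symm
      · rcases hbe with h | h
        · exact nb h.symm
        · exact hbτ (h ▸ mem_tri_right _ _ _)
      · rcases hbe with h | h
        · exact (hτb e he).1 h
        · exact (hτb e he).2 h

theorem segment_union_of_mem {a b c : R3} (h : b ∈ segment ℝ a c) :
    segment ℝ a b ∪ segment ℝ b c = segment ℝ a c := by
  apply subset_antisymm
  · exact union_subset ((convex_segment a c).segment_subset (left_mem_segment _ _ _) h)
      ((convex_segment a c).segment_subset h (right_mem_segment _ _ _))
  · rw [segment_eq_image'] at h
    obtain ⟨s, hs, rfl⟩ := h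
    intro x hx
    rw [segment_eq_image'] at hx
    obtain ⟨r, hr, rfl⟩ := hx
    rcases le_total r s with hrs | hrs
    · left
      rcases hs.1.eq_or_lt with h0 | h0
      · have : r = 0 := le_antisymm (h0 ▸ hrs) hr.1
        simp [this, left_mem_segment]
      · rw [segment_eq_image']
        refine ⟨r / s, ⟨div_nonneg hr.1 hs.1, (div_le_one h0).2 hrs⟩, ?_⟩
        simp only [add_sub_cancel_left, smul_smul]
        rw [div_mul_cancel₀ _ h0.ne']
    · right
      rcases hs.2.eq_or_lt with h0 | h0
      · have : r = 1 := le_antisymm hr.2 (h0 ▸ hrs)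
        simp [this, right_mem_segment]
      · have h1 : 0 < 1 - s := by linarith
        rw [segment_eq_image']
        refine ⟨(r - s) / (1 - s), ⟨div_nonneg (by linarith) h1.le,
          (div_le_one h1).2 (by linarith [hr.2])⟩, ?_⟩
        have e1 : c - (a + s • (c - a)) = (1 - s) • (c - a) := by module
        simp only [e1, smul_smul]
        rw [div_mul_cancel₀ _ h1.ne']
        module

theorem car_subdivide {X : Set (R3 × R3)} {a b c : R3} (h : b ∈ segment ℝ a c) :
    car (X ∪ dbl {(a, b), (b, c)}) = car (X ∪ dbl {(a, c)}) := by
  have h0 : car {(a, b), (b, c)} = car {(a, c)} := by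
    rw [car_pair, car_singleton]; exact segment_union_of_mem h
  ext x
  rw [car_union, car_union, mem_union, mem_union, mem_car_dbl, mem_car_dbl, h0]

theorem nd_of_mem {a b c : R3} (h : b ∈ segment ℝ a c) (ha : a ≠ b) (hc : c ≠ b) : Nd a b c := by
  rw [segment_eq_image'] at h
  obtain ⟨u, hu, rfl⟩ := h
  have hu0 : 0 < u := hu.1.lt_of_ne (by rintro rfl; simp at ha)
  have hu1 : u < 1 := hu.2.lt_of_ne (by rintro rfl; simp at hc)
  have hca : c - a ≠ 0 := by
    rw [sub_ne_zero]; rintro rfl; simp at ha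
  intro s hs r hr e
  have e1 : (s * u + r * (1 - u)) • (c - a) = 0 := by
    rw [← sub_eq_zero] at e
    have e' := congrArg Neg.neg e
    rw [neg_zero] at e'
    rw [← e']; module
  have e2 := (smul_eq_zero.1 e1).resolve_right hca
  have := mul_nonneg hs hu0.le
  have h4 : 0 ≤ r * (1 - u) := mul_nonneg hr (by linarith)
  constructor
  · have : s * u = 0 := by linarith
    exact (mul_eq_zero.1 this).resolve_right hu0.ne'
  · have : r * (1 - u) = 0 := by linarith
    exact (mul_eq_zero.1 this).resolve_right (by linarith)

/-- The links `E` and `F` are related by an equivariant isotopy. -/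
def IsoTo (E F : Set (R3 × R3)) : Prop := Lk F ∧ EquivIsotopicSets (car E) (car F)

theorem IsoTo.trans {E F G : Set (R3 × R3)} (h : IsoTo E F) (h' : IsoTo F G) : IsoTo E G :=
  ⟨h'.1, h.2.trans h'.2⟩

theorem Lk.move {X : Set (R3 × R3)} {a b c : R3} (h : Lk (X ∪ dbl {(a, c)})) (hX : TauSym X)
    (nd : Nd a b c) (h1 : ∀ x ∈ tri a b c, x ∈ car X → x = a ∨ x = c)
    (h2 : ∀ x ∈ tri a b c, tau x ∈ tri a b c → (x = a ∧ tau a = a) ∨ (x = c ∧ tau c = c)) :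
    IsoTo (X ∪ dbl {(a, c)}) (X ∪ dbl {(a, b), (b, c)}) := by
  classical
  refine ⟨h.replace hX nd h1 h2, ?_⟩
  set B : ℝ → R3 := fun t => (1 - t) • midpoint ℝ a c + t • b with hB
  have hB1 : B 1 = b := by simp [hB]
  have hB0 : B 0 = midpoint ℝ a c := by simp [hB]
  have hBc : Continuous B := by simp only [hB]; fun_prop
  have hBt : ∀ t ∈ Icc (0:ℝ) 1, B t ∈ tri a b c := fun t ht =>
    convex_tri a b c ((convex_tri a b c).segment_subset (mem_tri_left _ _ _) (mem_tri_right _ _ _)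
      (midpoint_mem_segment a c)) (mem_tri_mid _ _ _) (by linarith [ht.2]) ht.1 (by ring)
  have hnd : ∀ t ∈ Icc (0:ℝ) 1, Nd a (B t) c := fun t ht => nd.interp ht
  have hsub : ∀ t ∈ Icc (0:ℝ) 1, tri a (B t) c ⊆ tri a b c := fun t ht =>
    tri_subset (convex_tri _ _ _) (mem_tri_left _ _ _) (hBt t ht) (mem_tri_right _ _ _)
  have hBX : ∀ t ∈ Icc (0:ℝ) 1, B t ∉ car X := fun t ht hb => by
    rcases h1 _ (hBt t ht) hb with h | h
    exacts [(hnd t ht).left_ne h.symm, (hnd t ht).right_ne h.symm]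
  have hBτ : ∀ t ∈ Icc (0:ℝ) 1, tau (B t) ∉ tri a b c := fun t ht hb => by
    rcases h2 _ (hBt t ht) hb with h | h
    exacts [(hnd t ht).left_ne h.1.symm, (hnd t ht).right_ne h.1.symm]
  have one : (1:ℝ) ∈ Icc (0:ℝ) 1 := by simp
  have hbX : b ∉ car X := hB1 ▸ hBX 1 one
  have hbτ : tau b ∉ tri a b c := by simpa [hB1] using hBτ 1 one
  have hbτ' : tau b ≠ b := fun h => hbτ (by rw [h]; exact mem_tri_mid _ _ _)
  set P : ℝ → R3 → R3 := fun t v => if v = b then B t else if v = tau b then tau (B t) else v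
    with hP
  have Pb : ∀ t, P t b = B t := fun t => by simp [hP]
  have Pτ : ∀ t v, P t (tau v) = tau (P t v) := fun t v => by
    by_cases h : v = b
    · subst h; simp [hP, hbτ']
    · by_cases h' : v = tau b
      · subst h'; simp [hP, hbτ', tau_tau]
      · have : tau v ≠ b := fun h => h' (tau_eq_iff.1 h)
        have : tau v ≠ tau b := fun hh => h (tau_injective hh)
        simp [*]
  have Pfix : ∀ t v, v ∈ car X ∨ v = a ∨ v = c → P t v = v := by
    intro t v hv
    have n1 : v ≠ b := by
      rintro rfl
      rcases hv with hv | hv | hv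
      exacts [hbX hv, nd.left_ne hv.symm, nd.right_ne hv.symm]
    have n2 : v ≠ tau b := by
      rintro rfl
      rcases hv with hv | hv | hv
      · have := hX.tau_mem_car hv
        rw [tau_tau] at this; exact hbX this
      · exact hbτ (hv ▸ mem_tri_left _ _ _)
      · exact hbτ (hv ▸ mem_tri_right _ _ _)
    simp [hP, n1, n2]
  have hvt : ∀ v, (∃ e ∈ X ∪ dbl {(a, b), (b, c)}, v = e.1 ∨ v = e.2) →
      v = b ∨ v = tau b ∨ v ∈ car X ∪ {a, c, tau a, tau c} := by
    rintro v ⟨e, he | he, hv⟩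
    · exact Or.inr (Or.inr (Or.inl (vts_subset_car ⟨e, he, hv⟩)))
    · rcases he with (rfl | rfl) | ⟨e, rfl | rfl, rfl⟩ <;> rcases hv with rfl | rfl <;> simp [rv]
  have Pfix' : ∀ t v, v ≠ b → v ≠ tau b → P t v = v := fun t v n1 n2 => by simp [hP, n1, n2]
  have himg : ∀ t, imgE (P t) (X ∪ dbl {(a, b), (b, c)}) = X ∪ dbl {(a, B t), (B t, c)} := by
    intro t
    have pa := Pfix t a (by simp)
    have pc := Pfix t c (by simp)
    simp only [imgE, image_union, dbl, image_pair, rv, Prod.map, Pτ, pa, pc, Pb]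
    congr 1
    refine (image_congr fun e he => ?_).trans (image_id X)
    exact Prod.ext (Pfix t _ (Or.inl (vts_subset_car ⟨e, he, Or.inl rfl⟩)))
      (Pfix t _ (Or.inl (vts_subset_car ⟨e, he, Or.inr rfl⟩)))
  have key := equivIsotopic_of_family tau (X ∪ dbl {(a, b), (b, c)}) P
    (hX.union (tauSym_dbl _)) (fun v => by
      by_cases h : v = b
      · subst h; simpa [hP] using hBc
      · by_cases h' : v = tau b
        · subst h'; simp only [hP, hbτ', if_false, if_true]; exact continuous_tau.comp hBc
        · simp only [hP, h, h', if_false]; exact continuous_const) Pτ (fun t ht => by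
      have sep : B t ∉ car X ∪ {a, c, tau a, tau c} := by
        rintro (hv | hv | hv | hv | hv)
        · exact hBX t ht hv
        · exact (hnd t ht).left_ne hv.symm
        · exact (hnd t ht).right_ne hv.symm
        · exact hBτ t ht (by rw [hv, tau_tau]; exact mem_tri_left _ _ _)
        · exact hBτ t ht (by rw [hv, tau_tau]; exact mem_tri_right _ _ _)
      have sep' : tau (B t) ∉ car X ∪ {a, c, tau a, tau c} := by
        rintro (hv | hv | hv | hv | hv)
        · have := hX.tau_mem_car hv
          rw [tau_tau] at this; exact hBX t ht this
        · exact hBτ t ht (hv ▸ mem_tri_left _ _ _)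
        · exact hBτ t ht (hv ▸ mem_tri_right _ _ _)
        · exact (hnd t ht).left_ne (tau_injective hv).symm
        · exact (hnd t ht).right_ne (tau_injective hv).symm
      have sep2 : B t ≠ tau (B t) := fun h => hBτ t ht (h ▸ hBt t ht)
      have hval : ∀ v, (∃ e ∈ X ∪ dbl {(a, b), (b, c)}, v = e.1 ∨ v = e.2) →
          (v = b ∧ P t v = B t) ∨ (v = tau b ∧ P t v = tau (B t)) ∨
          (v ∈ car X ∪ {a, c, tau a, tau c} ∧ P t v = v) := by
        intro v hv
        by_cases n1 : v = b
        · exact Or.inl ⟨n1, n1 ▸ Pb t⟩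
        by_cases n2 : v = tau b
        · exact Or.inr (Or.inl ⟨n2, by rw [n2, Pτ, Pb]⟩)
        · exact Or.inr (Or.inr ⟨((hvt v hv).resolve_left n1).resolve_left n2, Pfix' t v n1 n2⟩)
      intro u hu v hv huv
      rcases hval u hu with ⟨h1, h2⟩ | ⟨h1, h2⟩ | ⟨h1, h2⟩ <;>
      rcases hval v hv with ⟨h3, h4⟩ | ⟨h3, h4⟩ | ⟨h3, h4⟩ <;> rw [h2, h4] at huv
      · rw [h1, h3]
      · exact absurd huv sep2
      · exact absurd (huv ▸ h3) sep
      · exact absurd huv.symm sep2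
      · rw [h1, h3]
      · exact absurd (huv ▸ h3) sep'
      · exact absurd (huv ▸ h1) sep
      · exact absurd (huv ▸ h1) sep'
      · exact huv) (fun t ht => by
      rw [himg t]
      exact (h.replace hX (hnd t ht) (fun x hx => h1 x (hsub t ht hx))
        (fun x hx hx' => h2 x (hsub t ht hx) (hsub t ht hx'))).emb)
  rw [himg, himg, hB0, hB1, car_subdivide (midpoint_mem_segment a c)] at key
  exact key


/-- Replacing an edge and its `tau`-image by three sides of an unobstructed quadrilateral. -/
theorem Lk.quad {X : Set (R3 × R3)} {a α γ c : R3} {T : Set R3} (h : Lk (X ∪ dbl {(a, c)}))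
    (hX : TauSym X) (hT : Convex ℝ T) (ha : a ∈ T) (hα : α ∈ T) (hγ : γ ∈ T) (hc : c ∈ T)
    (nd : Nd a α c) (nd' : Nd α γ c) (h1 : ∀ x ∈ T, x ∈ car X → x = a ∨ x = c)
    (h2 : ∀ x ∈ T, tau x ∈ T → (x = a ∧ tau a = a) ∨ (x = c ∧ tau c = c))
    (h3 : ∀ x ∈ tri α γ c, x ∈ segment ℝ a α → x = α) :
    IsoTo (X ∪ dbl {(a, c)}) ((X ∪ dbl {(a, α), (γ, c)}) ∪ dbl {(α, γ)}) := by
  have t1 : tri a α c ⊆ T := tri_subset hT ha hα hc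
  have t2 : tri α γ c ⊆ T := tri_subset hT hα hγ hc
  have r1 := h.move hX nd (fun x hx => h1 x (t1 hx)) (fun x hx hx' => h2 x (t1 hx) (t1 hx'))
  have e1 : X ∪ dbl {(a, α), (α, c)} = (X ∪ dbl {(a, α)}) ∪ dbl {(α, c)} := by
    rw [← singleton_union, dbl_union, union_assoc]
  have e2 : (X ∪ dbl {(a, α), (γ, c)}) ∪ dbl {(α, γ)}
      = (X ∪ dbl {(a, α)}) ∪ dbl {(α, γ), (γ, c)} := by
    ext e; simp only [mem_union, mem_dbl, mem_insert_iff, mem_singleton_iff]; tauto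
  rw [e1] at r1
  rw [e2]
  have na : a ∉ tri α γ c := fun hh => nd.left_ne (h3 a hh (left_mem_segment _ _ _))
  refine r1.trans (r1.1.move (hX.union (tauSym_dbl _)) nd' (fun x hx hx' => ?_)
    (fun x hx hx' => ?_))
  · rw [car_union, mem_union, mem_car_dbl, car_singleton] at hx'
    rcases hx' with hx' | hx' | hx'
    · exact Or.inr ((h1 x (t2 hx) hx').resolve_left (fun h => na (h ▸ hx)))
    · exact Or.inl (h3 x hx hx')
    · have hx'' : tau x ∈ T := hT.segment_subset ha hα hx'
      exact Or.inr ((h2 x (t2 hx) hx'').resolve_left (fun h => na (h.1 ▸ hx))).1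
  · exact Or.inr ((h2 x (t2 hx) (t2 hx')).resolve_left (fun h => na (h.1 ▸ hx)))

/-! ### Coordinates and separation by linear functionals -/

/-- The linear functional with coefficients `u`, `v`, `w`. -/
def fnl (u v w : ℝ) : R3 →ₗ[ℝ] ℝ where
  toFun p := u * p.1 + v * p.2.1 + w * p.2.2
  map_add' p q := by simp; ring
  map_smul' c p := by simp; ring

theorem fnl_apply (u v w : ℝ) (p : R3) : fnl u v w p = u * p.1 + v * p.2.1 + w * p.2.2 := rfl

theorem eq_right_of_fnl (φ : R3 →ₗ[ℝ] ℝ) {a b x : R3} (hx : x ∈ segment ℝ a b) (h : φ a < φ b)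
    (h' : φ b ≤ φ x) : x = b := by
  obtain ⟨s, t, hs, ht, hst, rfl⟩ := hx
  simp only [map_add, map_smul, smul_eq_mul] at h'
  obtain rfl : s = 1 - t := by linarith
  have ht1 : t = 1 := by nlinarith
  subst ht1; simp

theorem eq_left_of_fnl (φ : R3 →ₗ[ℝ] ℝ) {a b x : R3} (hx : x ∈ segment ℝ a b) (h : φ b < φ a)
    (h' : φ a ≤ φ x) : x = a :=
  eq_right_of_fnl φ (segment_symm ℝ a b ▸ hx) h h'

theorem segment_fnl_le (φ : R3 →ₗ[ℝ] ℝ) {a b x : R3} {k : ℝ} (hx : x ∈ segment ℝ a b)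
    (ha : φ a ≤ k) (hb : φ b ≤ k) : φ x ≤ k := by
  obtain ⟨s, t, hs, ht, hst, rfl⟩ := hx
  simp only [map_add, map_smul, smul_eq_mul]
  obtain rfl : s = 1 - t := by linarith
  nlinarith [mul_le_mul_of_nonneg_left ha hs, mul_le_mul_of_nonneg_left hb ht]

theorem segment_fnl_lt (φ : R3 →ₗ[ℝ] ℝ) {a b x : R3} {k : ℝ} (hx : x ∈ segment ℝ a b)
    (ha : φ a < k) (hb : φ b < k) : φ x < k :=
  (segment_fnl_le φ hx (le_max_left _ _) (le_max_right _ _)).trans_lt (max_lt ha hb)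

theorem mem_tri_iff {a b c x : R3} : x ∈ tri a b c ↔ ∃ u ≥ (0:ℝ), ∃ v ≥ (0:ℝ), ∃ w ≥ (0:ℝ),
    u + v + w = 1 ∧ x = u • a + v • b + w • c := by
  rw [tri, convexHull_insert (by simp), convexHull_pair]
  constructor
  · intro h
    rw [mem_convexJoin] at h
    obtain ⟨_, rfl, y, ⟨s, t, hs, ht, hst, rfl⟩, ⟨u, v, hu, hv, huv, rfl⟩⟩ := h
    refine ⟨u, hu, v * s, by positivity, v * t, by positivity, ?_, ?_⟩
    · rw [add_assoc, ← mul_add, hst, mul_one, huv]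
    · rw [smul_add, smul_smul, smul_smul, add_assoc]
  · rintro ⟨u, hu, v, hv, w, hw, h1, rfl⟩
    rw [← convexHull_pair, ← convexHull_insert (by simp)]
    have := convex_tri a b c
    rcases (add_nonneg hu hv).eq_or_lt with h0 | h0
    · have h2 : u = 0 := by linarith
      have h3 : v = 0 := by linarith
      have h4 : w = 1 := by linarith
      simp only [h2, h3, h4, zero_smul, zero_add, one_smul]
      exact mem_tri_right _ _ _
    · have e : u • a + v • b + w • c
          = (u + v) • ((u / (u + v)) • a + (v / (u + v)) • b) + w • c := by
        rw [smul_add, smul_smul, smul_smul, mul_div_cancel₀ _ h0.ne', mul_div_cancel₀ _ h0.ne']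
      rw [e]
      refine this (this (mem_tri_left _ _ _) (mem_tri_mid _ _ _) (by positivity) (by positivity)
        ?_) (mem_tri_right _ _ _) h0.le hw h1
      field_simp

theorem tri_eq_left (φ : R3 →ₗ[ℝ] ℝ) {a b c x : R3} (hx : x ∈ tri a b c) (hb : φ a < φ b)
    (hc : φ a < φ c) (h : φ x ≤ φ a) : x = a := by
  obtain ⟨u, hu, v, hv, w, hw, h1, rfl⟩ := mem_tri_iff.1 hx
  simp only [map_add, map_smul, smul_eq_mul] at h
  obtain rfl : u = 1 - v - w := by linarith
  have h2 : v * (φ b - φ a) + w * (φ c - φ a) ≤ 0 := by nlinarith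
  have h3 : 0 ≤ v * (φ b - φ a) := mul_nonneg hv (by linarith)
  have h4 : 0 ≤ w * (φ c - φ a) := mul_nonneg hw (by linarith)
  have h5 : v = 0 := (mul_eq_zero.1 (le_antisymm (by linarith) h3)).resolve_right (by linarith)
  have h6 : w = 0 := (mul_eq_zero.1 (le_antisymm (by linarith) h4)).resolve_right (by linarith)
  simp [h5, h6]

theorem tri_fnl_le (φ : R3 →ₗ[ℝ] ℝ) {a b c x : R3} {k : ℝ} (hx : x ∈ tri a b c) (ha : φ a ≤ k)
    (hb : φ b ≤ k) (hc : φ c ≤ k) : φ x ≤ k := by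
  obtain ⟨u, hu, v, hv, w, hw, h1, rfl⟩ := mem_tri_iff.1 hx
  simp only [map_add, map_smul, smul_eq_mul]
  obtain rfl : u = 1 - v - w := by linarith
  nlinarith [mul_le_mul_of_nonneg_left ha hu, mul_le_mul_of_nonneg_left hb hv,
    mul_le_mul_of_nonneg_left hc hw]

/-- A version of `Lk.quad` where the quadrilateral is separated by a linear functional. -/
theorem Lk.quad_fnl {X : Set (R3 × R3)} {a α γ c : R3} {T : Set R3} (h : Lk (X ∪ dbl {(a, c)}))
    (hX : TauSym X) (hT : Convex ℝ T) (ha : a ∈ T) (hα : α ∈ T) (hγ : γ ∈ T) (hc : c ∈ T)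
    (nd : Nd a α c) (nd' : Nd α γ c) (h1 : ∀ x ∈ T, x ∈ car X → x = a ∨ x = c)
    (h2 : ∀ x ∈ T, tau x ∈ T → (x = a ∧ tau a = a) ∨ (x = c ∧ tau c = c))
    (φ : R3 →ₗ[ℝ] ℝ) (h3 : φ a = φ α) (h4 : φ α < φ γ) (h5 : φ α < φ c) :
    IsoTo (X ∪ dbl {(a, c)}) ((X ∪ dbl {(a, α), (γ, c)}) ∪ dbl {(α, γ)}) :=
  h.quad hX hT ha hα hγ hc nd nd' h1 h2 fun _ hx hx' =>
    tri_eq_left φ hx h4 h5 (segment_fnl_le φ hx' h3.le le_rfl)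

theorem car_insert (e : R3 × R3) (W : Set (R3 × R3)) :
    car (insert e W) = segment ℝ e.1 e.2 ∪ car W := by
  rw [← singleton_union, car_union, car_singleton]

/-- The five edges leading from `(1/4, y, h)` around the braid axis to `(-1/4, y, h)`. -/
def outer (y h : ℝ) : Set (R3 × R3) :=
  {((1/4, y, h), (1/2, y, h)), ((1/2, y, h), (1/2, 2, h)), ((1/2, 2, h), (-1/2, 2, h)),
   ((-1/2, 2, h), (-1/2, y, h)), ((-1/2, y, h), (-1/4, y, h))}

/-- The four edges joining `a` and `c` to the endpoints of `outer y h`. -/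
def legs (a c : R3) (y η h : ℝ) : Set (R3 × R3) :=
  {(a, (a.1, y, η)), ((a.1, y, η), (1/4, y, h)), ((-1/4, y, h), (c.1, y, η)), ((c.1, y, η), c)}

/-- Replacing the edge from `(1/4, y, h)` to `(-1/4, y, h)` in a plane free of other edges. -/
theorem Lk.outer_move {Y : Set (R3 × R3)} {y h : ℝ} (hy : y < 2) (hh : 0 < h)
    (hL : Lk (Y ∪ dbl {((1/4, y, h), (-1/4, y, h))})) (hY : TauSym Y)
    (hz : ∀ p ∈ car Y, p.2.2 = h → p = (1/4, y, h) ∨ p = (-1/4, y, h)) :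
    IsoTo (Y ∪ dbl {((1/4, y, h), (-1/4, y, h))}) (Y ∪ dbl (outer y h)) := by
  rw [outer]
  set α : R3 := (1/4, y, h) with hα
  set γ : R3 := (-1/4, y, h) with hγ
  set R2 : R3 := (1/2, 2, h) with hR2
  set L2 : R3 := (-1/2, 2, h) with hL2
  set R1 : R3 := (1/2, y, h) with hR1
  set L1 : R3 := (-1/2, y, h) with hL1
  have s3 : IsoTo (Y ∪ dbl {(α, γ)}) ((Y ∪ dbl {(α, R2), (L2, γ)}) ∪ dbl {(R2, L2)}) := by
    refine hL.quad_fnl (T := {p | p.2.2 = h}) hY ?_ rfl rfl rfl rfl ?_ ?_ ?_ ?_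
      (fnl (y - 2) (1/4) 0) ?_ ?_ ?_
    · intro p hp q hq u v hu hv huv
      simp at hp hq ⊢
      rw [hp, hq, ← add_mul, huv, one_mul]
    · intro s hs r hr e
      simp [γ, R2, α, Prod.ext_iff] at e
      obtain ⟨e1, e3⟩ := e
      have := e3.resolve_right (by linarith)
      subst this
      constructor <;> linarith
    · intro s hs r hr e
      simp [γ, R2, L2, Prod.ext_iff] at e
      obtain ⟨e1, e3⟩ := e
      have := e3.resolve_right (by linarith)
      subst this
      constructor <;> linarith
    · intro p hp hp'
      exact hz p hp' hp
    · intro p hp hp'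
      simp [tau] at hp hp'; linarith
    · simp [fnl_apply, α, R2]; ring
    · simp [fnl_apply, L2, R2]; nlinarith
    · simp [fnl_apply, γ, R2]; nlinarith
  have e1 : (Y ∪ dbl {(α, R2), (L2, γ)}) ∪ dbl {(R2, L2)}
      = (Y ∪ dbl {(R2, L2), (L2, γ)}) ∪ dbl {(α, R2)} := by
    ext e; simp only [mem_union, mem_dbl, mem_insert_iff, mem_singleton_iff]; tauto
  have e2 : (Y ∪ dbl {(R2, L2), (L2, γ)}) ∪ dbl {(α, R1), (R1, R2)}
      = (Y ∪ dbl {(α, R1), (R1, R2), (R2, L2)}) ∪ dbl {(L2, γ)} := by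
    ext e; simp only [mem_union, mem_dbl, mem_insert_iff, mem_singleton_iff]; tauto
  have e3 : Y ∪ dbl {(α, R1), (R1, R2), (R2, L2), (L2, L1), (L1, γ)}
      = (Y ∪ dbl {(α, R1), (R1, R2), (R2, L2)}) ∪ dbl {(L2, L1), (L1, γ)} := by
    ext e; simp only [mem_union, mem_dbl, mem_insert_iff, mem_singleton_iff]; tauto
  rw [e1] at s3
  refine s3.trans ?_
  have s4 : IsoTo ((Y ∪ dbl {(R2, L2), (L2, γ)}) ∪ dbl {(α, R2)})
      ((Y ∪ dbl {(R2, L2), (L2, γ)}) ∪ dbl {(α, R1), (R1, R2)}) := by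
    have hpl : ∀ p ∈ tri α R1 R2, p.2.2 = h ∧ 1/4 ≤ p.1 := by
      intro p hp
      have h1 := tri_fnl_le (fnl 0 0 1) (k := h) hp (by simp [fnl_apply, α])
        (by simp [fnl_apply, R1]) (by simp [fnl_apply, R2])
      have h2 := tri_fnl_le (fnl 0 0 (-1)) (k := -h) hp (by simp [fnl_apply, α])
        (by simp [fnl_apply, R1]) (by simp [fnl_apply, R2])
      have h3 := tri_fnl_le (fnl (-1) 0 0) (k := -1/4) hp (by simp [fnl_apply, α]; norm_num)
        (by simp [fnl_apply, R1]; norm_num) (by simp [fnl_apply, R2]; norm_num)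
      simp [fnl_apply] at h1 h2 h3
      exact ⟨le_antisymm h1 h2, by linarith⟩
    refine s3.1.move (hY.union (tauSym_dbl _)) ?_ ?_ ?_
    · intro s hs r hr e
      simp [R1, R2, α, Prod.ext_iff] at e
      obtain ⟨e1, e3⟩ := e
      exact ⟨by rcases e1 with e1 | e1; exacts [e1, by norm_num at e1],
        e3.resolve_right (by linarith)⟩
    · intro p hp hp'
      obtain ⟨q1, q2⟩ := hpl p hp
      rw [car_union, mem_union, mem_car_dbl, car_pair] at hp'
      rcases hp' with hp' | (hp' | hp') | (hp' | hp')
      · left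
        refine (hz p hp' q1).resolve_right ?_
        rintro rfl
        simp [γ] at q2; norm_num at q2
      · right
        have hp2 : p ∈ tri R2 R1 α := by
          have : tri R2 R1 α = tri α R1 R2 := by
            unfold tri; congr 1; ext; simp; tauto
          rwa [this]
        refine tri_eq_left (fnl 0 (-1) 0) hp2 ?_ ?_ ?_
        · simp [fnl_apply, R1, R2]; linarith
        · simp [fnl_apply, α, R2]; linarith
        · exact segment_fnl_le _ hp' (by simp [fnl_apply, R2]) (by simp [fnl_apply, L2, R2])
      · have := segment_fnl_lt (fnl 1 0 0) (k := 0) hp' (by simp [fnl_apply, L2]; norm_num)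
          (by simp [fnl_apply, γ]; norm_num)
        simp [fnl_apply] at this; linarith
      · have := segment_fnl_lt (fnl 0 0 (-1)) (k := 0) hp' (by simp [fnl_apply, R2]; linarith)
          (by simp [fnl_apply, L2]; linarith)
        simp [fnl_apply, tau] at this; linarith
      · have := segment_fnl_lt (fnl 0 0 (-1)) (k := 0) hp' (by simp [fnl_apply, L2]; linarith)
          (by simp [fnl_apply, γ]; linarith)
        simp [fnl_apply, tau] at this; linarith
    · intro p hp hp'
      have h1 := (hpl p hp).1
      have h2 := (hpl _ hp').1
      simp [tau] at h2; linarith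
  refine s4.trans ?_
  have s4' := s4.1
  rw [e2] at s4' ⊢
  rw [e3]
  have hpl : ∀ p ∈ tri L2 L1 γ, p.2.2 = h ∧ p.1 ≤ -1/4 := by
    intro p hp
    have h1 := tri_fnl_le (fnl 0 0 1) (k := h) hp (by simp [fnl_apply, L2])
      (by simp [fnl_apply, L1]) (by simp [fnl_apply, γ])
    have h2 := tri_fnl_le (fnl 0 0 (-1)) (k := -h) hp (by simp [fnl_apply, L2])
      (by simp [fnl_apply, L1]) (by simp [fnl_apply, γ])
    have h3 := tri_fnl_le (fnl 1 0 0) (k := -1/4) hp (by simp [fnl_apply, L2]; norm_num)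
      (by simp [fnl_apply, L1]; norm_num) (by simp [fnl_apply, γ])
    simp [fnl_apply] at h1 h2 h3
    exact ⟨le_antisymm h1 h2, by linarith⟩
  refine s4'.move (hY.union (tauSym_dbl _)) ?_ ?_ ?_
  · intro s hs r hr e
    simp [L1, L2, γ, Prod.ext_iff] at e
    obtain ⟨e1, e3⟩ := e
    exact ⟨e3.resolve_right (by linarith), by rcases e1 with e1 | e1; exacts [e1, by norm_num at e1]⟩
  · intro p hp hp'
    obtain ⟨q1, q2⟩ := hpl p hp
    rw [car_union, mem_union, mem_car_dbl, car_insert, car_pair] at hp'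
    have hτ : ∀ u v : R3, u.2.2 = h → v.2.2 = h → tau p ∉ segment ℝ u v := fun u v hu hv hp' => by
      have := segment_fnl_lt (fnl 0 0 (-1)) (k := 0) hp' (by simp [fnl_apply, hu]; linarith)
          (by simp [fnl_apply, hv]; linarith)
      simp [fnl_apply, tau] at this; linarith
    have hr : ∀ u v : R3, 0 < u.1 → 0 < v.1 → p ∉ segment ℝ u v := fun u v hu hv hp' => by
      have := segment_fnl_lt (fnl (-1) 0 0) (k := 0) hp' (by simp [fnl_apply, hu])
          (by simp [fnl_apply, hv])
      simp [fnl_apply] at this; linarith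
    rcases hp' with hp' | (hp' | hp' | hp') | (hp' | hp' | hp')
    · right
      refine (hz p hp' q1).resolve_left ?_
      rintro rfl
      simp [α] at q2; norm_num at q2
    · exact absurd hp' (hr _ _ (by simp [α]) (by simp [R1]))
    · exact absurd hp' (hr _ _ (by simp [R1]) (by simp [R2]))
    · left
      refine tri_eq_left (fnl 0 (-1) 0) hp ?_ ?_ ?_
      · simp [fnl_apply, L1, L2]; linarith
      · simp [fnl_apply, γ, L2]; linarith
      · exact segment_fnl_le _ hp' (by simp [fnl_apply, L2, R2]) (by simp [fnl_apply, L2])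
    · exact absurd hp' (hτ _ _ rfl rfl)
    · exact absurd hp' (hτ _ _ rfl rfl)
    · exact absurd hp' (hτ _ _ rfl rfl)
  · intro p hp hp'
    have h1 := (hpl p hp).1
    have h2 := (hpl _ hp').1
    simp [tau] at h2; linarith


theorem Lk.lift_move {X : Set (R3 × R3)} {ax ay az cx cy cz : ℝ} {y η : ℝ}
    (hL : Lk (X ∪ dbl {((ax, ay, az), (cx, cy, cz))}))
    (hX : TauSym X) (hac : cx < ax) (haz : az < η) (hcz : cz < η)
    (hT1 : ∀ x ∈ convexHull ℝ {(ax, ay, az), (cx, cy, cz), (ax, y, η), (cx, y, η)},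
      x ∈ car X → x = (ax, ay, az) ∨ x = (cx, cy, cz))
    (hT2 : ∀ x ∈ convexHull ℝ {(ax, ay, az), (cx, cy, cz), (ax, y, η), (cx, y, η)},
      tau x ∈ convexHull ℝ {(ax, ay, az), (cx, cy, cz), (ax, y, η), (cx, y, η)} →
      (x = (ax, ay, az) ∧ tau (ax, ay, az) = (ax, ay, az)) ∨
      (x = (cx, cy, cz) ∧ tau (cx, cy, cz) = (cx, cy, cz))) :
    IsoTo (X ∪ dbl {((ax, ay, az), (cx, cy, cz))})
      ((X ∪ dbl {((ax, ay, az), (ax, y, η)), ((cx, y, η), (cx, cy, cz))}) ∪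
        dbl {((ax, y, η), (cx, y, η))}) := by
  refine hL.quad_fnl hX (convex_convexHull _ _) (subset_convexHull _ _ (Or.inl rfl))
    (subset_convexHull _ _ (Or.inr (Or.inr (Or.inl rfl))))
    (subset_convexHull _ _ (Or.inr (Or.inr (Or.inr rfl))))
    (subset_convexHull _ _ (Or.inr (Or.inl rfl))) ?_ ?_ hT1 hT2 (fnl (-1) 0 0) ?_ ?_ ?_
  · intro s hs r hr e
    simp [Prod.ext_iff] at e
    obtain ⟨e1, e2, e3⟩ := e
    have : r = 0 := by
      rcases e1 with e1 | e1
      · exact e1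
      · linarith
    subst this
    simp at e3
    exact ⟨e3.resolve_right (by linarith), rfl⟩
  · intro s hs r hr e
    simp [Prod.ext_iff] at e
    obtain ⟨e1, e2, e3⟩ := e
    exact ⟨e1.resolve_right (by linarith), e3.resolve_right (by linarith)⟩
  · simp [fnl_apply]
  · simp [fnl_apply]; exact hac
  · simp [fnl_apply]; exact hac

theorem Lk.widen_move {X : Set (R3 × R3)} {ax ay az cx cy cz : ℝ} {y η h : ℝ}
    (hL : Lk ((X ∪ dbl {((ax, ay, az), (ax, y, η)), ((cx, y, η), (cx, cy, cz))}) ∪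
      dbl {((ax, y, η), (cx, y, η))}))
    (hX : TauSym X) (hac : cx < ax) (ha : ax < 1/4) (hc : -1/4 < cx)
    (haz : |az| < η) (hcz : |cz| < η) (hη : η < h)
    (hyX : ∀ p ∈ car X, p.2.1 = y → η ≤ p.2.2 → 1/4 < |p.1|) :
    IsoTo ((X ∪ dbl {((ax, ay, az), (ax, y, η)), ((cx, y, η), (cx, cy, cz))}) ∪
      dbl {((ax, y, η), (cx, y, η))})
      (((X ∪ dbl {((ax, ay, az), (ax, y, η)), ((cx, y, η), (cx, cy, cz))}) ∪
        dbl {((ax, y, η), (1/4, y, h)), ((-1/4, y, h), (cx, y, η))}) ∪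
        dbl {((1/4, y, h), (-1/4, y, h))}) := by
  rw [abs_lt] at haz hcz
  have hη0 : 0 < η := by linarith
  set a : R3 := (ax, ay, az) with hadef
  set c : R3 := (cx, cy, cz) with hcdef
  set α' : R3 := (ax, y, η) with hα'
  set γ' : R3 := (cx, y, η) with hγ'
  set α : R3 := (1/4, y, h) with hα
  set γ : R3 := (-1/4, y, h) with hγ
  refine hL.quad_fnl (T := {p | p.2.1 = y ∧ η ≤ p.2.2 ∧ -1/4 ≤ p.1 ∧ p.1 ≤ 1/4})
    (hX.union (tauSym_dbl _)) ?_ ?_ ?_ ?_ ?_ ?_ ?_ ?_ ?_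
    (fnl (η - h) 0 (1/4 - ax)) ?_ ?_ ?_
  · intro p hp q hq u v hu hv huv
    obtain ⟨p1, p2, p3, p4⟩ := hp
    obtain ⟨q1, q2, q3, q4⟩ := hq
    obtain rfl : u = 1 - v := by linarith
    refine ⟨?_, ?_, ?_, ?_⟩ <;> simp
    · rw [p1, q1]; ring
    · nlinarith
    · nlinarith
    · nlinarith
  · simp [α']; constructor <;> linarith
  · simp [α]; constructor <;> linarith
  · simp [γ]; constructor <;> linarith
  · simp [γ']; constructor <;> linarith
  · intro s hs r hr e
    simp [γ', α', α, Prod.ext_iff] at e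
    obtain ⟨e1, e3⟩ := e
    have : s = r := e3.resolve_right (by linarith)
    subst this
    have : s * (ax - cx) = 0 := by linarith
    have := (mul_eq_zero.1 this).resolve_right (by linarith)
    exact ⟨this, this⟩
  · intro s hs r hr e
    simp [γ', α, γ, Prod.ext_iff] at e
    obtain ⟨e1, e3⟩ := e
    have := e3.resolve_right (by linarith)
    subst this
    refine ⟨by linarith, rfl⟩
  · rintro p ⟨p1, p2, p3, p4⟩ hp
    rw [car_union, mem_union, mem_car_dbl, car_pair] at hp
    rcases hp with hp | (hp | hp) | (hp | hp)
    · have := hyX p hp p1 p2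
      rcases lt_abs.1 this with h | h <;> linarith
    · left
      exact eq_right_of_fnl (fnl 0 0 1) hp (by simp [fnl_apply, a, α']; linarith)
        (by simp [fnl_apply, α']; linarith)
    · right
      exact eq_left_of_fnl (fnl 0 0 1) hp (by simp [fnl_apply, c, γ']; linarith)
        (by simp [fnl_apply, γ']; linarith)
    · have := segment_fnl_lt (fnl 0 0 (-1)) (k := η) hp (by simp [fnl_apply, a]; linarith)
        (by simp [fnl_apply, α']; linarith)
      simp [fnl_apply, tau] at this; linarith
    · have := segment_fnl_lt (fnl 0 0 (-1)) (k := η) hp (by simp [fnl_apply, γ']; linarith)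
        (by simp [fnl_apply, c]; linarith)
      simp [fnl_apply, tau] at this; linarith
  · rintro p ⟨p1, p2, p3, p4⟩ ⟨q1, q2, q3, q4⟩
    simp [tau] at q2; linarith
  · simp [fnl_apply, α', α]; ring
  · simp [fnl_apply, γ, α]; nlinarith
  · simp [fnl_apply, γ', α]; nlinarith

theorem eq_of_mem_car_level {X : Set (R3 × R3)} {ax ay az cx cy cz : ℝ} {y η h : ℝ}
    (haz : |az| < η) (hcz : |cz| < η) (hη : η < h) (hzX : ∀ p ∈ car X, |p.2.2| < h) :
    ∀ p ∈ car ((X ∪ dbl {((ax, ay, az), (ax, y, η)), ((cx, y, η), (cx, cy, cz))}) ∪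
      dbl {((ax, y, η), (1/4, y, h)), ((-1/4, y, h), (cx, y, η))}),
      p.2.2 = h → p = (1/4, y, h) ∨ p = (-1/4, y, h) := by
  rw [abs_lt] at haz hcz
  have hη0 : 0 < η := by linarith
  set a : R3 := (ax, ay, az) with hadef
  set c : R3 := (cx, cy, cz) with hcdef
  set α' : R3 := (ax, y, η) with hα'
  set γ' : R3 := (cx, y, η) with hγ'
  set α : R3 := (1/4, y, h) with hα
  set γ : R3 := (-1/4, y, h) with hγ
  intro p hp hph
  rw [car_union, car_union, mem_union, mem_union, mem_car_dbl, mem_car_dbl, car_pair,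
    car_pair] at hp
  rcases hp with (hp | (hp | hp) | (hp | hp)) | (hp | hp) | (hp | hp)
  · have := (abs_lt.1 (hzX p hp)).2; linarith
  · have := segment_fnl_lt (fnl 0 0 1) (k := h) hp (by simp [fnl_apply, a]; linarith)
        (by simp [fnl_apply, α']; linarith)
    simp [fnl_apply] at this; linarith
  · have := segment_fnl_lt (fnl 0 0 1) (k := h) hp (by simp [fnl_apply, γ']; linarith)
        (by simp [fnl_apply, c]; linarith)
    simp [fnl_apply] at this; linarith
  · have := segment_fnl_lt (fnl 0 0 (-1)) (k := h) hp (by simp [fnl_apply, a]; linarith)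
        (by simp [fnl_apply, α']; linarith)
    simp [fnl_apply, tau] at this; linarith
  · have := segment_fnl_lt (fnl 0 0 (-1)) (k := h) hp (by simp [fnl_apply, γ']; linarith)
        (by simp [fnl_apply, c]; linarith)
    simp [fnl_apply, tau] at this; linarith
  · left
    exact eq_right_of_fnl (fnl 0 0 1) hp (by simp [fnl_apply, α, α']; linarith)
        (by simp [fnl_apply, α]; linarith)
  · right
    exact eq_left_of_fnl (fnl 0 0 1) hp (by simp [fnl_apply, γ, γ']; linarith)
        (by simp [fnl_apply, γ]; linarith)
  · have := segment_fnl_lt (fnl 0 0 (-1)) (k := h) hp (by simp [fnl_apply, α']; linarith)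
        (by simp [fnl_apply, α]; linarith)
    simp [fnl_apply, tau] at this; linarith
  · have := segment_fnl_lt (fnl 0 0 (-1)) (k := h) hp (by simp [fnl_apply, γ]; linarith)
        (by simp [fnl_apply, γ']; linarith)
    simp [fnl_apply, tau] at this; linarith

theorem Lk.piece {X : Set (R3 × R3)} {a c : R3} {y η h : ℝ} (hL : Lk (X ∪ dbl {(a, c)}))
    (hX : TauSym X) (hac : c.1 < a.1) (ha : a.1 < 1/4) (hc : -1/4 < c.1) (hy : y < 2)
    (haz : |a.2.2| < η) (hcz : |c.2.2| < η) (hη : η < h)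
    (hT1 : ∀ x ∈ convexHull ℝ {a, c, (a.1, y, η), (c.1, y, η)}, x ∈ car X → x = a ∨ x = c)
    (hT2 : ∀ x ∈ convexHull ℝ {a, c, (a.1, y, η), (c.1, y, η)},
      tau x ∈ convexHull ℝ {a, c, (a.1, y, η), (c.1, y, η)} →
      (x = a ∧ tau a = a) ∨ (x = c ∧ tau c = c))
    (hyX : ∀ p ∈ car X, p.2.1 = y → η ≤ p.2.2 → 1/4 < |p.1|)
    (hzX : ∀ p ∈ car X, |p.2.2| < h) :
    IsoTo (X ∪ dbl {(a, c)}) (X ∪ dbl (legs a c y η h ∪ outer y h)) := by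
  obtain ⟨ax, ay, az⟩ := a
  obtain ⟨cx, cy, cz⟩ := c
  have s1 := hL.lift_move hX hac (abs_lt.1 haz).2 (abs_lt.1 hcz).2 hT1 hT2
  have s2 := s1.1.widen_move hX hac ha hc haz hcz hη hyX
  have s3 := s2.1.outer_move hy (((abs_nonneg _).trans_lt haz).trans hη)
    ((hX.union (tauSym_dbl _)).union (tauSym_dbl _)) (eq_of_mem_car_level haz hcz hη hzX)
  have e0 : X ∪ dbl (legs (ax, ay, az) (cx, cy, cz) y η h ∪ outer y h)
      = ((X ∪ dbl {((ax, ay, az), (ax, y, η)), ((cx, y, η), (cx, cy, cz))}) ∪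
        dbl {((ax, y, η), (1/4, y, h)), ((-1/4, y, h), (cx, y, η))}) ∪
        dbl (outer y h) := by
    ext e
    simp only [legs, mem_union, mem_dbl, mem_insert_iff, mem_singleton_iff]; tauto
  rw [e0]
  exact s1.trans (s2.trans s3)

/-! ### Generic partitions of an edge -/

/-- The convex combination of a point of the edge `e` and a point of the line at height `η`. -/
def apex (e : R3 × R3) (η s s' y μ : ℝ) : R3 :=
  (1 - μ) • lin id e s + μ • ((lin id e s').1, y, η)

theorem lin_id_fst (e : R3 × R3) (s : ℝ) : (lin id e s).1 = e.1.1 + s * (e.2.1 - e.1.1) := by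
  simp [lin]

theorem lin_id_snd (e : R3 × R3) (s : ℝ) :
    (lin id e s).2.1 = e.1.2.1 + s * (e.2.2.1 - e.1.2.1) := by
  simp [lin]

theorem lin_id_trd (e : R3 × R3) (s : ℝ) :
    (lin id e s).2.2 = e.1.2.2 + s * (e.2.2.2 - e.1.2.2) := by
  simp [lin]

theorem continuous_apex (e : R3 × R3) (η : ℝ) :
    Continuous fun q : (ℝ × ℝ × ℝ) × ℝ => apex e η q.1.1 q.1.2.1 q.1.2.2 q.2 := by
  unfold apex lin; fun_prop

open Filter Topology in
theorem eventually_apex_notMem {e f : R3 × R3} {η s₀ y₀ : ℝ}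
    (h : ∀ μ ∈ Icc (0:ℝ) 1, apex e η s₀ s₀ y₀ μ ∉ segment ℝ f.1 f.2) :
    ∀ᶠ q : ℝ × ℝ × ℝ in 𝓝 (s₀, s₀, y₀), ∀ μ ∈ Icc (0:ℝ) 1,
      apex e η q.1 q.2.1 q.2.2 μ ∉ segment ℝ f.1 f.2 := by
  refine isCompact_Icc.eventually_forall_of_forall_eventually fun μ hμ => ?_
  have hcl : IsClosed (segment ℝ f.1 f.2) := by
    rw [← convexHull_pair]
    exact ((Set.toFinite {f.1, f.2}).isCompact_convexHull ℝ).isClosed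
  exact ((hcl.isOpen_compl.preimage (continuous_apex e η)).mem_nhds (h μ hμ))

open Filter Topology in
theorem exists_bad_of_notMem {e f : R3 × R3} {η s₀ : ℝ} (hf : f.1.1 ≠ f.2.1)
    (hη : (lin id e s₀).2.2 < η) (hp : lin id e s₀ ∉ segment ℝ f.1 f.2) :
    ∃ b : ℝ, ∀ y₀ ≠ b, ∀ᶠ q : ℝ × ℝ × ℝ in 𝓝 (s₀, s₀, y₀), ∀ μ ∈ Icc (0:ℝ) 1,
      apex e η q.1 q.2.1 q.2.2 μ ∈ segment ℝ f.1 f.2 → μ = 0 := by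
  set p := lin id e s₀ with hpdef
  set r := (p.1 - f.1.1) / (f.2.1 - f.1.1) with hr
  set g := lin id f r with hg
  refine ⟨p.2.1 + (g.2.1 - p.2.1) * ((η - p.2.2) / (g.2.2 - p.2.2)), fun y₀ hy => ?_⟩
  have key : ∀ μ ∈ Icc (0:ℝ) 1, apex e η s₀ s₀ y₀ μ ∉ segment ℝ f.1 f.2 := by
    intro μ hμ hmem
    obtain ⟨r', hr', e1⟩ := mem_segment_iff_lin.1 hmem
    have hx : (apex e η s₀ s₀ y₀ μ).1 = p.1 := by simp [apex, ← hpdef]; ring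
    have hrr : r' = r := by
      have h1 := congrArg Prod.fst e1
      rw [hx, lin_id_fst] at h1
      rw [hr, eq_div_iff (sub_ne_zero.2 hf.symm)]; linarith
    subst hrr
    rw [← hg] at e1
    have h2 : g.2.1 = p.2.1 + μ * (y₀ - p.2.1) := by
      rw [e1]; simp [apex, ← hpdef]; ring
    have h3 : g.2.2 = p.2.2 + μ * (η - p.2.2) := by
      rw [e1]; simp [apex, ← hpdef]; ring
    have hμ0 : μ ≠ 0 := by
      rintro rfl
      apply hp
      rw [mem_segment_iff_lin]
      exact ⟨r, hr', by rw [← hg, e1]; simp [apex, ← hpdef]⟩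
    apply hy
    have : (η - p.2.2) ≠ 0 := by linarith
    rw [h2, h3]
    field_simp
    ring
  filter_upwards [eventually_apex_notMem key] with q hq μ hμ h
  exact absurd h (hq μ hμ)

open Filter Topology in
theorem exists_bad_of_mem {e f : R3 × R3} {η s₀ : ℝ} (he : e.1.1 ≠ e.2.1)
    (hη : (lin id e s₀).2.2 < η) (hp : lin id e s₀ ∈ segment ℝ f.1 f.2) :
    ∃ b : ℝ, ∀ y₀ ≠ b, ∀ᶠ q : ℝ × ℝ × ℝ in 𝓝 (s₀, s₀, y₀), ∀ μ ∈ Icc (0:ℝ) 1,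
      apex e η q.1 q.2.1 q.2.2 μ ∈ segment ℝ f.1 f.2 → μ = 0 := by
  set p := lin id e s₀ with hpdef
  obtain ⟨r₀, hr₀, hfp⟩ := mem_segment_iff_lin.1 hp
  have hD : e.2.1 - e.1.1 ≠ 0 := sub_ne_zero.2 he.symm
  set κ := (f.2.1 - f.1.1) / (e.2.1 - e.1.1) with hκ
  have hκ' : f.2.1 - f.1.1 = κ * (e.2.1 - e.1.1) := by rw [hκ]; field_simp
  set v₁ := (f.2.2.1 - f.1.2.1) - κ * (e.2.2.1 - e.1.2.1) with hv1
  set v₂ := (f.2.2.2 - f.1.2.2) - κ * (e.2.2.2 - e.1.2.2) with hv2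
  refine ⟨p.2.1 + (η - p.2.2) * (v₁ / v₂), fun y₀ hy => ?_⟩
  have hw2 : ∀ᶠ q : ℝ × ℝ × ℝ in 𝓝 (s₀, s₀, y₀), (lin id e q.2.1).2.2 < η := by
    have hc : Continuous fun q : ℝ × ℝ × ℝ => (lin id e q.2.1).2.2 := by unfold lin; fun_prop
    exact hc.continuousAt.eventually_lt continuousAt_const hη
  have hcr : ∀ᶠ q : ℝ × ℝ × ℝ in 𝓝 (s₀, s₀, y₀), (v₁ = 0 ∧ v₂ = 0) ∨
      (q.2.2 - (lin id e q.2.1).2.1) * v₂ - (η - (lin id e q.2.1).2.2) * v₁ ≠ 0 := by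
    by_cases h0 : v₁ = 0 ∧ v₂ = 0
    · exact Eventually.of_forall fun _ => Or.inl h0
    · have hc : Continuous fun q : ℝ × ℝ × ℝ =>
          (q.2.2 - (lin id e q.2.1).2.1) * v₂ - (η - (lin id e q.2.1).2.2) * v₁ := by
        unfold lin; fun_prop
      have hne : (y₀ - p.2.1) * v₂ - (η - p.2.2) * v₁ ≠ 0 := by
        intro h
        by_cases h2 : v₂ = 0
        · rw [h2] at h
          have : v₁ = 0 := by
            have : (η - p.2.2) * v₁ = 0 := by linarith
            exact (mul_eq_zero.1 this).resolve_left (by linarith)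
          exact h0 ⟨this, h2⟩
        · apply hy
          field_simp
          linarith
      exact (hc.continuousAt.eventually_ne hne).mono fun _ h => Or.inr h
  filter_upwards [hw2, hcr] with q h1 h2 μ hμ hmem
  obtain ⟨r, hr, e1⟩ := mem_segment_iff_lin.1 hmem
  have x1 := congrArg Prod.fst e1
  have y1 := congrArg (fun p : R3 => p.2.1) e1
  have z1 := congrArg (fun p : R3 => p.2.2) e1
  have x0 := congrArg Prod.fst hfp
  have y0 := congrArg (fun p : R3 => p.2.1) hfp
  have z0 := congrArg (fun p : R3 => p.2.2) hfp
  simp only [apex, hpdef, lin_id_fst, lin_id_snd, lin_id_trd, Prod.fst_add, Prod.snd_add,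
    Prod.smul_fst, Prod.smul_snd, smul_eq_mul] at x1 y1 z1 x0 y0 z0 h1 h2
  set S := (1 - μ) * q.1 + μ * q.2.1 with hS
  have hxr : S - s₀ = (r - r₀) * κ := by
    have : (S - s₀ - (r - r₀) * κ) * (e.2.1 - e.1.1) = 0 := by
      rw [hS]; linear_combination x0 - x1 + (r - r₀) * hκ'
    have := (mul_eq_zero.1 this).resolve_right hD
    linarith
  have hy2 : μ * (q.2.2 - (e.1.2.1 + q.2.1 * (e.2.2.1 - e.1.2.1))) = (r - r₀) * v₁ := by
    rw [hv1]
    have : (S - s₀) * (e.2.2.1 - e.1.2.1) = (r - r₀) * κ * (e.2.2.1 - e.1.2.1) := by rw [hxr]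
    rw [hS] at this
    linear_combination y0 - y1 - this
  have hz2 : μ * (η - (e.1.2.2 + q.2.1 * (e.2.2.2 - e.1.2.2))) = (r - r₀) * v₂ := by
    rw [hv2]
    have : (S - s₀) * (e.2.2.2 - e.1.2.2) = (r - r₀) * κ * (e.2.2.2 - e.1.2.2) := by rw [hxr]
    rw [hS] at this
    linear_combination z0 - z1 - this
  rcases h2 with ⟨h2, h3⟩ | h2
  · rw [h3, mul_zero] at hz2
    exact (mul_eq_zero.1 hz2).resolve_right (by linarith)
  · by_contra hμ0
    apply h2
    apply mul_left_cancel₀ hμ0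
    linear_combination v₂ * hy2 - v₁ * hz2

open Filter Topology in
theorem exists_bad_finset {e : R3 × R3} {η s₀ : ℝ} {X : Set (R3 × R3)} (hX : X.Finite)
    (he : e.1.1 ≠ e.2.1) (hXx : ∀ f ∈ X, f.1.1 ≠ f.2.1) (hη : (lin id e s₀).2.2 < η) :
    ∃ F : Set ℝ, F.Finite ∧ ∀ y₀ ∉ F, ∀ᶠ q : ℝ × ℝ × ℝ in 𝓝 (s₀, s₀, y₀), ∀ f ∈ X,
      ∀ μ ∈ Icc (0:ℝ) 1, apex e η q.1 q.2.1 q.2.2 μ ∈ segment ℝ f.1 f.2 → μ = 0 := by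
  have : ∀ f ∈ X, ∃ b : ℝ, ∀ y₀ ≠ b, ∀ᶠ q : ℝ × ℝ × ℝ in 𝓝 (s₀, s₀, y₀), ∀ μ ∈ Icc (0:ℝ) 1,
      apex e η q.1 q.2.1 q.2.2 μ ∈ segment ℝ f.1 f.2 → μ = 0 := fun f hf => by
    by_cases h : lin id e s₀ ∈ segment ℝ f.1 f.2
    · exact exists_bad_of_mem he hη h
    · exact exists_bad_of_notMem (hXx f hf) hη h
  choose! b hb using this
  refine ⟨b '' X, hX.image _, fun y₀ hy => ?_⟩
  exact (hX.eventually_all).2 fun f hf => hb f hf y₀ fun h => hy ⟨f, hf, h.symm⟩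

theorem exists_injOn_choice (U : ℕ → Set ℝ) (n : ℕ) (hU : ∀ j < n, (U j).Infinite) :
    ∃ y : ℕ → ℝ, (∀ j < n, y j ∈ U j) ∧ InjOn y {j | j < n} := by
  induction n with
  | zero => exact ⟨fun _ => 0, by simp, by simp⟩
  | succ n ih =>
    obtain ⟨y, h1, h2⟩ := ih fun j hj => hU j (hj.trans n.lt_succ_self)
    obtain ⟨z, hz, hz'⟩ := ((hU n n.lt_succ_self).sdiff
      ((Set.finite_lt_nat n).image y)).nonempty
    refine ⟨Function.update y n z, fun j hj => ?_, fun i hi j hj hij => ?_⟩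
    · rcases (Nat.lt_succ_iff_lt_or_eq.1 hj) with h | rfl
      · rw [Function.update_of_ne h.ne]; exact h1 j h
      · simpa using hz
    · rcases (Nat.lt_succ_iff_lt_or_eq.1 hi) with h | rfl <;>
      rcases (Nat.lt_succ_iff_lt_or_eq.1 hj) with h' | rfl
      · rw [Function.update_of_ne h.ne, Function.update_of_ne h'.ne] at hij
        exact h2 h h' hij
      · rw [Function.update_of_ne h.ne, Function.update_self] at hij
        exact absurd ⟨i, h, hij⟩ hz'
      · rw [Function.update_of_ne h'.ne, Function.update_self] at hij
        exact absurd ⟨j, h', hij.symm⟩ hz'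
      · rfl

open Filter Topology in
/-- A partition of the edge `e` with generic distinct values of `y` over its intervals. -/
theorem exists_partition {e : R3 × R3} {η l u : ℝ} {X : Set (R3 × R3)} (hX : X.Finite)
    (hlu : l < u) (he : e.1.1 ≠ e.2.1) (hXx : ∀ f ∈ X, f.1.1 ≠ f.2.1)
    (hη : ∀ s ∈ Icc (0:ℝ) 1, (lin id e s).2.2 < η) :
    ∃ (n : ℕ) (s y : ℕ → ℝ), s 0 = 0 ∧ s n = 1 ∧ (∀ j < n, s j < s (j + 1)) ∧
      InjOn y {j | j < n} ∧ (∀ j < n, l < y j ∧ y j < u) ∧ (∀ j ≤ n, s j ∈ Icc (0:ℝ) 1) ∧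
      ∀ j < n, ∀ f ∈ X, ∀ t ∈ Icc (s j) (s (j + 1)), ∀ t' ∈ Icc (s j) (s (j + 1)),
        ∀ μ ∈ Icc (0:ℝ) 1, apex e η t t' (y j) μ ∈ segment ℝ f.1 f.2 → μ = 0 := by
  have loc : ∀ s₀ ∈ Icc (0:ℝ) 1, ∃ ε > 0, ∃ U : Set ℝ, U.Infinite ∧ U ⊆ Ioo l u ∧
      ∀ t, |t - s₀| < ε → ∀ t', |t' - s₀| < ε → ∀ y ∈ U, ∀ f ∈ X,
        ∀ μ ∈ Icc (0:ℝ) 1, apex e η t t' y μ ∈ segment ℝ f.1 f.2 → μ = 0 := by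
    intro s₀ hs₀
    obtain ⟨F, hF, h⟩ := exists_bad_finset hX he hXx (hη s₀ hs₀)
    obtain ⟨y₀, hy₀, hyF⟩ := ((Ioo_infinite hlu).sdiff hF).nonempty
    obtain ⟨ε, hε, hb⟩ := Metric.eventually_nhds_iff.1 (h y₀ hyF)
    have hm : max l (y₀ - ε) < min u (y₀ + ε) :=
      max_lt (lt_min hlu (by linarith [hy₀.1])) (lt_min (by linarith [hy₀.2]) (by linarith))
    refine ⟨ε, hε, Ioo (max l (y₀ - ε)) (min u (y₀ + ε)), Ioo_infinite hm,
      Ioo_subset_Ioo (le_max_left _ _) (min_le_left _ _), fun t ht t' ht' y hy => ?_⟩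
    have hy1 := (le_max_right _ _).trans_lt hy.1
    have hy2 := hy.2.trans_le (min_le_right _ _)
    refine hb (y := (t, t', y)) ?_
    simp only [Prod.dist_eq, Real.dist_eq, max_lt_iff]
    exact ⟨ht, ht', by rw [abs_lt]; constructor <;> linarith⟩
  choose! ε hε U hU hUl hloc using loc
  obtain ⟨δ, hδ, hL⟩ := lebesgue_number_lemma_of_metric (c := fun s : Icc (0:ℝ) 1 =>
    Metric.ball (s : ℝ) (ε s)) isCompact_Icc (fun _ => Metric.isOpen_ball) fun s hs =>
      mem_iUnion.2 ⟨⟨s, hs⟩, Metric.mem_ball_self (hε s hs)⟩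
  obtain ⟨n, hn⟩ := exists_nat_gt (1 / δ)
  have hn0 : (0:ℝ) < n := (by positivity : (0:ℝ) < 1 / δ).trans hn
  have hn1 : 1 / (n:ℝ) < δ := by rw [div_lt_comm₀ hn0 hδ]; exact hn
  set s : ℕ → ℝ := fun j => j / n with hs
  have hsI : ∀ j ≤ n, s j ∈ Icc (0:ℝ) 1 := fun j hj =>
    ⟨by positivity, by rw [hs, div_le_one hn0]; exact_mod_cast hj⟩
  have hstep : ∀ j, s (j + 1) = s j + 1 / n := fun j => by simp [hs]; ring
  choose! c hc using fun j (hj : j < n) => hL (s j) (hsI j hj.le)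
  obtain ⟨y, hy, hyi⟩ := exists_injOn_choice (fun j => U (c j)) n fun j _ => hU _ (c j).2
  refine ⟨n, s, y, by simp [hs], div_self hn0.ne', fun j _ => ?_, hyi,
    fun j hj => hUl _ (c j).2 (hy j hj), hsI, fun j hj f hf t ht t' ht' => ?_⟩
  · rw [hstep]; have : 0 < 1 / (n:ℝ) := by positivity
    linarith
  · have hb : ∀ t ∈ Icc (s j) (s (j + 1)), |t - c j| < ε (c j) := fun t ht => by
      have : t ∈ Metric.ball (s j) δ := by
        rw [Metric.mem_ball, Real.dist_eq, abs_lt]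
        rw [hstep] at ht
        constructor <;> linarith [ht.1, ht.2]
      simpa [Real.dist_eq] using hc j hj this
    exact hloc _ (c j).2 t (hb t ht) t' (hb t' ht') (y j) (hy j hj) f hf

/-! ### Replacing an edge running backwards -/

/-- The edge `e` runs backwards, on one side of the plane `x = 0`. -/
structure Backward (e : R3 × R3) : Prop where
  lt : e.2.1 < e.1.1
  lo : -1/4 < e.2.1
  hi : e.1.1 < 1/4
  side : 0 ≤ e.2.1 ∨ e.1.1 ≤ 0
  fst : e.1.1 = 0 → 0 ≤ e.1.2.2
  snd : e.2.1 = 0 → 0 ≤ e.2.2.2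

theorem lin_id_zero (e : R3 × R3) : lin id e 0 = e.1 := by simp [lin]

theorem lin_id_one (e : R3 × R3) : lin id e 1 = e.2 := by simp [lin]

theorem segment_lin_subset {e : R3 × R3} {s s' : ℝ} (h : s ≤ s') {x : R3}
    (hx : x ∈ segment ℝ (lin id e s) (lin id e s')) : ∃ t ∈ Icc s s', x = lin id e t := by
  obtain ⟨a, b, ha, hb, hab, rfl⟩ := hx
  refine ⟨a * s + b * s', ⟨?_, ?_⟩, ?_⟩
  · obtain rfl : a = 1 - b := by linarith
    nlinarith
  · obtain rfl : a = 1 - b := by linarith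
    nlinarith
  · obtain rfl : a = 1 - b := by linarith
    simp only [lin, id]
    module

theorem exists_apex_of_mem_convexHull {e : R3 × R3} {η s s' y : ℝ} (h : s ≤ s') {x : R3}
    (hx : x ∈ convexHull ℝ {lin id e s, lin id e s', ((lin id e s).1, y, η),
      ((lin id e s').1, y, η)}) :
    ∃ t ∈ Icc s s', ∃ t' ∈ Icc s s', ∃ μ ∈ Icc (0:ℝ) 1, x = apex e η t t' y μ := by
  rw [← convexJoin_segments, mem_convexJoin] at hx
  obtain ⟨p, hp, q, hq, a, b, ha, hb, hab, rfl⟩ := hx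
  obtain ⟨t, ht, rfl⟩ := segment_lin_subset h hp
  have : ∃ t' ∈ Icc s s', q = ((lin id e t').1, y, η) := by
    obtain ⟨u, v, hu, hv, huv, rfl⟩ := hq
    obtain ⟨t', ht', e'⟩ := segment_lin_subset (e := e) h ⟨u, v, hu, hv, huv, rfl⟩
    refine ⟨t', ht', ?_⟩
    rw [← e']
    simp [← add_mul, huv]
  obtain ⟨t', ht', rfl⟩ := this
  exact ⟨t, ht, t', ht', b, ⟨hb, by linarith⟩, by rw [apex]; congr 2; linarith⟩

theorem apex_fst (e : R3 × R3) (η t t' y μ : ℝ) :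
    (apex e η t t' y μ).1 = (lin id e ((1 - μ) * t + μ * t')).1 := by
  simp [apex, lin]; ring

theorem apex_snd (e : R3 × R3) (η t t' y μ : ℝ) :
    (apex e η t t' y μ).2.1 = (1 - μ) * (lin id e t).2.1 + μ * y := by
  simp [apex]

theorem apex_trd (e : R3 × R3) (η t t' y μ : ℝ) :
    (apex e η t t' y μ).2.2 = (1 - μ) * (lin id e t).2.2 + μ * η := by
  simp [apex]

theorem apex_zero (e : R3 × R3) (η t t' y : ℝ) : apex e η t t' y 0 = lin id e t := by
  simp [apex]

theorem apex_eq_of_eq {e : R3 × R3} {η s t t' y μ : ℝ} (h1 : (1 - μ) * t = (1 - μ) * s)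
    (h2 : μ * t' = μ * s) : apex e η t t' y μ = apex e η s s y μ := by
  simp only [apex, lin, id]
  refine Prod.ext ?_ (Prod.ext ?_ ?_) <;> simp only [Prod.fst_add, Prod.snd_add, Prod.smul_fst,
    Prod.smul_snd, Prod.fst_sub, Prod.snd_sub, smul_eq_mul]
  · linear_combination (e.2.1 - e.1.1) * (h1 + h2)
  · linear_combination (e.2.2.1 - e.1.2.1) * h1
  · linear_combination (e.2.2.2 - e.1.2.2) * h1

theorem apex_eq_left {e : R3 × R3} {η s t t' y μ : ℝ} (hμ : μ ∈ Icc (0:ℝ) 1) (ht : s ≤ t)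
    (ht' : s ≤ t') (h : (1 - μ) * t + μ * t' ≤ s) : apex e η t t' y μ = apex e η s s y μ := by
  have h1 : 0 ≤ (1 - μ) * (t - s) := mul_nonneg (by linarith [hμ.2]) (by linarith)
  have h2 : 0 ≤ μ * (t' - s) := mul_nonneg hμ.1 (by linarith)
  exact apex_eq_of_eq (by linarith) (by linarith)

theorem apex_eq_right {e : R3 × R3} {η s t t' y μ : ℝ} (hμ : μ ∈ Icc (0:ℝ) 1) (ht : t ≤ s)
    (ht' : t' ≤ s) (h : s ≤ (1 - μ) * t + μ * t') : apex e η t t' y μ = apex e η s s y μ := by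
  have h1 : 0 ≤ (1 - μ) * (s - t) := mul_nonneg (by linarith [hμ.2]) (by linarith)
  have h2 : 0 ≤ μ * (s - t') := mul_nonneg hμ.1 (by linarith)
  exact apex_eq_of_eq (by linarith) (by linarith)

theorem convex_comb_mem {s s' t t' μ : ℝ} (hμ : μ ∈ Icc (0:ℝ) 1) (ht : t ∈ Icc s s')
    (ht' : t' ∈ Icc s s') : (1 - μ) * t + μ * t' ∈ Icc s s' := by
  obtain ⟨h0, h1⟩ := hμ
  constructor
  · nlinarith [mul_le_mul_of_nonneg_left ht.1 (sub_nonneg.2 h1),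
      mul_le_mul_of_nonneg_left ht'.1 h0]
  · nlinarith [mul_le_mul_of_nonneg_left ht.2 (sub_nonneg.2 h1),
      mul_le_mul_of_nonneg_left ht'.2 h0]

theorem Backward.fst_lt {e : R3 × R3} (he : Backward e) {s t : ℝ} :
    (lin id e t).1 < (lin id e s).1 ↔ s < t := by
  rw [lin_id_fst, lin_id_fst]
  have := he.lt
  constructor
  · intro h; nlinarith
  · intro h; nlinarith

theorem Backward.fst_le {e : R3 × R3} (he : Backward e) {s t : ℝ} :
    (lin id e t).1 ≤ (lin id e s).1 ↔ s ≤ t := by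
  rw [← not_lt, he.fst_lt, not_lt]

theorem apex_trd_nonneg {e : R3 × R3} {η s y μ : ℝ} (hη : 0 < η) (hμ : μ ∈ Icc (0:ℝ) 1)
    (hs : 0 ≤ (lin id e s).2.2) : 0 ≤ (apex e η s s y μ).2.2 := by
  rw [apex_trd]
  have := mul_nonneg (sub_nonneg.2 hμ.2) hs
  have := mul_nonneg hμ.1 hη.le
  linarith

theorem apex_eq_of_trd {e : R3 × R3} {η s y μ : ℝ} (hη : 0 < η) (hμ : μ ∈ Icc (0:ℝ) 1)
    (hs : 0 ≤ (lin id e s).2.2) (h : (apex e η s s y μ).2.2 ≤ 0) :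
    apex e η s s y μ = lin id e s := by
  rw [apex_trd] at h
  have h1 := mul_nonneg (sub_nonneg.2 hμ.2) hs
  have h2 := mul_nonneg hμ.1 hη.le
  have : μ = 0 := (mul_eq_zero.1 (le_antisymm (by linarith) h2)).resolve_right hη.ne'
  rw [this, apex_zero]

theorem Backward.eq_of_tau {e : R3 × R3} (he : Backward e) {η t t' y μ r r' w ν : ℝ} (hη : 0 < η)
    (ht : t ∈ Icc (0:ℝ) 1) (ht' : t' ∈ Icc (0:ℝ) 1) (hμ : μ ∈ Icc (0:ℝ) 1)
    (hr : r ∈ Icc (0:ℝ) 1) (hr' : r' ∈ Icc (0:ℝ) 1) (hν : ν ∈ Icc (0:ℝ) 1)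
    (h : tau (apex e η t t' y μ) = apex e η r r' w ν) :
    tau (apex e η t t' y μ) = apex e η t t' y μ ∧
      (apex e η t t' y μ = e.1 ∨ apex e η t t' y μ = e.2) := by
  have hT := convex_comb_mem hμ ht ht'
  have hR := convex_comb_mem hν hr hr'
  have hx : -(apex e η t t' y μ).1 = (apex e η r r' w ν).1 := by rw [← h]; rfl
  have hz : -(apex e η t t' y μ).2.2 = (apex e η r r' w ν).2.2 := by rw [← h]; rfl
  have hlt := he.lt
  have h1 := hx
  rw [apex_fst, apex_fst, lin_id_fst, lin_id_fst] at h1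
  have hfin : ∀ s, (lin id e s).1 = 0 → 0 ≤ (lin id e s).2.2 →
      apex e η t t' y μ = apex e η s s y μ → apex e η r r' w ν = apex e η s s w ν →
      tau (apex e η t t' y μ) = apex e η t t' y μ ∧ apex e η t t' y μ = lin id e s := by
    intro s hs hsz e1 e2
    rw [e1, e2] at hz
    have h3 := apex_trd_nonneg (y := w) hη hν hsz
    have h4 := apex_eq_of_trd (y := y) hη hμ hsz (by linarith)
    have h5 := apex_trd_nonneg (y := y) hη hμ hsz
    rw [e1, h4]
    rw [h4] at hz h5
    refine ⟨?_, rfl⟩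
    have : (lin id e s).2.2 = 0 := by linarith
    simp [tau, Prod.ext_iff, hs, this]
  rcases he.side with h0 | h0
  · have k1 : (1 - ((1 - μ) * t + μ * t')) * (e.1.1 - e.2.1) ≤ 0 := by
      nlinarith [mul_nonneg (sub_nonneg.2 hR.2) (sub_nonneg.2 hlt.le)]
    have k2 : (1 - ((1 - ν) * r + ν * r')) * (e.1.1 - e.2.1) ≤ 0 := by
      nlinarith [mul_nonneg (sub_nonneg.2 hT.2) (sub_nonneg.2 hlt.le)]
    have j1 : 1 ≤ (1 - μ) * t + μ * t' := by nlinarith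
    have j2 : 1 ≤ (1 - ν) * r + ν * r' := by nlinarith
    have i1 := le_antisymm hT.2 j1
    have i2 := le_antisymm hR.2 j2
    rw [i1, i2] at h1
    have hB : e.2.1 = 0 := by linarith
    obtain ⟨q1, q2⟩ := hfin 1 (by rw [lin_id_one, hB]) (by rw [lin_id_one]; exact he.snd hB)
      (apex_eq_right hμ ht.2 ht'.2 j1) (apex_eq_right hν hr.2 hr'.2 j2)
    exact ⟨q1, Or.inr (by rw [q2, lin_id_one])⟩
  · have k1 : ((1 - μ) * t + μ * t') * (e.1.1 - e.2.1) ≤ 0 := by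
      nlinarith [mul_nonneg hR.1 (sub_nonneg.2 hlt.le)]
    have k2 : ((1 - ν) * r + ν * r') * (e.1.1 - e.2.1) ≤ 0 := by
      nlinarith [mul_nonneg hT.1 (sub_nonneg.2 hlt.le)]
    have j1 : (1 - μ) * t + μ * t' ≤ 0 := by nlinarith
    have j2 : (1 - ν) * r + ν * r' ≤ 0 := by nlinarith
    have i1 := le_antisymm j1 hT.1
    have i2 := le_antisymm j2 hR.1
    rw [i1, i2] at h1
    have hA : e.1.1 = 0 := by linarith
    obtain ⟨q1, q2⟩ := hfin 0 (by rw [lin_id_zero, hA]) (by rw [lin_id_zero]; exact he.fst hA)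
      (apex_eq_left hμ ht.1 ht'.1 j1) (apex_eq_left hν hr.1 hr'.1 j2)
    exact ⟨q1, Or.inl (by rw [q2, lin_id_zero])⟩

theorem exists_apex_of_mem_segment {e : R3 × R3} {η y s : ℝ} {x : R3}
    (h : x ∈ segment ℝ (lin id e s) ((lin id e s).1, y, η)) :
    ∃ μ ∈ Icc (0:ℝ) 1, x = apex e η s s y μ := by
  obtain ⟨a, b, ha, hb, hab, rfl⟩ := h
  exact ⟨b, ⟨hb, by linarith⟩, by rw [apex]; congr 2; linarith⟩

/-- The replacement of one piece of an edge. -/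
def detour (η : ℝ) (t : R3 × R3 × ℝ × ℝ) : Set (R3 × R3) :=
  legs t.1 t.2.1 t.2.2.1 η t.2.2.2 ∪ outer t.2.2.1 t.2.2.2

theorem mem_car_detour {η y h : ℝ} {a c x : R3} (hx : x ∈ car (detour η (a, c, y, h)))
    (hη : η < h) :
    x ∈ segment ℝ a (a.1, y, η) ∨ x ∈ segment ℝ c (c.1, y, η) ∨
    (η ≤ x.2.2 ∧ x.2.1 = y) ∨ (η < x.2.2 ∧ (1/4 < |x.1| ∨ x.2.1 = 2)) := by
  have pl : ∀ {u v : R3} {k : ℝ}, x ∈ segment ℝ u v → u.2.1 = k → v.2.1 = k → x.2.1 = k :=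
    fun {u v k} h hu hv => by
      have h1 := segment_fnl_le (fnl 0 1 0) (k := k) h (by simp [fnl_apply, hu])
        (by simp [fnl_apply, hv])
      have h2 := segment_fnl_le (fnl 0 (-1) 0) (k := -k) h (by simp [fnl_apply, hu])
        (by simp [fnl_apply, hv])
      simp [fnl_apply] at h1 h2
      linarith
  have ge : ∀ {u v : R3}, x ∈ segment ℝ u v → η ≤ u.2.2 → η ≤ v.2.2 → η ≤ x.2.2 :=
    fun {u v} h hu hv => by
      have h1 := segment_fnl_le (fnl 0 0 (-1)) (k := -η) h (by simp [fnl_apply, hu])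
        (by simp [fnl_apply, hv])
      simp [fnl_apply] at h1
      linarith
  have gt : ∀ {u v : R3}, x ∈ segment ℝ u v → η < u.2.2 → η < v.2.2 → η < x.2.2 :=
    fun {u v} h hu hv => by
      have h1 := segment_fnl_lt (fnl 0 0 (-1)) (k := -η) h (by simp [fnl_apply, hu])
        (by simp [fnl_apply, hv])
      simp [fnl_apply] at h1
      linarith
  simp only [detour, legs, outer, car_union, car_insert, car_singleton, mem_union] at hx
  rcases hx with (hx | hx | hx | hx) | hx | hx | hx | hx | hx
  · exact Or.inl hx
  · exact Or.inr (Or.inr (Or.inl ⟨ge hx le_rfl hη.le, pl hx rfl rfl⟩))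
  · exact Or.inr (Or.inr (Or.inl ⟨ge hx hη.le le_rfl, pl hx rfl rfl⟩))
  · exact Or.inr (Or.inl (segment_symm ℝ c _ ▸ hx))
  · exact Or.inr (Or.inr (Or.inl ⟨ge hx hη.le hη.le, pl hx rfl rfl⟩))
  · refine Or.inr (Or.inr (Or.inr ⟨gt hx hη hη, Or.inl ?_⟩))
    have h1 := segment_fnl_le (fnl (-1) 0 0) (k := -1/2) hx (by simp [fnl_apply]; norm_num)
        (by simp [fnl_apply]; norm_num)
    simp [fnl_apply] at h1
    exact lt_abs.2 (Or.inl (by linarith))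
  · exact Or.inr (Or.inr (Or.inr ⟨gt hx hη hη, Or.inr (pl hx rfl rfl)⟩))
  · refine Or.inr (Or.inr (Or.inr ⟨gt hx hη hη, Or.inl ?_⟩))
    have h1 := segment_fnl_le (fnl 1 0 0) (k := -1/2) hx (by simp [fnl_apply])
        (by simp [fnl_apply])
    simp [fnl_apply] at h1
    exact lt_abs.2 (Or.inr (by linarith))
  · exact Or.inr (Or.inr (Or.inl ⟨ge hx hη.le hη.le, pl hx rfl rfl⟩))

theorem neg_lt_apex_trd {e : R3 × R3} {η t t' y μ : ℝ} (hz : |(lin id e t).2.2| < η)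
    (hμ : μ ∈ Icc (0:ℝ) 1) : -η < (apex e η t t' y μ).2.2 := by
  rw [apex_trd]
  obtain ⟨h1, h2⟩ := abs_lt.1 hz
  have h3 := mul_nonneg (sub_nonneg.2 hμ.2) (sub_nonneg.2 h1.le)
  rcases hμ.1.eq_or_lt with h | h
  · rw [← h]; linarith
  · have := mul_pos h (by linarith : 0 < η + η)
    nlinarith

theorem apex_of_le_trd {e : R3 × R3} {η t t' y μ : ℝ} (hz : |(lin id e t).2.2| < η)
    (hμ : μ ∈ Icc (0:ℝ) 1) (h : η ≤ (apex e η t t' y μ).2.2) :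
    (apex e η t t' y μ).2.2 = η ∧ (apex e η t t' y μ).2.1 = y := by
  rw [apex_trd] at h
  obtain ⟨h1, h2⟩ := abs_lt.1 hz
  have h3 := mul_nonneg (sub_nonneg.2 hμ.2) (sub_nonneg.2 h2.le)
  have : μ = 1 := by
    have : (1 - μ) * (η - (lin id e t).2.2) = 0 := le_antisymm (by linarith) h3
    have := (mul_eq_zero.1 this).resolve_right (by linarith)
    linarith
  subst this
  rw [apex_snd, apex_trd]
  simp

theorem Backward.apex_eq_of_mem_detour {e : R3 × R3} (he : Backward e) {η h y y' s₀ s₁ t t' μ : ℝ}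
    (hz : ∀ s ∈ Icc (0:ℝ) 1, |(lin id e s).2.2| < η) (hs₀ : 0 ≤ s₀) (hs : s₀ < s₁)
    (hs₁ : s₁ ≤ 1) (ht : t ∈ Icc s₁ 1) (ht' : t' ∈ Icc s₁ 1) (hμ : μ ∈ Icc (0:ℝ) 1)
    (hy : y' ≠ y) (hη : η < h)
    (hx : apex e η t t' y' μ ∈ car (dbl (detour η (lin id e s₀, lin id e s₁, y, h)))) :
    apex e η t t' y' μ = lin id e s₁ := by
  have hI : ∀ {r}, r ∈ Icc s₁ 1 → r ∈ Icc (0:ℝ) 1 := fun hr => ⟨by linarith [hr.1], hr.2⟩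
  have hη0 : 0 < η := (abs_nonneg _).trans_lt (hz 0 (by simp))
  have hlow := neg_lt_apex_trd (t' := t') (y := y') (hz t (hI ht)) hμ
  have hT := convex_comb_mem hμ ht ht'
  have c0 : apex e η t t' y' μ ∉ segment ℝ (lin id e s₀) ((lin id e s₀).1, y, η) := fun h => by
    obtain ⟨ν, hν, e'⟩ := exists_apex_of_mem_segment h
    have e1 := congrArg Prod.fst e'
    rw [apex_fst, apex_fst] at e1
    have := he.fst_le.1 e1.ge
    nlinarith [hT.1]
  have c1 : apex e η t t' y' μ ∈ segment ℝ (lin id e s₁) ((lin id e s₁).1, y, η) →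
      apex e η t t' y' μ = lin id e s₁ := fun h => by
    obtain ⟨ν, hν, e'⟩ := exists_apex_of_mem_segment h
    have e1 := congrArg Prod.fst e'
    rw [apex_fst, apex_fst] at e1
    have h1 := he.fst_le.1 e1.ge
    have h2 := apex_eq_left (e := e) (η := η) (y := y') hμ ht.1 ht'.1 (by linarith)
    rw [h2] at e' ⊢
    have ez := congrArg (fun p : R3 => p.2.2) e'
    have ey := congrArg (fun p : R3 => p.2.1) e'
    simp only [apex_trd, apex_snd] at ez ey
    have hzs := (abs_lt.1 (hz s₁ ⟨by linarith, hs₁⟩)).2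
    have hμν : (μ - ν) * (η - (lin id e s₁).2.2) = 0 := by linarith
    have hμν := (mul_eq_zero.1 hμν).resolve_right (by linarith)
    obtain rfl : μ = ν := by linarith
    have : μ * (y' - y) = 0 := by linarith
    have := (mul_eq_zero.1 this).resolve_right (sub_ne_zero.2 hy)
    rw [this, apex_zero]
  rcases mem_car_dbl.1 hx with hx | hx
  · rcases mem_car_detour hx hη with h1 | h1 | ⟨h1, h2⟩ | ⟨h1, -⟩
    · exact absurd h1 c0
    · exact c1 h1
    · rw [(apex_of_le_trd (hz t (hI ht)) hμ h1).2] at h2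
      exact absurd h2 hy
    · have := (apex_of_le_trd (hz t (hI ht)) hμ h1.le).1
      linarith
  · have hτ : ∀ s ∈ Icc (0:ℝ) 1, tau (apex e η t t' y' μ) ∈
        segment ℝ (lin id e s) ((lin id e s).1, y, η) →
        apex e η t t' y' μ ∈ segment ℝ (lin id e s) ((lin id e s).1, y, η) := fun s hs h => by
      obtain ⟨ν, hν, e'⟩ := exists_apex_of_mem_segment h
      rwa [(he.eq_of_tau hη0 (hI ht) (hI ht') hμ hs hs hν e').1] at h
    rcases mem_car_detour hx hη with h1 | h1 | ⟨h1, h2⟩ | ⟨h1, -⟩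
    · exact absurd (hτ s₀ ⟨hs₀, by linarith⟩ h1) c0
    · exact c1 (hτ s₁ ⟨by linarith, hs₁⟩ h1)
    · simp only [tau] at h1; linarith
    · simp only [tau] at h1; linarith

theorem abs_fst_of_mem_detour {η h y y' : ℝ} {a c p : R3} (ha : |a.2.2| < η) (hc : |c.2.2| < η)
    (hη : η < h) (hy : y' ≠ y) (hy2 : y' < 2) (hp : p ∈ car (dbl (detour η (a, c, y, h))))
    (hpy : p.2.1 = y') (hpz : η ≤ p.2.2) : 1/4 < |p.1| := by
  have hη0 : 0 < η := (abs_nonneg _).trans_lt ha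
  have key : ∀ q : R3, |q.2.2| < η → ∀ x ∈ segment ℝ q (q.1, y, η),
      |x.2.2| ≤ η ∧ (η ≤ x.2.2 → x.2.1 = y) ∧ -η < x.2.2 := by
    intro q hq x hx
    obtain ⟨h1, h2⟩ := abs_lt.1 hq
    have k1 := segment_fnl_lt (fnl 0 0 (-1)) (k := η) hx (by simp [fnl_apply]; linarith)
      (by simp [fnl_apply]; linarith)
    have k2 := segment_fnl_le (fnl 0 0 1) (k := η) hx (by simp [fnl_apply]; linarith)
      (by simp [fnl_apply])
    simp [fnl_apply] at k1 k2
    refine ⟨abs_le.2 ⟨by linarith, k2⟩, fun h => ?_, by linarith⟩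
    have := eq_right_of_fnl (fnl 0 0 1) hx (by simp [fnl_apply]; linarith)
      (by simp [fnl_apply]; exact h)
    rw [this]
  rcases mem_car_dbl.1 hp with hp | hp
  · rcases mem_car_detour hp hη with h1 | h1 | ⟨h1, h2⟩ | ⟨h1, h2 | h2⟩
    · exact absurd (hpy.symm.trans ((key a ha p h1).2.1 hpz)) hy
    · exact absurd (hpy.symm.trans ((key c hc p h1).2.1 hpz)) hy
    · exact absurd (hpy.symm.trans h2) hy
    · exact h2
    · linarith
  · rcases mem_car_detour hp hη with h1 | h1 | ⟨h1, h2⟩ | ⟨h1, h2 | h2⟩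
    · have := (key a ha _ h1).2.2
      simp only [tau] at this; linarith
    · have := (key c hc _ h1).2.2
      simp only [tau] at this; linarith
    all_goals simp only [tau] at h1; linarith

theorem exists_trd_bound {E : Set (R3 × R3)} (hE : E.Finite) :
    ∃ M : ℝ, ∀ p ∈ car E, |p.2.2| < M := by
  obtain ⟨M, hM⟩ := (hE.image fun e : R3 × R3 => |e.1.2.2| + |e.2.2.2|).bddAbove
  refine ⟨M + 1, fun p hp => ?_⟩
  obtain ⟨e, he, hp⟩ := mem_car.1 hp
  have h := hM ⟨e, he, rfl⟩
  simp only at h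
  have h1 := abs_nonneg e.1.2.2
  have h2 := abs_nonneg e.2.2.2
  rw [abs_lt]
  have k1 := segment_fnl_lt (fnl 0 0 (-1)) (k := M + 1) hp
    (by simp [fnl_apply]; linarith [neg_abs_le e.1.2.2])
    (by simp [fnl_apply]; linarith [neg_abs_le e.2.2.2])
  have k2 := segment_fnl_lt (fnl 0 0 1) (k := M + 1) hp
    (by simp [fnl_apply]; linarith [le_abs_self e.1.2.2])
    (by simp [fnl_apply]; linarith [le_abs_self e.2.2.2])
  simp [fnl_apply] at k1 k2
  constructor <;> linarith

theorem Backward.fst_inj {e : R3 × R3} (he : Backward e) {s t : ℝ}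
    (h : (lin id e s).1 = (lin id e t).1) : s = t :=
  le_antisymm (he.fst_le.1 h.ge) (he.fst_le.1 h.le)

theorem Backward.eq_of_tau_hull {e : R3 × R3} (he : Backward e) {η s₀ s₁ t t' r r' y w μ ν : ℝ}
    (hη : 0 < η) (hs₀ : 0 ≤ s₀) (hs₁ : s₁ ≤ 1) (ht : t ∈ Icc s₀ s₁)
    (ht' : t' ∈ Icc s₀ s₁) (hμ : μ ∈ Icc (0:ℝ) 1) (hr : r ∈ Icc s₀ s₁) (hr' : r' ∈ Icc s₀ s₁)
    (hν : ν ∈ Icc (0:ℝ) 1) (h : tau (apex e η t t' y μ) = apex e η r r' w ν) :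
    (apex e η t t' y μ = lin id e s₀ ∧ tau (lin id e s₀) = lin id e s₀) ∨
    (apex e η t t' y μ = lin id e s₁ ∧ tau (lin id e s₁) = lin id e s₁) := by
  have hsub : Icc s₀ s₁ ⊆ Icc (0:ℝ) 1 := Icc_subset_Icc hs₀ hs₁
  obtain ⟨h1, h2⟩ := he.eq_of_tau hη (hsub ht) (hsub ht') hμ (hsub hr) (hsub hr') hν h
  have hc := convex_comb_mem hμ ht ht'
  rcases h2 with h2 | h2
  · have h3 := congrArg Prod.fst h2
    rw [← lin_id_zero, apex_fst] at h3
    have := he.fst_inj h3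
    have h0 : s₀ = 0 := by linarith [hc.1]
    rw [h0, lin_id_zero, ← h2]
    exact .inl ⟨rfl, h1⟩
  · have h3 := congrArg Prod.fst h2
    rw [← lin_id_one, apex_fst] at h3
    have := he.fst_inj h3
    have h0 : s₁ = 1 := by linarith [hc.2]
    rw [h0, lin_id_one, ← h2]
    exact .inr ⟨rfl, h1⟩

/-- Replacing an edge running backwards by finitely many detours. -/
theorem Lk.multi {e : R3 × R3} (he : Backward e) {η : ℝ}
    (hz : ∀ s ∈ Icc (0:ℝ) 1, |(lin id e s).2.2| < η) (n : ℕ) :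
    ∀ (s y : ℕ → ℝ) (X : Set (R3 × R3)) (h₀ : ℝ), 0 ≤ s 0 → s (n + 1) = 1 →
    (∀ j < n + 1, s j < s (j + 1)) → InjOn y {j | j < n + 1} → (∀ j < n + 1, y j < 2) →
    Lk (X ∪ dbl {(lin id e (s 0), e.2)}) → TauSym X →
    (∀ t ∈ Icc (s 0) 1, lin id e t ∈ car X → lin id e t = lin id e (s 0) ∨ lin id e t = e.2) →
    (∀ j < n + 1, ∀ t ∈ Icc (s j) (s (j + 1)), ∀ t' ∈ Icc (s j) (s (j + 1)), ∀ μ ∈ Icc (0:ℝ) 1,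
      apex e η t t' (y j) μ ∈ car X →
      apex e η t t' (y j) μ = lin id e (s 0) ∨ apex e η t t' (y j) μ = e.2) →
    (∀ j < n + 1, ∀ p ∈ car X, p.2.1 = y j → η ≤ p.2.2 → 1/4 < |p.1|) →
    ∃ P : Set (R3 × R3 × ℝ × ℝ), P.Finite ∧
      IsoTo (X ∪ dbl {(lin id e (s 0), e.2)}) (X ∪ dbl (⋃ t ∈ P, detour η t)) ∧
      (∀ t ∈ P, (∃ r ∈ Icc (0:ℝ) 1, ∃ r' ∈ Icc (0:ℝ) 1, r < r' ∧ t.1 = lin id e r ∧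
        t.2.1 = lin id e r') ∧
        η < t.2.2.2 ∧ h₀ < t.2.2.2 ∧ ∃ j < n + 1, t.2.2.1 = y j) ∧
      InjOn (fun t => t.2.2.2) P := by
  have hη : 0 < η := (abs_nonneg _).trans_lt (hz 0 (by simp))
  have mono : ∀ (s : ℕ → ℝ) (n : ℕ), (∀ j < n + 1, s j < s (j + 1)) → s 1 ≤ s (n + 1) := by
    intro s n hs
    induction n with
    | zero => simp
    | succ n ih => exact (ih fun j hj => hs j (by omega)).trans (hs (n + 1) (by omega)).le
  have hlast : lin id e 1 = e.2 := lin_id_one e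
  induction n with
  | zero =>
    intro s y X h₀ hs0 hs1 hs hy hy2 hL hX hN H1 H2
    obtain ⟨M, hM⟩ := exists_trd_bound hL.emb.fin
    have h01 := hs 0 (by omega)
    simp only [zero_add] at hs1 h01
    set h := max (max M h₀) η + 1 with hh
    have hh1 : M < h := by rw [hh]; linarith [le_max_left M h₀, le_max_left (max M h₀) η]
    have hh2 : h₀ < h := by rw [hh]; linarith [le_max_right M h₀, le_max_left (max M h₀) η]
    have hh3 : η < h := by rw [hh]; linarith [le_max_right (max M h₀) η]
    refine ⟨{(lin id e (s 0), e.2, y 0, h)}, finite_singleton _, ?_, ?_, by simp⟩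
    · simp only [mem_singleton_iff, iUnion_iUnion_eq_left, detour]
      have hs0' : s 0 ≤ 1 := by linarith
      rw [← hlast] at hL ⊢
      refine hL.piece hX (he.fst_lt.2 (by linarith)) ?_ ?_ (hy2 0 (by omega)) (hz _ ⟨hs0, hs0'⟩)
        (hz 1 (by simp)) hh3 ?_ ?_ (H2 0 (by omega)) ?_
      · have := he.fst_le.2 hs0
        rw [lin_id_zero] at this
        linarith [he.hi]
      · rw [hlast]; exact he.lo
      · intro x hx hxX
        obtain ⟨t, ht, t', ht', μ, hμ, rfl⟩ := exists_apex_of_mem_convexHull hs0' hx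
        rw [hlast]
        refine H1 0 (by omega) t ?_ t' ?_ μ hμ hxX <;> simpa [hs1]
      · intro x hx hx'
        obtain ⟨t, ht, t', ht', μ, hμ, rfl⟩ := exists_apex_of_mem_convexHull hs0' hx
        obtain ⟨r, hr, r', hr', ν, hν, e'⟩ := exists_apex_of_mem_convexHull hs0' hx'
        exact he.eq_of_tau_hull hη hs0 le_rfl ht ht' hμ hr hr' hν e'
      · intro p hp
        exact (hM p (by rw [car_union]; exact .inl hp)).trans hh1
    · rintro t rfl
      exact ⟨⟨s 0, ⟨hs0, by linarith⟩, 1, by simp, by linarith, rfl, hlast.symm⟩, hh3, hh2, 0, by omega, rfl⟩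
  | succ n ih =>
    intro s y X h₀ hs0 hs1 hs hy hy2 hL hX hN H1 H2
    have h01 : s 0 < s 1 := hs 0 (by omega)
    have h12 : s 1 < s 2 := hs 1 (by omega)
    have h21 : s 2 ≤ 1 := by
      have := mono (fun j => s (j + 1)) n (fun j hj => hs (j + 1) (by omega))
      simpa [hs1] using this
    have h11 : s 1 < 1 := by linarith
    have hs0' : s 0 ∈ Icc (0:ℝ) 1 := ⟨hs0, by linarith⟩
    have hs1' : s 1 ∈ Icc (0:ℝ) 1 := ⟨by linarith, by linarith⟩
    have ne01 : (lin id e (s 0)).1 ≠ (lin id e (s 1)).1 := (he.fst_lt.2 h01).ne'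
    have ne12 : (lin id e (s 1)).1 ≠ e.2.1 := by rw [← hlast]; exact (he.fst_lt.2 h11).ne'
    have hq : lin id e (s 1) ∈ segment ℝ (lin id e (s 0)) e.2 := by
      have hd : 0 < 1 - s 0 := by linarith
      obtain ⟨c, hc⟩ : ∃ c, c = (s 1 - s 0) / (1 - s 0) := ⟨_, rfl⟩
      have hc1 : s 1 = s 0 + c * (1 - s 0) := by rw [hc]; field_simp; ring
      have hc0 : 0 ≤ c := by rw [hc]; apply div_nonneg <;> linarith
      have hc2 : c ≤ 1 := by rw [hc]; exact (div_le_one hd).2 (by linarith)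
      refine ⟨1 - c, c, by linarith, hc0, by ring, ?_⟩
      rw [← hlast, hc1]
      simp only [lin, id]
      module
    have hL1 : Lk (X ∪ dbl {(lin id e (s 0), lin id e (s 1)), (lin id e (s 1), e.2)}) := by
      have key : ∀ x ∈ tri (lin id e (s 0)) (lin id e (s 1)) e.2, ∃ t ∈ Icc (s 0) 1,
          x = lin id e t := by
        intro x hx
        have : tri (lin id e (s 0)) (lin id e (s 1)) e.2 ⊆ segment ℝ (lin id e (s 0)) e.2 :=
          tri_subset (convex_segment _ _) (left_mem_segment _ _ _) hq (right_mem_segment _ _ _)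
        have := this hx
        rw [← hlast] at this
        exact segment_lin_subset hs0'.2 this
      refine hL.replace hX (nd_of_mem hq (fun h => ne01 (by rw [h])) fun h => ne12 (by rw [h]))
        ?_ ?_
      · intro x hx hxX
        obtain ⟨t, ht, rfl⟩ := key x hx
        exact hN t ht hxX
      · intro x hx hx'
        obtain ⟨t, ht, rfl⟩ := key x hx
        obtain ⟨r, hr, e'⟩ := key _ hx'
        rw [← apex_zero e η t t 0, ← apex_zero e η r r 0] at e'
        have := he.eq_of_tau_hull hη hs0 le_rfl ht ht (by simp) hr hr (by simp) e'
        rwa [apex_zero, hlast] at this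
    have hL2 : Lk ((X ∪ dbl {(lin id e (s 1), e.2)}) ∪ dbl {(lin id e (s 0), lin id e (s 1))}) := by
      convert hL1 using 1
      rw [union_assoc, ← dbl_union]
      congr 2
      exact union_comm _ _
    have hcar : car (X ∪ dbl {(lin id e (s 0), e.2)}) =
        car ((X ∪ dbl {(lin id e (s 1), e.2)}) ∪ dbl {(lin id e (s 0), lin id e (s 1))}) := by
      rw [← car_subdivide hq, union_assoc, ← dbl_union]
      congr 3
      exact union_comm _ _
    obtain ⟨M, hM⟩ := exists_trd_bound hL2.emb.fin
    set h := max (max M h₀) η + 1 with hh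
    have hh1 : M < h := by rw [hh]; linarith [le_max_left M h₀, le_max_left (max M h₀) η]
    have hh2 : h₀ < h := by rw [hh]; linarith [le_max_right M h₀, le_max_left (max M h₀) η]
    have hh3 : η < h := by rw [hh]; linarith [le_max_right (max M h₀) η]
    have seg : ∀ x ∈ segment ℝ (lin id e (s 1)) e.2, ∃ t ∈ Icc (s 1) 1, x = lin id e t := by
      intro x hx
      rw [← hlast] at hx
      exact segment_lin_subset hs1'.2 hx
    have notlast : ∀ t ∈ Icc (s 0) (s 1), ∀ t' ∈ Icc (s 0) (s 1), ∀ μ ∈ Icc (0:ℝ) 1,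
        apex e η t t' (y 0) μ ≠ e.2 := by
      intro t ht t' ht' μ hμ h2
      have h3 := congrArg Prod.fst h2
      rw [← lin_id_one, apex_fst] at h3
      linarith [he.fst_inj h3, (convex_comb_mem hμ ht ht').2]
    have step : IsoTo ((X ∪ dbl {(lin id e (s 1), e.2)}) ∪
        dbl {(lin id e (s 0), lin id e (s 1))})
        ((X ∪ dbl {(lin id e (s 1), e.2)}) ∪
          dbl (detour η (lin id e (s 0), lin id e (s 1), y 0, h))) := by
      refine hL2.piece (hX.union (tauSym_dbl _)) (he.fst_lt.2 h01) ?_ ?_ (hy2 0 (by omega))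
        (hz _ hs0') (hz _ hs1') hh3 ?_ ?_ ?_ ?_
      · have := he.fst_le.2 hs0
        rw [lin_id_zero] at this
        linarith [he.hi]
      · have := he.fst_lt.2 h11
        rw [lin_id_one] at this
        linarith [he.lo]
      · intro x hx hxX
        obtain ⟨t, ht, t', ht', μ, hμ, rfl⟩ := exists_apex_of_mem_convexHull h01.le hx
        rw [car_union] at hxX
        rcases hxX with hxX | hxX
        · rcases H1 0 (by omega) t ht t' ht' μ hμ hxX with h | h
          · exact .inl h
          · exact absurd h (notlast t ht t' ht' μ hμ)
        rw [mem_car_dbl, car_singleton] at hxX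
        rcases hxX with hxX | hxX
        · obtain ⟨r, hr, e'⟩ := seg _ hxX
          have h3 := congrArg Prod.fst e'
          rw [apex_fst] at h3
          have h4 := he.fst_inj h3
          have : r = s 1 := le_antisymm (h4 ▸ (convex_comb_mem hμ ht ht').2) hr.1
          rw [e', this]
          exact .inr rfl
        · obtain ⟨r, hr, e'⟩ := seg _ hxX
          rw [← apex_zero e η r r 0] at e'
          have hs2 := Icc_subset_Icc hs0 hs1'.2
          have hr1 : r ∈ Icc (0:ℝ) 1 := ⟨hs1'.1.trans hr.1, hr.2⟩
          obtain ⟨h1, h2⟩ := he.eq_of_tau hη (hs2 ht) (hs2 ht') hμ hr1 hr1 (by simp) e'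
          rcases h2 with h2 | h2
          · rw [← h1, e', apex_zero, ← lin_id_zero] at h2
            have := he.fst_inj (congrArg Prod.fst h2)
            linarith [hr.1]
          · exact absurd h2 (notlast t ht t' ht' μ hμ)
      · intro x hx hx'
        obtain ⟨t, ht, t', ht', μ, hμ, rfl⟩ := exists_apex_of_mem_convexHull h01.le hx
        obtain ⟨r, hr, r', hr', ν, hν, e'⟩ := exists_apex_of_mem_convexHull h01.le hx'
        exact he.eq_of_tau_hull hη hs0 hs1'.2 ht ht' hμ hr hr' hν e'
      · intro p hp hpy hpz
        rw [car_union] at hp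
        rcases hp with hp | hp
        · exact H2 0 (by omega) p hp hpy hpz
        exfalso
        rw [mem_car_dbl, car_singleton] at hp
        rcases hp with hp | hp
        · obtain ⟨r, hr, e'⟩ := seg _ hp
          have := (abs_lt.1 (hz r ⟨hs1'.1.trans hr.1, hr.2⟩)).2
          rw [← e'] at this
          linarith
        · obtain ⟨r, hr, e'⟩ := seg _ hp
          have := (abs_lt.1 (hz r ⟨hs1'.1.trans hr.1, hr.2⟩)).1
          rw [← e'] at this
          simp only [tau] at this
          linarith
      · intro p hp
        exact (hM p (by rw [car_union]; exact .inl hp)).trans hh1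
    set D := detour η (lin id e (s 0), lin id e (s 1), y 0, h) with hD
    have hset : (X ∪ dbl {(lin id e (s 1), e.2)}) ∪ dbl D =
        (X ∪ dbl D) ∪ dbl {(lin id e (s 1), e.2)} := by
      rw [union_assoc, union_comm (dbl _), ← union_assoc]
    rw [hset] at step
    have nq0 : ∀ t ∈ Icc (s 1) 1, ∀ t' ∈ Icc (s 1) 1, ∀ μ ∈ Icc (0:ℝ) 1, ∀ y',
        apex e η t t' y' μ ≠ lin id e (s 0) := by
      intro t ht t' ht' μ hμ y' h2
      have h3 := congrArg Prod.fst h2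
      rw [apex_fst] at h3
      linarith [he.fst_inj h3, (convex_comb_mem hμ ht ht').1]
    have hyne : ∀ j < n + 1, y (j + 1) ≠ y 0 := fun j hj h =>
      absurd (hy (show j + 1 < n + 1 + 1 by omega) (show 0 < n + 1 + 1 by omega) h) (by omega)
    have smono : ∀ j ≤ n + 1, s 1 ≤ s (j + 1) := by
      intro j hj
      exact mono s j (fun i hi => hs i (by omega))
    have smono' : ∀ j ≤ n + 2, s j ≤ 1 := by
      intro j hj
      refine Nat.decreasingInduction' (P := fun k => s k ≤ 1) ?_ hj hs1.le
      intro k hk _ h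
      exact (hs k (by omega)).le.trans h
    obtain ⟨P, hPf, hPi, hP, hPinj⟩ := ih (fun j => s (j + 1)) (fun j => y (j + 1)) (X ∪ dbl D) h
      hs1'.1 hs1 (fun j hj => hs (j + 1) (by omega))
      (fun i hi j hj h => by
        have := hy (show i + 1 < n + 1 + 1 from Nat.succ_lt_succ hi)
          (show j + 1 < n + 1 + 1 from Nat.succ_lt_succ hj) h
        omega)
      (fun j hj => hy2 _ (by omega)) step.1 (hX.union (tauSym_dbl _))
      (by
        intro t ht htX
        rw [car_union] at htX
        rcases htX with htX | htX
        · refine .inr ((hN t ⟨by linarith [ht.1], ht.2⟩ htX).resolve_left ?_)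
          rw [← apex_zero e η t t 0]
          exact nq0 t ht t ht 0 (by simp) 0
        · rw [← apex_zero e η t t (y 1)] at htX ⊢
          exact .inl (he.apex_eq_of_mem_detour hz hs0 h01 hs1'.2 ht ht (by simp)
            (hyne 0 (by omega)) hh3 htX))
      (by
        intro j hj t ht t' ht' μ hμ hx
        have hsub : Icc (s (j + 1)) (s (j + 1 + 1)) ⊆ Icc (s 1) 1 :=
          Icc_subset_Icc (smono j (by omega)) (smono' (j + 1 + 1) (by omega))
        rw [car_union] at hx
        rcases hx with hx | hx
        · exact .inr ((H1 (j + 1) (by omega) t ht t' ht' μ hμ hx).resolve_left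
            (nq0 t (hsub ht) t' (hsub ht') μ hμ _))
        · exact .inl (he.apex_eq_of_mem_detour hz hs0 h01 hs1'.2 (hsub ht) (hsub ht') hμ
            (hyne j hj) hh3 hx))
      (by
        intro j hj p hp hpy hpz
        rw [car_union] at hp
        rcases hp with hp | hp
        · exact H2 (j + 1) (by omega) p hp hpy hpz
        · exact abs_fst_of_mem_detour (hz _ hs0') (hz _ hs1') hh3 (hyne j hj)
            (hy2 _ (by omega)) hp hpy hpz)
    refine ⟨insert (lin id e (s 0), lin id e (s 1), y 0, h) P, hPf.insert _, ?_, ?_, ?_⟩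
    · have := step.trans hPi
      have hset2 : X ∪ dbl D ∪ dbl (⋃ t ∈ P, detour η t) = X ∪ dbl
          (⋃ t ∈ insert (lin id e (s 0), lin id e (s 1), y 0, h) P, detour η t) := by
        rw [biUnion_insert, dbl_union, ← hD, union_assoc]
      rw [hset2] at this
      exact ⟨this.1, hcar ▸ this.2⟩
    · rintro t (rfl | ht)
      · exact ⟨⟨s 0, hs0', s 1, hs1', h01, rfl, rfl⟩, hh3, hh2, 0, by omega, rfl⟩
      · obtain ⟨h1, h2, h3, j, hj, h4⟩ := hP t ht
        exact ⟨h1, h2, hh2.trans h3, j + 1, by omega, h4⟩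
    · rw [injOn_insert]
      · refine ⟨hPinj, ?_⟩
        rintro ⟨t, ht, e'⟩
        exact absurd e' (hP t ht).2.2.1.ne'
      · intro hmem
        exact lt_irrefl _ (hP _ hmem).2.2.1

/-! ### Links in normal form -/

theorem Comb.imgE {E : Set (R3 × R3)} (h : Comb E) {P : R3 → R3} (hP : InjOn P (vts E)) :
    Comb (imgE P E) := by
  have v1 : ∀ e ∈ E, e.1 ∈ vts E := fun e he => ⟨e, he, .inl rfl⟩
  have v2 : ∀ e ∈ E, e.2 ∈ vts E := fun e he => ⟨e, he, .inr rfl⟩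
  refine ⟨?_, ?_, ?_, ?_⟩
  · rintro _ ⟨e, he, rfl⟩ _ ⟨f, hf, rfl⟩ h1
    rw [h.out e he f hf (hP (v1 e he) (v1 f hf) h1)]
  · rintro _ ⟨e, he, rfl⟩ _ ⟨f, hf, rfl⟩ h1
    rw [h.inn e he f hf (hP (v2 e he) (v2 f hf) h1)]
  · rintro _ ⟨e, he, rfl⟩
    obtain ⟨f, hf, h1⟩ := h.next e he
    exact ⟨_, ⟨f, hf, rfl⟩, congrArg P h1⟩
  · rintro _ ⟨e, he, rfl⟩
    obtain ⟨f, hf, h1⟩ := h.prev e he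
    exact ⟨_, ⟨f, hf, rfl⟩, congrArg P h1⟩

theorem TauSym.imgE {E : Set (R3 × R3)} (h : TauSym E) {P : R3 → R3}
    (hP : ∀ v ∈ vts E, P (tau v) = tau (P v)) : TauSym (imgE P E) := by
  rintro _ ⟨e, he, rfl⟩
  refine ⟨_, h e he, ?_⟩
  simp [hP e.1 ⟨e, he, .inl rfl⟩, hP e.2 ⟨e, he, .inr rfl⟩]

theorem Lk.exists_perturb {E : Set (R3 × R3)} (h : Lk E) :
    ∃ δ > 0, ∀ P : R3 → R3, (∀ v ∈ vts E, ‖P v - v‖ ≤ δ) →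
      (∀ v ∈ vts E, P (tau v) = tau (P v)) → IsoTo E (imgE P E) := by
  obtain ⟨δ, hδ, H⟩ := h.emb.exists_perturb h.sym
  refine ⟨δ, hδ, fun P h1 h2 => ?_⟩
  obtain ⟨h3, h4, h5⟩ := H P h1 h2
  exact ⟨⟨h4, h.comb.imgE h3, h.sym.imgE h2⟩, h5⟩

/-- The union of the arcs `outer k.1 k.2`. -/
def outerUnion (K : Set (ℝ × ℝ)) : Set (R3 × R3) := ⋃ k ∈ K, outer k.1 k.2

theorem mem_outerUnion {K : Set (ℝ × ℝ)} {e : R3 × R3} :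
    e ∈ outerUnion K ↔ ∃ k ∈ K, e ∈ outer k.1 k.2 := by simp [outerUnion]

theorem rv_mem_outer {y h : ℝ} {e : R3 × R3} (he : e ∈ outer y h) : rv e ∈ outer y (-h) := by
  simp only [outer, mem_insert_iff, mem_singleton_iff] at he
  rcases he with rfl | rfl | rfl | rfl | rfl <;> simp [outer, rv, tau] <;> norm_num

theorem rv_mem_outer_iff {y h : ℝ} {e : R3 × R3} : rv e ∈ outer y h ↔ e ∈ outer y (-h) := by
  refine ⟨fun h1 => ?_, fun h1 => ?_⟩
  · simpa [rv_rv] using rv_mem_outer h1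
  · simpa using rv_mem_outer h1

theorem outer_snd {y h : ℝ} {e : R3 × R3} (he : e ∈ outer y h) :
    e.1.2.2 = h ∧ e.2.2.2 = h ∧ 1/4 ≤ |e.1.1| ∧ 1/4 ≤ |e.2.1| := by
  simp only [outer, mem_insert_iff, mem_singleton_iff] at he
  rcases he with rfl | rfl | rfl | rfl | rfl <;> norm_num [abs_of_pos, abs_of_neg]

theorem segment_outer {y h : ℝ} {e : R3 × R3} (he : e ∈ outer y h) {x : R3}
    (hx : x ∈ segment ℝ e.1 e.2) : 1/4 ≤ |x.1| ∨ x.2.1 = 2 := by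
  simp only [outer, mem_insert_iff, mem_singleton_iff] at he
  obtain ⟨a, b, ha, hb, hab, rfl⟩ := hx
  obtain rfl : a = 1 - b := by linarith
  rcases he with rfl | rfl | rfl | rfl | rfl <;>
    simp only [Prod.fst_add, Prod.snd_add, Prod.smul_fst, Prod.smul_snd, smul_eq_mul]
  · left; rw [le_abs]; left; linarith
  · left; rw [le_abs]; left; linarith
  · right; ring
  · left; rw [le_abs]; right; linarith
  · left; rw [le_abs]; right; linarith

/-- A link consisting of edges `I` in a slab together with outer arcs indexed by `K`. -/
structure NormalForm (I : Set (R3 × R3)) (K : Set (ℝ × ℝ)) : Prop where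
  lk : Lk (I ∪ outerUnion K)
  isym : TauSym I
  kfin : K.Finite
  ksym : ∀ k ∈ K, (k.1, -k.2) ∈ K
  ky : ∀ k ∈ K, -5/2 < k.1 ∧ k.1 < -3/2
  kz : ∀ k ∈ K, k.2 ≠ 0
  kinj : ∀ k ∈ K, ∀ k' ∈ K, k.2 = k'.2 → k = k'
  ne : ∀ e ∈ I, e.1.1 ≠ e.2.1
  vy : ∀ v ∈ vts I, -5/2 < v.2.1 ∧ v.2.1 < -3/2
  vx : ∀ v ∈ vts I, |v.1| < 1/4 ∨ ∃ k ∈ K, v = (1/4, k.1, k.2) ∨ v = (-1/4, k.1, k.2)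
  bad : ∀ e ∈ I, e.2.1 < e.1.1 → |e.1.1| < 1/4 ∧ |e.2.1| < 1/4 ∧ (0 ≤ e.2.1 ∨ e.1.1 ≤ 0)

/-- The conditions on the data `(a, c, y, h)` of a detour. -/
structure DetourOK (η : ℝ) (t : R3 × R3 × ℝ × ℝ) : Prop where
  lt : t.2.1.1 < t.1.1
  ax : t.1.1 < 1/4
  cx : -1/4 < t.2.1.1
  ay : -5/2 < t.1.2.1 ∧ t.1.2.1 < -3/2
  cy : -5/2 < t.2.1.2.1 ∧ t.2.1.2.1 < -3/2
  az : |t.1.2.2| < η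
  cz : |t.2.1.2.2| < η
  y : -5/2 < t.2.2.1 ∧ t.2.2.1 < -3/2
  h : η < t.2.2.2

theorem NormalForm.exists_detours {I : Set (R3 × R3)} {K : Set (ℝ × ℝ)} (hN : NormalForm I K)
    {e : R3 × R3} (he : e ∈ I) (hb : Backward e) :
    ∃ (η : ℝ) (P : Set (R3 × R3 × ℝ × ℝ)), 0 < η ∧ P.Finite ∧
      (∀ p ∈ car (I ∪ outerUnion K), |p.2.2| < η) ∧
      IsoTo (I ∪ outerUnion K)
        (((I \ {e, rv e}) ∪ outerUnion K) ∪ dbl (⋃ t ∈ P, detour η t)) ∧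
      (∀ t ∈ P, DetourOK η t) ∧ InjOn (fun t => t.2.2.2) P := by
  obtain ⟨η, hη⟩ := exists_trd_bound hN.lk.emb.fin
  have hre : rv e ∈ I := hN.isym e he
  set X := (I \ {e, rv e}) ∪ outerUnion K with hX
  have hset : I ∪ outerUnion K = X ∪ dbl {e} := by
    ext f
    simp only [hX, mem_union, mem_sdiff, mem_insert_iff, mem_singleton_iff, mem_dbl]
    have : rv f = e ↔ f = rv e :=
      ⟨fun h => by rw [← h, rv_rv], fun h => by rw [h, rv_rv]⟩
    rw [this]
    constructor
    · tauto
    · rintro ((h | h) | h | h)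
      · exact .inl h.1
      · exact .inr h
      · exact .inl (h ▸ he)
      · exact .inl (h ▸ hre)
  have hXs : TauSym X := by
    intro f hf
    change rv f ∈ X
    rcases hf with hf | hf
    · refine .inl ⟨hN.isym f hf.1, fun h => hf.2 ?_⟩
      rcases h with h | h
      · right; rw [mem_singleton_iff, ← h, rv_rv]
      · left
        rw [mem_singleton_iff] at h
        rw [← rv_rv f, h, rv_rv]
    · obtain ⟨k, hk, hf⟩ := mem_outerUnion.1 hf
      exact .inr (mem_outerUnion.2 ⟨_, hN.ksym k hk, rv_mem_outer hf⟩)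
  have heX : e ∉ X := by
    rintro (h | h)
    · exact h.2 (.inl rfl)
    · obtain ⟨k, hk, h⟩ := mem_outerUnion.1 h
      have := (hN.bad e he hb.lt).1
      linarith [(outer_snd h).2.2.1]
  have hlin : ∀ s ∈ Icc (0:ℝ) 1, lin id e s ∈ segment ℝ e.1 e.2 := fun s hs =>
    mem_segment_iff_lin.2 ⟨s, hs, rfl⟩
  have hz : ∀ s ∈ Icc (0:ℝ) 1, |(lin id e s).2.2| < η := fun s hs =>
    hη _ (mem_car.2 ⟨e, .inl he, hlin s hs⟩)
  have hend : ∀ t ∈ Icc (0:ℝ) 1, lin id e t ∈ car X → lin id e t = e.1 ∨ lin id e t = e.2 := by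
    intro t ht hx
    obtain ⟨f, hf, hx⟩ := mem_car.1 hx
    have hf' : f ∈ I ∪ outerUnion K := by rw [hset]; exact .inl hf
    exact (hN.lk.emb.emb e (.inl he) f hf' (fun h => heX (h ▸ hf)) _ (hlin t ht) hx).1
  obtain ⟨n, s, y, hs0, hsn, hs, hy, hyI, hsI, H⟩ := exists_partition (e := e) (η := η)
    (l := -5/2) (u := -3/2) (X := I \ {e, rv e})
    ((hN.lk.emb.fin.subset subset_union_left).subset sdiff_subset) (by norm_num) hb.lt.ne'
    (fun f hf => hN.ne f hf.1) (fun s hs => (abs_lt.1 (hz s hs)).2)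
  obtain ⟨n, rfl⟩ : ∃ m, n = m + 1 := by
    refine ⟨n - 1, ?_⟩
    rcases n with _ | n
    · rw [hs0] at hsn; norm_num at hsn
    · rfl
  have hxr : ∀ s ∈ Icc (0:ℝ) 1, -1/4 < (lin id e s).1 ∧ (lin id e s).1 < 1/4 := by
    intro s hs
    have h1 := hb.fst_le.2 hs.1
    have h2 := hb.fst_le.2 hs.2
    rw [lin_id_zero] at h1
    rw [lin_id_one] at h2
    exact ⟨hb.lo.trans_le h2, h1.trans_lt hb.hi⟩
  have hyr : ∀ s ∈ Icc (0:ℝ) 1, -5/2 < (lin id e s).2.1 ∧ (lin id e s).2.1 < -3/2 := by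
    intro s hs
    have h1 := hN.vy e.1 ⟨e, he, .inl rfl⟩
    have h2 := hN.vy e.2 ⟨e, he, .inr rfl⟩
    have h3 := convex_Ioo (-5/2 : ℝ) (-3/2) h1 h2 (sub_nonneg.2 hs.2) hs.1 (by ring)
    rw [lin_id_snd]
    simp only [mem_Ioo, smul_eq_mul] at h3
    constructor <;> linarith [h3.1, h3.2]
  obtain ⟨P, hPf, hPi, hP, hPinj⟩ := Lk.multi hb hz n s y X 0 hs0.ge hsn hs hy
    (fun j hj => by linarith [(hyI j hj).2])
    (by rw [hs0, lin_id_zero, Prod.mk.eta, ← hset]; exact hN.lk) hXs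
    (by rw [hs0, lin_id_zero]; exact hend)
    (by
      intro j hj t ht t' ht' μ hμ hx
      have hsub : Icc (s j) (s (j + 1)) ⊆ Icc (0:ℝ) 1 :=
        Icc_subset_Icc (hsI j (by omega)).1 (hsI (j + 1) (by omega)).2
      rw [hs0, lin_id_zero]
      obtain ⟨f, hf | hf, hx'⟩ := mem_car.1 hx
      · have := H j hj f hf t ht t' ht' μ hμ hx'
        rw [this, apex_zero] at hx ⊢
        exact hend t (hsub ht) hx
      · exfalso
        obtain ⟨k, hk, hf⟩ := mem_outerUnion.1 hf
        rcases segment_outer hf hx' with h | h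
        · rw [apex_fst] at h
          have := hxr _ (convex_comb_mem hμ (hsub ht) (hsub ht'))
          have := abs_lt.2 ⟨by linarith [this.1], this.2⟩
          linarith
        · rw [apex_snd] at h
          have h1 := (hyr t (hsub ht)).2
          have h2 := (hyI j hj).2
          nlinarith [hμ.1, hμ.2])
    (by
      intro j hj p hp _ hpz
      have : p ∈ car (I ∪ outerUnion K) := by rw [hset, car_union]; exact .inl hp
      linarith [(abs_lt.1 (hη p this)).2])
  refine ⟨η, P, (abs_nonneg _).trans_lt (hz 0 (by simp)), hPf, hη, ?_, ?_, hPinj⟩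
  · rw [hs0, lin_id_zero, Prod.mk.eta, ← hset] at hPi
    exact hPi
  · intro t ht
    obtain ⟨⟨r, hr, r', hr', hrr, h1, h2⟩, h3, h4, j, hj, h5⟩ := hP t ht
    refine ⟨?_, ?_, ?_, ?_, ?_, ?_, ?_, ?_, h3⟩
    · rw [h1, h2]; exact hb.fst_lt.2 hrr
    · rw [h1]; exact (hxr r hr).2
    · rw [h2]; exact (hxr r' hr').1
    · rw [h1]; exact hyr r hr
    · rw [h2]; exact hyr r' hr'
    · rw [h1]; exact hz r hr
    · rw [h2]; exact hz r' hr'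
    · rw [h5]; exact hyI j hj

open Classical in
/-- Move the vertices at height `±η` slightly in the `x`-direction, so that the edges of `E` at
these vertices which are orthogonal to this direction run forwards. -/
def tilt (E : Set (R3 × R3)) (η δ : ℝ) (v : R3) : R3 :=
  (v.1 + δ * (if |v.2.2| = η then (if ∃ f ∈ E, f.2 = v ∧ f.1.1 = v.1 then 1 else 0) -
    (if ∃ f ∈ E, f.1 = v ∧ f.2.1 = v.1 then 1 else 0) else 0), v.2.1, v.2.2)

theorem tilt_of_ne {E : Set (R3 × R3)} {η δ : ℝ} {v : R3} (h : |v.2.2| ≠ η) :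
    tilt E η δ v = v := by simp [tilt, h]

theorem tilt_of_in {E : Set (R3 × R3)} (hE : Comb E) {η δ : ℝ} {v : R3} (h : |v.2.2| = η)
    {f g : R3 × R3} (hf : f ∈ E) (hfv : f.2 = v) (hf1 : f.1.1 = v.1) (hg : g ∈ E)
    (hgv : g.1 = v) (hg1 : g.2.1 ≠ v.1) : tilt E η δ v = (v.1 + δ, v.2.1, v.2.2) := by
  have h1 : ∃ f ∈ E, f.2 = v ∧ f.1.1 = v.1 := ⟨f, hf, hfv, hf1⟩
  have h2 : ¬ ∃ f ∈ E, f.1 = v ∧ f.2.1 = v.1 := by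
    rintro ⟨k, hk, hkv, hk1⟩
    exact hg1 (hE.out k hk g hg (hkv.trans hgv.symm) ▸ hk1)
  rw [tilt, if_pos h, if_pos h1, if_neg h2]
  simp

theorem tilt_of_out {E : Set (R3 × R3)} (hE : Comb E) {η δ : ℝ} {v : R3} (h : |v.2.2| = η)
    {f g : R3 × R3} (hf : f ∈ E) (hfv : f.1 = v) (hf1 : f.2.1 = v.1) (hg : g ∈ E)
    (hgv : g.2 = v) (hg1 : g.1.1 ≠ v.1) : tilt E η δ v = (v.1 - δ, v.2.1, v.2.2) := by
  have h1 : ∃ f ∈ E, f.1 = v ∧ f.2.1 = v.1 := ⟨f, hf, hfv, hf1⟩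
  have h2 : ¬ ∃ f ∈ E, f.2 = v ∧ f.1.1 = v.1 := by
    rintro ⟨k, hk, hkv, hk1⟩
    exact hg1 (hE.inn k hk g hg (hkv.trans hgv.symm) ▸ hk1)
  rw [tilt, if_pos h, if_pos h1, if_neg h2]
  simp [sub_eq_add_neg]

theorem tilt_tau {E : Set (R3 × R3)} (hE : TauSym E) {η δ : ℝ} (v : R3) :
    tilt E η δ (tau v) = tau (tilt E η δ v) := by
  have h1 : ∀ v, (∃ f ∈ E, f.1 = v ∧ f.2.1 = v.1) →
      ∃ f ∈ E, f.2 = tau v ∧ f.1.1 = (tau v).1 := by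
    rintro v ⟨f, hf, rfl, h⟩
    exact ⟨_, hE f hf, rfl, by simp [tau, h]⟩
  have h2 : ∀ v, (∃ f ∈ E, f.2 = v ∧ f.1.1 = v.1) →
      ∃ f ∈ E, f.1 = tau v ∧ f.2.1 = (tau v).1 := by
    rintro v ⟨f, hf, rfl, h⟩
    exact ⟨_, hE f hf, rfl, by simp [tau, h]⟩
  have h3 : (∃ f ∈ E, f.2 = tau v ∧ f.1.1 = (tau v).1) ↔ ∃ f ∈ E, f.1 = v ∧ f.2.1 = v.1 :=
    ⟨fun h => by simpa [tau_tau] using h2 _ h, h1 v⟩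
  have h4 : (∃ f ∈ E, f.1 = tau v ∧ f.2.1 = (tau v).1) ↔ ∃ f ∈ E, f.2 = v ∧ f.1.1 = v.1 :=
    ⟨fun h => by simpa [tau_tau] using h1 _ h, h2 v⟩
  have h5 : |(tau v).2.2| = |v.2.2| := by simp [tau]
  by_cases h : |v.2.2| = η
  · by_cases a : ∃ f ∈ E, f.1 = v ∧ f.2.1 = v.1 <;> by_cases b : ∃ f ∈ E, f.2 = v ∧ f.1.1 = v.1
    · rw [tilt, tilt, h5, if_pos h, if_pos h, if_pos a, if_pos b, if_pos (h3.2 a), if_pos (h4.2 b)]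
      simp [tau]
    · rw [tilt, tilt, h5, if_pos h, if_pos h, if_pos a, if_neg b, if_pos (h3.2 a),
        if_neg (mt h4.1 b)]
      simp [tau, add_comm]
    · rw [tilt, tilt, h5, if_pos h, if_pos h, if_neg a, if_pos b, if_neg (mt h3.1 a),
        if_pos (h4.2 b)]
      simp [tau, add_comm]
    · rw [tilt, tilt, h5, if_pos h, if_pos h, if_neg a, if_neg b, if_neg (mt h3.1 a),
        if_neg (mt h4.1 b)]
      simp [tau]
  · rw [tilt_of_ne h, tilt_of_ne (h5 ▸ h)]

theorem norm_tilt_sub_le (E : Set (R3 × R3)) (η : ℝ) {δ : ℝ} (hδ : 0 ≤ δ) (v : R3) :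
    ‖tilt E η δ v - v‖ ≤ δ := by
  have h1 : (tilt E η δ v - v).2 = 0 := by ext <;> simp [tilt]
  have h2 : |(tilt E η δ v - v).1| ≤ δ := by
    simp only [tilt, Prod.fst_sub, add_sub_cancel_left, abs_mul, abs_of_nonneg hδ]
    split_ifs <;> simp [hδ]
  rw [Prod.norm_def, h1, norm_zero]
  exact max_le h2 hδ

/-- The edges running backwards. -/
def badEdges (I : Set (R3 × R3)) : Set (R3 × R3) := {f ∈ I | f.2.1 < f.1.1}

theorem NormalForm.step_backward {I : Set (R3 × R3)} {K : Set (ℝ × ℝ)} (hN : NormalForm I K)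
    {e : R3 × R3} (he : e ∈ I) (hb : Backward e) :
    ∃ I' K', NormalForm I' K' ∧
      EquivIsotopicSets (car (I ∪ outerUnion K)) (car (I' ∪ outerUnion K')) ∧
      badEdges I' ⊆ badEdges I \ {e} := by
  obtain ⟨η, P, hη, hPf, hz, hiso, hP, hPinj⟩ := hN.exists_detours he hb
  set I₀ := I \ {e, rv e} with hI₀
  set Lg := ⋃ t ∈ P, legs t.1 t.2.1 t.2.2.1 η t.2.2.2 with hLg
  set K₁ : Set (ℝ × ℝ) := K ∪ {k | ∃ t ∈ P, k = (t.2.2.1, t.2.2.2) ∨ k = (t.2.2.1, -t.2.2.2)}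
    with hK₁
  set E := (I₀ ∪ dbl Lg) ∪ outerUnion K₁ with hE
  have mLg : ∀ f, f ∈ Lg ↔ ∃ t ∈ P, f ∈ legs t.1 t.2.1 t.2.2.1 η t.2.2.2 := by simp [hLg]
  have hset : ((I₀ ∪ outerUnion K) ∪ dbl (⋃ t ∈ P, detour η t)) = E := by
    ext f
    simp only [hE, mem_union, mem_dbl, mLg, mem_outerUnion, mem_iUnion, detour, exists_prop,
      rv_mem_outer_iff]
    constructor
    · rintro ((h | ⟨k, hk, h⟩) | ⟨t, ht, h | h⟩ | ⟨t, ht, h | h⟩)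
      · exact .inl (.inl h)
      · exact .inr ⟨k, .inl hk, h⟩
      · exact .inl (.inr (.inl ⟨t, ht, h⟩))
      · exact .inr ⟨_, .inr ⟨t, ht, .inl rfl⟩, h⟩
      · exact .inl (.inr (.inr ⟨t, ht, h⟩))
      · exact .inr ⟨_, .inr ⟨t, ht, .inr rfl⟩, h⟩
    · rintro ((h | ⟨t, ht, h⟩ | ⟨t, ht, h⟩) | ⟨k, hk | ⟨t, ht, rfl | rfl⟩, h⟩)
      · exact .inl (.inl h)
      · exact .inr (.inl ⟨t, ht, .inl h⟩)
      · exact .inr (.inr ⟨t, ht, .inl h⟩)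
      · exact .inl (.inr ⟨k, hk, h⟩)
      · exact .inr (.inl ⟨t, ht, .inr h⟩)
      · exact .inr (.inr ⟨t, ht, .inr h⟩)
  rw [hset] at hiso
  obtain ⟨δ₀, hδ₀, hpert⟩ := hiso.1.exists_perturb
  obtain ⟨δ, hδ, hδδ₀, hδP⟩ : ∃ δ > 0, δ ≤ δ₀ ∧ ∀ t ∈ P, t.1.1 + δ < 1/4 ∧ -1/4 < t.2.1.1 - δ := by
    have h1 : ∀ᶠ δ in nhdsWithin (0:ℝ) (Ioi 0), ∀ t ∈ P,
        t.1.1 + δ < 1/4 ∧ -1/4 < t.2.1.1 - δ := by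
      rw [Filter.eventually_all_finite hPf]
      intro t ht
      have a1 := (hP t ht).ax
      have a2 := (hP t ht).cx
      filter_upwards [Ioo_mem_nhdsGT (show (0:ℝ) < 1/4 - t.1.1 by linarith),
        Ioo_mem_nhdsGT (show (0:ℝ) < t.2.1.1 + 1/4 by linarith)] with δ h1 h2
      exact ⟨by linarith [h1.2], by linarith [h2.2]⟩
    obtain ⟨δ, h2, h3⟩ := (h1.and (Ioo_mem_nhdsGT hδ₀)).exists
    exact ⟨δ, h3.1, h3.2.le, h2⟩
  have hEs : TauSym E := hiso.1.sym
  have hEc : Comb E := hiso.1.comb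
  have hiso2 := hpert (tilt E η δ) (fun v _ => (norm_tilt_sub_le E η hδ.le v).trans hδδ₀)
    (fun v _ => tilt_tau hEs v)
  have hK₁z : ∀ k ∈ K₁, |k.2| ≠ η := by
    rintro k (hk | ⟨t, ht, rfl | rfl⟩)
    · refine (hz (1/4, k.1, k.2) (vts_subset_car ⟨((1/4, k.1, k.2), (1/2, k.1, k.2)), .inr
        (mem_outerUnion.2 ⟨k, hk, .inl rfl⟩), .inl rfl⟩)).ne
    · have := (hP t ht).h
      simp only
      rw [abs_of_pos (hη.trans this)]
      exact this.ne'
    · have := (hP t ht).h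
      simp only [abs_neg]
      rw [abs_of_pos (hη.trans this)]
      exact this.ne'
  have fixI : ∀ f ∈ I₀, Prod.map (tilt E η δ) (tilt E η δ) f = f := by
    intro f hf
    ext1
    · exact tilt_of_ne (hz _ (vts_subset_car ⟨f, .inl hf.1, .inl rfl⟩)).ne
    · exact tilt_of_ne (hz _ (vts_subset_car ⟨f, .inl hf.1, .inr rfl⟩)).ne
  have fixK : ∀ f ∈ outerUnion K₁, Prod.map (tilt E η δ) (tilt E η δ) f = f := by
    intro f hf
    obtain ⟨k, hk, hf⟩ := mem_outerUnion.1 hf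
    obtain ⟨h1, h2, -⟩ := outer_snd hf
    ext1
    · exact tilt_of_ne (h1 ▸ hK₁z k hk)
    · exact tilt_of_ne (h2 ▸ hK₁z k hk)
  have himg : imgE (tilt E η δ) E = imgE (tilt E η δ) (I₀ ∪ dbl Lg) ∪ outerUnion K₁ := by
    nth_rw 2 [hE]
    simp only [imgE]
    rw [image_union]
    congr 1
    rw [image_congr (g := id) fixK, image_id]
  have hK₁s : ∀ k ∈ K₁, (k.1, -k.2) ∈ K₁ := by
    rintro k (hk | ⟨t, ht, rfl | rfl⟩)
    · exact .inl (hN.ksym k hk)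
    · exact .inr ⟨t, ht, .inr rfl⟩
    · exact .inr ⟨t, ht, .inl (by simp)⟩
  have hI₀s : TauSym I₀ := by
    intro f hf
    refine ⟨hN.isym f hf.1, fun h => hf.2 ?_⟩
    rcases h with h | h
    · right; rw [mem_singleton_iff, ← h]; exact (rv_rv f).symm
    · left
      rw [mem_singleton_iff] at h
      rw [← rv_rv f, ← rv_rv e]; exact congrArg rv h
  have hleg : ∀ f ∈ Lg, (tilt E η δ f.1).1 < (tilt E η δ f.2).1 ∧
      ∀ v, v = tilt E η δ f.1 ∨ v = tilt E η δ f.2 → (-5/2 < v.2.1 ∧ v.2.1 < -3/2) ∧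
        (|v.1| < 1/4 ∨ ∃ k ∈ K₁, v = (1/4, k.1, k.2) ∨ v = (-1/4, k.1, k.2)) := by
    intro f hf
    obtain ⟨⟨a, c, y, h⟩, ht, hf⟩ := (mLg f).1 hf
    have ok := hP _ ht
    have hsub : legs a c y η h ⊆ E := fun g hg =>
      .inl (.inr (.inl ((mLg g).2 ⟨_, ht, hg⟩)))
    obtain ⟨lt, ax, cx, ay, cy, az, cz, hy, hh⟩ := ok
    obtain ⟨d1, d2⟩ := hδP _ ht
    simp only at lt ax cx ay cy az cz hy hh d1 d2 hf
    have ta : tilt E η δ a = a := tilt_of_ne az.ne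
    have tc : tilt E η δ c = c := tilt_of_ne cz.ne
    have tp : tilt E η δ (1/4, y, h) = (1/4, y, h) := tilt_of_ne (by
      simp only; rw [abs_of_pos (hη.trans hh)]; exact hh.ne')
    have tm : tilt E η δ (-1/4, y, h) = (-1/4, y, h) := tilt_of_ne (by
      simp only; rw [abs_of_pos (hη.trans hh)]; exact hh.ne')
    have tα : tilt E η δ (a.1, y, η) = (a.1 + δ, y, η) :=
      tilt_of_in hEc (by simp [abs_of_pos hη]) (hsub (show (a, (a.1, y, η)) ∈ _ by simp [legs]))
        rfl rfl (hsub (show ((a.1, y, η), (1/4, y, h)) ∈ _ by simp [legs])) rfl (by simpa using ax.ne')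
    have tγ : tilt E η δ (c.1, y, η) = (c.1 - δ, y, η) :=
      tilt_of_out hEc (by simp [abs_of_pos hη]) (hsub (show ((c.1, y, η), c) ∈ _ by simp [legs]))
        rfl rfl (hsub (show ((-1/4, y, h), (c.1, y, η)) ∈ _ by simp [legs])) rfl cx.ne
    have hk : ((y, h) : ℝ × ℝ) ∈ K₁ := .inr ⟨_, ht, .inl rfl⟩
    have va : |a.1| < 1/4 := abs_lt.2 ⟨by linarith, ax⟩
    have vc : |c.1| < 1/4 := abs_lt.2 ⟨by linarith, by linarith⟩
    have vα : |a.1 + δ| < 1/4 := abs_lt.2 ⟨by linarith, by linarith⟩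
    have vγ : |c.1 - δ| < 1/4 := abs_lt.2 ⟨by linarith, by linarith⟩
    simp only [legs, mem_insert_iff, mem_singleton_iff] at hf
    rcases hf with rfl | rfl | rfl | rfl
    · simp only [ta, tα]
      refine ⟨by linarith, ?_⟩
      rintro v (rfl | rfl)
      exacts [⟨ay, .inl va⟩, ⟨hy, .inl vα⟩]
    · simp only [tp, tα]
      refine ⟨by linarith, ?_⟩
      rintro v (rfl | rfl)
      exacts [⟨hy, .inl vα⟩, ⟨hy, .inr ⟨_, hk, .inl rfl⟩⟩]
    · simp only [tm, tγ]
      refine ⟨by linarith, ?_⟩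
      rintro v (rfl | rfl)
      exacts [⟨hy, .inr ⟨_, hk, .inr rfl⟩⟩, ⟨hy, .inl vγ⟩]
    · simp only [tc, tγ]
      refine ⟨by linarith, ?_⟩
      rintro v (rfl | rfl)
      exacts [⟨hy, .inl vγ⟩, ⟨cy, .inl vc⟩]
  have hleg' : ∀ f ∈ dbl Lg, (tilt E η δ f.1).1 < (tilt E η δ f.2).1 ∧
      ∀ v, v = tilt E η δ f.1 ∨ v = tilt E η δ f.2 → (-5/2 < v.2.1 ∧ v.2.1 < -3/2) ∧
        (|v.1| < 1/4 ∨ ∃ k ∈ K₁, v = (1/4, k.1, k.2) ∨ v = (-1/4, k.1, k.2)) := by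
    intro f hf
    rcases mem_dbl.1 hf with hf | hf
    · exact hleg f hf
    obtain ⟨h1, h2⟩ := hleg _ hf
    simp only [rv, tilt_tau hEs] at h1 h2
    refine ⟨by simpa [tau] using h1, fun v hv => ?_⟩
    have := h2 (tau v) (by rcases hv with rfl | rfl <;> simp)
    obtain ⟨h3, h4⟩ := this
    refine ⟨h3, ?_⟩
    rcases h4 with h4 | ⟨k, hk, h4⟩
    · left; simpa [tau] using h4
    · right
      refine ⟨_, hK₁s k hk, ?_⟩
      simp only [tau_eq_iff] at h4
      rcases h4 with rfl | rfl
      · right; simp [tau]; norm_num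
      · left; simp [tau]; norm_num
  have hmem : ∀ f ∈ imgE (tilt E η δ) (I₀ ∪ dbl Lg), f ∈ I₀ ∨ (f.1.1 < f.2.1 ∧
      ∀ v, v = f.1 ∨ v = f.2 → (-5/2 < v.2.1 ∧ v.2.1 < -3/2) ∧
        (|v.1| < 1/4 ∨ ∃ k ∈ K₁, v = (1/4, k.1, k.2) ∨ v = (-1/4, k.1, k.2))) := by
    rintro _ ⟨f, hf | hf, rfl⟩
    · rw [fixI f hf]; exact .inl hf
    · exact .inr (hleg' f hf)
  refine ⟨imgE (tilt E η δ) (I₀ ∪ dbl Lg), K₁, ?_, ?_, ?_⟩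
  · constructor
    · rw [← himg]; exact hiso2.1
    · exact (hI₀s.union (tauSym_dbl _)).imgE fun v _ => tilt_tau hEs v
    · refine hN.kfin.union (((hPf.image fun t => (t.2.2.1, t.2.2.2)).union
        (hPf.image fun t => (t.2.2.1, -t.2.2.2))).subset ?_)
      rintro k ⟨t, ht, rfl | rfl⟩
      · exact .inl ⟨t, ht, rfl⟩
      · exact .inr ⟨t, ht, rfl⟩
    · exact hK₁s
    · rintro k (hk | ⟨t, ht, rfl | rfl⟩)
      exacts [hN.ky k hk, (hP t ht).y, (hP t ht).y]
    · rintro k (hk | ⟨t, ht, rfl | rfl⟩)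
      · exact hN.kz k hk
      · exact (hη.trans (hP t ht).h).ne'
      · exact (neg_lt_zero.2 (hη.trans (hP t ht).h)).ne
    · have hKz : ∀ k ∈ K, |k.2| < η := fun k hk => hz (1/4, k.1, k.2) (vts_subset_car
        ⟨((1/4, k.1, k.2), (1/2, k.1, k.2)), .inr (mem_outerUnion.2 ⟨k, hk, .inl rfl⟩), .inl rfl⟩)
      rintro k (hk | ⟨t, ht, rfl | rfl⟩) k' (hk' | ⟨t', ht', rfl | rfl⟩) h
      · exact hN.kinj k hk k' hk' h
      · have := abs_lt.1 (hKz k hk); have := (hP _ ht').h; simp only at h; linarith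
      · have := abs_lt.1 (hKz k hk); have := (hP _ ht').h; simp only at h; linarith
      · have := abs_lt.1 (hKz k' hk'); have := (hP _ ht).h; simp only at h; linarith
      · rw [hPinj ht ht' h]
      · have := (hP _ ht).h; have := (hP _ ht').h; simp only at h; linarith
      · have := abs_lt.1 (hKz k' hk'); have := (hP _ ht).h; simp only at h; linarith
      · have := (hP _ ht).h; have := (hP _ ht').h; simp only at h; linarith
      · rw [hPinj ht ht' (neg_injective h)]
    · intro f hf
      rcases hmem f hf with h | h
      · exact hN.ne f h.1
      · exact h.1.ne
    · rintro v ⟨f, hf, hv⟩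
      rcases hmem f hf with h | h
      · exact hN.vy v ⟨f, h.1, hv⟩
      · exact (h.2 v hv).1
    · rintro v ⟨f, hf, hv⟩
      rcases hmem f hf with h | h
      · rcases hN.vx v ⟨f, h.1, hv⟩ with h | ⟨k, hk, h⟩
        · exact .inl h
        · exact .inr ⟨k, .inl hk, h⟩
      · exact (h.2 v hv).2
    · intro f hf hlt
      rcases hmem f hf with h | h
      · exact hN.bad f h.1 hlt
      · exact absurd hlt h.1.not_gt
  · rw [← himg]; exact hiso.2.trans hiso2.2
  · rintro f ⟨hf, hlt⟩
    rcases hmem f hf with h | h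
    · exact ⟨⟨h.1, hlt⟩, fun h' => h.2 (.inl h')⟩
    · exact absurd hlt h.1.not_gt

theorem NormalForm.exists_of_bad {I : Set (R3 × R3)} {K : Set (ℝ × ℝ)} (hN : NormalForm I K)
    {e : R3 × R3} (he : e ∈ I) (hlt : e.2.1 < e.1.1) :
    ∃ I' K', NormalForm I' K' ∧
      EquivIsotopicSets (car (I ∪ outerUnion K)) (car (I' ∪ outerUnion K')) ∧
      (badEdges I').ncard < (badEdges I).ncard := by
  have hfin : (badEdges I).Finite :=
    (hN.lk.emb.fin.subset subset_union_left).subset (sep_subset _ _)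
  have key : ∃ f ∈ badEdges I, Backward f := by
    obtain ⟨h1, h2, h3⟩ := hN.bad e he hlt
    by_cases h : (e.1.1 = 0 → 0 ≤ e.1.2.2) ∧ (e.2.1 = 0 → 0 ≤ e.2.2.2)
    · exact ⟨e, ⟨he, hlt⟩, hlt, by linarith [(abs_lt.1 h2).1], (abs_lt.1 h1).2, h3, h.1, h.2⟩
    · refine ⟨rv e, ⟨hN.isym e he, ?_⟩, ⟨?_, ?_, ?_, ?_, ?_, ?_⟩⟩ <;>
        simp only [rv, tau]
      · linarith
      · linarith
      · linarith [(abs_lt.1 h1).2]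
      · linarith [(abs_lt.1 h2).1]
      · rcases h3 with h3 | h3
        · right; linarith
        · left; linarith
      · intro h0
        by_contra hc
        exact h ⟨fun h' => by linarith, fun h' => by linarith⟩
      · intro h0
        by_contra hc
        exact h ⟨fun h' => by linarith, fun h' => by linarith⟩
  obtain ⟨f, hf, hb⟩ := key
  obtain ⟨I', K', h1, h2, h3⟩ := hN.step_backward hf.1 hb
  refine ⟨I', K', h1, h2, ncard_lt_ncard ?_ hfin⟩
  exact ⟨h3.trans sdiff_subset, fun h => (h3 (h hf)).2 rfl⟩

/-- Every link in normal form is isotopic to one without edges running backwards. -/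
theorem NormalForm.exists_forward {I : Set (R3 × R3)} {K : Set (ℝ × ℝ)} (hN : NormalForm I K) :
    ∃ I' K', NormalForm I' K' ∧
      EquivIsotopicSets (car (I ∪ outerUnion K)) (car (I' ∪ outerUnion K')) ∧
      ∀ e ∈ I', e.1.1 < e.2.1 := by
  induction h : (badEdges I).ncard using Nat.strong_induction_on generalizing I K with
  | _ n ih =>
    by_cases hb : ∃ e ∈ I, e.2.1 < e.1.1
    · obtain ⟨e, he, hlt⟩ := hb
      obtain ⟨I', K', h1, h2, h3⟩ := hN.exists_of_bad he hlt
      obtain ⟨I₂, K₂, h4, h5, h6⟩ := ih _ (h ▸ h3) h1 rfl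
      exact ⟨I₂, K₂, h4, h2.trans h5, h6⟩
    · push Not at hb
      exact ⟨I, K, hN, .refl _, fun e he => lt_of_le_of_ne (hb e he) (hN.ne e he)⟩

/-! ### Reaching the normal form -/

theorem IsLink.lk {L : PolyLink} (hL : IsLink L) (hS : StronglyInvolutive L) :
    Lk {e | e ∈ L} := by
  obtain ⟨-, hne, hemb, hnext, hprev⟩ := hL
  refine ⟨⟨List.finite_toSet L, hne, ?_⟩, ⟨?_, ?_, ?_, ?_⟩, hS⟩
  · intro e he f hf hef x hx hx'
    have := hemb e he f hf hef ⟨hx, hx'⟩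
    simpa using this
  · intro e he f hf h
    obtain ⟨g, hg, hge⟩ := (hprev e he).exists
    have h1 : g.2 = f.1 := hge.trans h
    exact (hnext g hg).unique ⟨he, hge.symm⟩ ⟨hf, h1.symm⟩
  · intro e he f hf h
    obtain ⟨g, hg, hge⟩ := (hnext e he).exists
    have h1 : g.1 = f.2 := hge.trans h
    exact (hprev g hg).unique ⟨he, hge.symm⟩ ⟨hf, h1.symm⟩
  · intro e he
    exact (hnext e he).exists
  · intro e he
    exact (hprev e he).exists

theorem finite_setOf_cubic_eq_zero {a b c d : ℝ} (h : ¬ (a = 0 ∧ b = 0 ∧ c = 0 ∧ d = 0)) :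
    {s : ℝ | a + s * b + s ^ 2 * c + s ^ 3 * d = 0}.Finite := by
  classical
  set p : Polynomial ℝ := .C a + .C b * .X + .C c * .X ^ 2 + .C d * .X ^ 3 with hp
  have h0 : p ≠ 0 := by
    intro h0
    have key : ∀ n, p.coeff n = 0 := fun n => by rw [h0, Polynomial.coeff_zero]
    simp only [hp, Polynomial.coeff_add, Polynomial.coeff_C_mul, Polynomial.coeff_C,
      Polynomial.coeff_X_pow, Polynomial.coeff_X] at key
    exact h ⟨by simpa using key 0, by simpa using key 1, by simpa using key 2, by simpa using key 3⟩
  refine (p.roots.toFinset.finite_toSet).subset fun s hs => ?_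
  simp only [Finset.mem_coe, Multiset.mem_toFinset, Polynomial.mem_roots h0, Polynomial.IsRoot.def]
  have hs' : a + s * b + s ^ 2 * c + s ^ 3 * d = 0 := hs
  simp only [hp, Polynomial.eval_add, Polynomial.eval_mul, Polynomial.eval_C, Polynomial.eval_X,
    Polynomial.eval_pow]
  linarith

/-- No edge lies on the axis. -/
theorem Lk.not_axis {E : Set (R3 × R3)} (h : Lk E) {e : R3 × R3} (he : e ∈ E)
    (h1 : tau e.1 = e.1) (h2 : tau e.2 = e.2) : False := by
  have hr : rv e ∈ E := h.sym e he
  have hre : rv e = (e.2, e.1) := by rw [rv, h1, h2]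
  have hne := h.emb.ne e he
  have hm := midpoint_mem_segment (𝕜 := ℝ) e.1 e.2
  have := (h.emb.emb e he _ hr (fun h' => hne (by rw [hre] at h'; exact congrArg Prod.fst h'))
    _ hm (by rw [hre, segment_symm]; exact hm)).1
  rcases this with h | h
  · exact hne ((midpoint_eq_left_iff ℝ).1 h)
  · exact hne ((midpoint_eq_right_iff ℝ).1 h)

theorem Lk.exists_ne {E : Set (R3 × R3)} (h : Lk E) :
    ∃ F, IsoTo E F ∧ ∀ e ∈ F, e.1.1 ≠ e.2.1 := by
  obtain ⟨δ, hδ, hp⟩ := h.exists_perturb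
  set Q : ℝ → R3 → R3 := fun s v =>
    (v.1 + s * v.2.2 + s ^ 2 * (v.1 * v.2.1) + s ^ 3 * (v.2.2 * v.2.1), v.2.1, v.2.2) with hQ
  have hfv : (vts E).Finite := by
    refine ((h.emb.fin.image Prod.fst).union (h.emb.fin.image Prod.snd)).subset ?_
    rintro v ⟨e, he, rfl | rfl⟩
    exacts [.inl ⟨e, he, rfl⟩, .inr ⟨e, he, rfl⟩]
  have hev : ∀ᶠ s in nhds (0:ℝ), ∀ v ∈ vts E, ‖Q s v - v‖ ≤ δ := by
    rw [Filter.eventually_all_finite hfv]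
    intro v _
    have hc : Continuous fun s => ‖Q s v - v‖ := by fun_prop
    have h0 : ‖Q 0 v - v‖ < δ := by simp [hQ, hδ]
    filter_upwards [hc.continuousAt.eventually_lt continuousAt_const h0] with s hs using hs.le
  obtain ⟨ε, hε, hεs⟩ := Metric.eventually_nhds_iff.1 hev
  have hbad : (⋃ e ∈ E, {s : ℝ | (Q s e.1).1 = (Q s e.2).1}).Finite := by
    refine h.emb.fin.biUnion fun e he => ?_
    refine (finite_setOf_cubic_eq_zero (a := e.1.1 - e.2.1) (b := e.1.2.2 - e.2.2.2)
      (c := e.1.1 * e.1.2.1 - e.2.1 * e.2.2.1) (d := e.1.2.2 * e.1.2.1 - e.2.2.2 * e.2.2.1)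
      ?_).subset fun s hs => ?_
    · rintro ⟨h1, h2, h3, h4⟩
      have h5 : e.1.1 = e.2.1 := by linarith
      have h6 : e.1.2.2 = e.2.2.2 := by linarith
      have h7 : e.1.2.1 - e.2.2.1 ≠ 0 := fun h0 =>
        h.emb.ne e he (by ext; exacts [h5, by linarith, h6])
      have h8 : e.1.1 = 0 := by
        rw [← h5] at h3
        have : e.1.1 * (e.1.2.1 - e.2.2.1) = 0 := by linarith
        exact (mul_eq_zero.1 this).resolve_right h7
      have h9 : e.1.2.2 = 0 := by
        rw [← h6] at h4
        have : e.1.2.2 * (e.1.2.1 - e.2.2.1) = 0 := by linarith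
        exact (mul_eq_zero.1 this).resolve_right h7
      refine h.not_axis he ?_ ?_
      · ext <;> simp [tau, h8, h9]
      · ext <;> simp [tau, ← h5, ← h6, h8, h9]
    · simp only [hQ, mem_ofPred_eq] at hs ⊢
      linarith
  obtain ⟨s, hs, hs'⟩ := ((Ioo_infinite hε).sdiff hbad).nonempty
  refine ⟨imgE (Q s) E, hp (Q s) (hεs ?_) ?_, ?_⟩
  · rw [Real.dist_eq, sub_zero, abs_of_pos hs.1]; exact hs.2
  · intro v _
    ext <;> simp only [hQ, tau]
    ring
  · rintro _ ⟨e, he, rfl⟩ h0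
    exact hs' (mem_biUnion he h0)

/-- Rescaling the coordinates and translating along the axis. -/
def rescale (a b d c : ℝ) (v : R3) : R3 := (a * v.1, b * v.2.1 + d, c * v.2.2)

theorem rescale_injective {a b c : ℝ} (ha : a ≠ 0) (hb : b ≠ 0) (hc : c ≠ 0) (d : ℝ) :
    Function.Injective (rescale a b d c) := by
  rintro ⟨x, y, z⟩ ⟨x', y', z'⟩ h
  simp only [rescale, Prod.mk.injEq, mul_eq_mul_left_iff, add_left_inj] at h
  simp_all

theorem rescale_tau (a b d c : ℝ) (v : R3) :
    rescale a b d c (tau v) = tau (rescale a b d c v) := by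
  simp [rescale, tau]

theorem exists_rescale_of_mem_segment {a b d c : ℝ} {p q x : R3}
    (h : x ∈ segment ℝ (rescale a b d c p) (rescale a b d c q)) :
    ∃ x₀ ∈ segment ℝ p q, x = rescale a b d c x₀ := by
  obtain ⟨u, v, hu, hv, huv, rfl⟩ := h
  refine ⟨_, ⟨u, v, hu, hv, huv, rfl⟩, ?_⟩
  obtain rfl : u = 1 - v := by linarith
  ext <;> simp [rescale] <;> ring

theorem Emb.rescale {E : Set (R3 × R3)} (h : Emb E) {a b c : ℝ} (ha : a ≠ 0) (hb : b ≠ 0)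
    (hc : c ≠ 0) (d : ℝ) : Emb (imgE (rescale a b d c) E) := by
  have inj := rescale_injective ha hb hc d
  refine ⟨h.fin.image _, ?_, ?_⟩
  · rintro _ ⟨e, he, rfl⟩ h'
    exact h.ne e he (inj h')
  · rintro _ ⟨e, he, rfl⟩ _ ⟨f, hf, rfl⟩ hef x hx hx'
    obtain ⟨x₀, hx₀, rfl⟩ := exists_rescale_of_mem_segment hx
    obtain ⟨x₁, hx₁, h1⟩ := exists_rescale_of_mem_segment hx'
    obtain rfl := inj h1
    have := h.emb e he f hf (fun h => hef (by rw [h])) x₀ hx₀ hx₁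
    simpa [inj.eq_iff] using this

theorem Lk.rescale {E : Set (R3 × R3)} (h : Lk E) {a b c : ℝ} (ha : 0 < a) (hb : 0 < b)
    (hc : 0 < c) (d : ℝ) : IsoTo E (imgE (rescale a b d c) E) := by
  refine ⟨⟨h.emb.rescale ha.ne' hb.ne' hc.ne' d,
    h.comb.imgE (rescale_injective ha.ne' hb.ne' hc.ne' d).injOn,
    h.sym.imgE fun v _ => rescale_tau _ _ _ _ v⟩, ?_⟩
  have pos : ∀ t ∈ Icc (0:ℝ) 1, ∀ a : ℝ, 0 < a → 1 - t + t * a ≠ 0 := by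
    intro t ht a ha
    rcases ht.1.eq_or_lt with rfl | h0
    · simp
    · have := mul_pos h0 ha
      linarith [ht.2]
  have := equivIsotopic_of_family tau E
    (fun t => _root_.rescale (1 - t + t * a) (1 - t + t * b) (t * d) (1 - t + t * c)) h.sym
    (fun v => by unfold _root_.rescale; fun_prop) (fun t v => rescale_tau _ _ _ _ v)
    (fun t ht => (rescale_injective (pos t ht a ha) (pos t ht b hb) (pos t ht c hc) _).injOn)
    (fun t ht => h.emb.rescale (pos t ht a ha) (pos t ht b hb) (pos t ht c hc) _)
  convert this using 2
  · simp only [imgE]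
    have : Prod.map (_root_.rescale (1 - 0 + 0 * a) (1 - 0 + 0 * b) (0 * d) (1 - 0 + 0 * c))
        (_root_.rescale (1 - 0 + 0 * a) (1 - 0 + 0 * b) (0 * d) (1 - 0 + 0 * c)) = id := by
      ext <;> simp [_root_.rescale]
    rw [this, image_id]
  · simp

theorem exists_norm_bound {E : Set (R3 × R3)} (hE : E.Finite) :
    ∃ M : ℝ, 0 < M ∧ ∀ v ∈ vts E, ‖v‖ < M := by
  have hfv : (vts E).Finite := by
    refine ((hE.image Prod.fst).union (hE.image Prod.snd)).subset ?_
    rintro v ⟨e, he, rfl | rfl⟩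
    exacts [.inl ⟨e, he, rfl⟩, .inr ⟨e, he, rfl⟩]
  obtain ⟨M, hM⟩ := hfv.isBounded.exists_norm_le
  exact ⟨max M 0 + 1, by positivity, fun v hv =>
    (hM v hv).trans_lt (by linarith [le_max_left M 0])⟩

/-- Subdividing an edge, or a symmetric pair of edges, at an interior point. -/
theorem Lk.subdivide {E : Set (R3 × R3)} (h : Lk E) {e : R3 × R3} (he : e ∈ E) {b : R3}
    (hb : b ∈ segment ℝ e.1 e.2) (h1 : e.1 ≠ b) (h2 : e.2 ≠ b) (hτ : rv e = e → tau b = b) :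
    Lk ((E \ {e, rv e}) ∪ dbl {(e.1, b), (b, e.2)}) ∧
    car ((E \ {e, rv e}) ∪ dbl {(e.1, b), (b, e.2)}) = car E := by
  have hr : rv e ∈ E := h.sym e he
  set X := E \ {e, rv e} with hX
  have hset : X ∪ dbl {e} = E := by
    ext f
    simp only [hX, mem_union, mem_sdiff, mem_insert_iff, mem_singleton_iff, mem_dbl]
    have : rv f = e ↔ f = rv e :=
      ⟨fun h => by rw [← h, rv_rv], fun h => by rw [h, rv_rv]⟩
    rw [this]
    constructor
    · rintro (h | h | h)
      exacts [h.1, h ▸ he, h ▸ hr]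
    · tauto
  have hXs : TauSym X := by
    intro f hf
    refine ⟨h.sym f hf.1, fun h => hf.2 ?_⟩
    rcases h with h | h
    · right; rw [mem_singleton_iff, ← h]; exact (rv_rv f).symm
    · left
      rw [mem_singleton_iff] at h
      rw [← rv_rv f, ← rv_rv e]; exact congrArg rv h
  have hcar : car (X ∪ dbl {(e.1, b), (b, e.2)}) = car E := by
    rw [car_subdivide hb, Prod.mk.eta, hset]
  refine ⟨?_, hcar⟩
  have nd := nd_of_mem hb h1 h2
  have htri : tri e.1 b e.2 ⊆ segment ℝ e.1 e.2 :=
    tri_subset (convex_segment _ _) (left_mem_segment _ _ _) hb (right_mem_segment _ _ _)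
  have hXmeet : ∀ f ∈ X, Meet e f := fun f hf =>
    h.emb.emb e he f hf.1 fun h' => hf.2 (.inl h'.symm)
  by_cases hre : rv e = e
  · have hd : dbl {(e.1, b), (b, e.2)} = {(e.1, b), (b, e.2)} := by
      have e1 : tau e.2 = e.1 := congrArg Prod.fst hre
      have e2 : tau e.1 = e.2 := congrArg Prod.snd hre
      ext f
      rw [mem_dbl]
      constructor
      · rintro (h | h)
        · exact h
        · rw [← rv_rv f]
          rcases h with h | h
          · rw [h]; right; simp [rv, hτ hre, e2]
          · rw [mem_singleton_iff] at h
            rw [h]; left; simp [rv, hτ hre, e1]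
      · exact .inl
    have sub1 : segment ℝ e.1 b ⊆ segment ℝ e.1 e.2 :=
      (convex_segment _ _).segment_subset (left_mem_segment _ _ _) hb
    have sub2 : segment ℝ b e.2 ⊆ segment ℝ e.1 e.2 :=
      (convex_segment _ _).segment_subset hb (right_mem_segment _ _ _)
    refine ⟨?_, ?_, hXs.union (tauSym_dbl _)⟩
    · rw [hd]
      refine (h.emb.mono sdiff_subset).union ⟨by simp, ?_, ?_⟩ ?_
      · rintro f (rfl | rfl)
        exacts [h1, h2.symm]
      · have key : Meet (e.1, b) (b, e.2) := fun x hx hx' =>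
          ⟨.inr (nd.eq_of_mem hx hx'), .inl (nd.eq_of_mem hx hx')⟩
        rintro f (rfl | rfl) g (rfl | rfl) hfg
        · exact absurd rfl hfg
        · exact key
        · exact key.symm
        · exact absurd rfl hfg
      · rintro f hf g (rfl | rfl) x hx hx'
        · obtain ⟨h3, h4⟩ := hXmeet f hf x (sub1 hx') hx
          exact ⟨h4, .inl (h3.resolve_right fun h => nd.notMem (h ▸ hx'))⟩
        · obtain ⟨h3, h4⟩ := hXmeet f hf x (sub2 hx') hx
          exact ⟨h4, .inr (h3.resolve_left fun h => nd.notMem' (h ▸ hx'))⟩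
    · have hins : insert (e.1, e.2) X = E := by
        rw [← hset, Prod.mk.eta]
        ext f
        simp only [mem_insert_iff, mem_union, mem_dbl, mem_singleton_iff]
        have : rv f = e ↔ f = e :=
          ⟨fun h => by rw [← rv_rv f, h, hre], fun h => by rw [h, hre]⟩
        rw [this]; tauto
      rw [hd]
      have := Comb.replace (X := X) (a := e.1) (b := b) (c := e.2) (hins ▸ h.comb)
        (fun h => h.2 (.inl rfl)) ?_
      · convert this using 1
        ext f; simp only [mem_union, mem_insert_iff, mem_singleton_iff]; tauto
      · rw [hins]
        rintro ⟨f, hf, hbf⟩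
        by_cases hfe : f = e
        · subst hfe
          rcases hbf with h | h
          exacts [h1 h.symm, h2 h.symm]
        · have hbs : b ∈ segment ℝ f.1 f.2 := by
            rcases hbf with h | h <;> rw [h]
            exacts [left_mem_segment _ _ _, right_mem_segment _ _ _]
          rcases (h.emb.emb e he f hf (Ne.symm hfe) b hb hbs).1 with h | h
          exacts [h1 h.symm, h2 h.symm]
  · refine Lk.replace (by rw [Prod.mk.eta, hset]; exact h) hXs nd ?_ ?_
    · intro x hx hxX
      obtain ⟨f, hf, hxf⟩ := mem_car.1 hxX
      exact (hXmeet f hf x (htri hx) hxf).1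
    · intro x hx hx'
      obtain ⟨h3, h4⟩ := h.emb.emb e he _ hr (Ne.symm hre) x (htri hx)
        (mem_segment_rv.2 (htri hx'))
      rcases h3 with rfl | rfl
      · rcases h4 with h4 | h4
        · exact absurd (h.comb.out _ hr _ he h4.symm) hre
        · exact .inl ⟨rfl, h4.symm⟩
      · rcases h4 with h4 | h4
        · exact .inr ⟨rfl, h4.symm⟩
        · exact absurd (h.comb.inn _ hr _ he h4.symm) hre

theorem Lk.exists_cut {E : Set (R3 × R3)} (h : Lk E) (hne : ∀ e ∈ E, e.1.1 ≠ e.2.1) {T : Set R3}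
    (hT : Convex ℝ T) (hTτ : ∀ v ∈ T, tau v ∈ T) (hET : vts E ⊆ T) :
    ∃ F, Lk F ∧ car F = car E ∧ (∀ e ∈ F, e.1.1 ≠ e.2.1) ∧ vts F ⊆ T ∧
      ∀ e ∈ F, 0 ≤ e.1.1 * e.2.1 := by
  induction hn : {e ∈ E | e.1.1 * e.2.1 < 0}.ncard using Nat.strong_induction_on
    generalizing E with
  | _ n ih =>
    by_cases hb : ∃ e ∈ E, e.1.1 * e.2.1 < 0
    swap
    · push Not at hb
      exact ⟨E, h, rfl, hne, hET, hb⟩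
    obtain ⟨e, he, hlt⟩ := hb
    have hd : e.1.1 - e.2.1 ≠ 0 := sub_ne_zero.2 (hne e he)
    have he1 : e.1.1 ≠ 0 := by rintro h; rw [h] at hlt; simp at hlt
    have he2 : e.2.1 ≠ 0 := by rintro h; rw [h] at hlt; simp at hlt
    obtain ⟨s, hs⟩ : ∃ s, s = e.1.1 / (e.1.1 - e.2.1) := ⟨_, rfl⟩
    have hs01 : s ∈ Icc (0:ℝ) 1 := by
      rw [hs]
      rcases lt_or_gt_of_ne he1 with h0 | h0
      · have h0' : 0 < e.2.1 := by by_contra hc; nlinarith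
        constructor
        · exact div_nonneg_of_nonpos h0.le (by linarith)
        · rw [div_le_one_of_neg (by linarith)]; linarith
      · have h0' : e.2.1 < 0 := by by_contra hc; nlinarith
        constructor
        · exact div_nonneg h0.le (by linarith)
        · rw [div_le_one (by linarith)]; linarith
    have hb1 : (lin id e s).1 = 0 := by
      rw [lin_id_fst, hs]; field_simp; ring
    obtain ⟨hL, hcar⟩ := h.subdivide he (b := lin id e s)
      (mem_segment_iff_lin.2 ⟨s, hs01, rfl⟩) (fun h => he1 (by rw [h, hb1]))
      (fun h => he2 (by rw [h, hb1])) (fun hr => by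
        have e1 : tau e.1 = e.2 := congrArg Prod.snd hr
        have e2 : e.2.1 = -e.1.1 := by rw [← e1]; rfl
        have e3 : e.2.2.2 = -e.1.2.2 := by rw [← e1]; rfl
        have hs2 : s = 1/2 := by rw [hs, e2]; field_simp; ring
        ext
        · simp [tau, hb1]
        · rfl
        · simp only [tau, lin_id_trd, e3, hs2]; ring)
    have hbT : lin id e s ∈ T := hT.segment_subset (hET ⟨e, he, .inl rfl⟩) (hET ⟨e, he, .inr rfl⟩)
      (mem_segment_iff_lin.2 ⟨s, hs01, rfl⟩)
    set b := lin id e s with hbdef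
    set F := (E \ {e, rv e}) ∪ dbl {(e.1, b), (b, e.2)} with hF
    have hmem : ∀ f ∈ F, (f ∈ E ∧ f ≠ e) ∨ (f.1.1 ≠ f.2.1 ∧ f.1 ∈ T ∧ f.2 ∈ T ∧
        0 ≤ f.1.1 * f.2.1) := by
      rintro f (hf | hf)
      · exact .inl ⟨hf.1, fun h => hf.2 (.inl h)⟩
      · right
        have key : ∀ f ∈ ({(e.1, b), (b, e.2)} : Set (R3 × R3)), f.1.1 ≠ f.2.1 ∧ f.1 ∈ T ∧
            f.2 ∈ T ∧ 0 ≤ f.1.1 * f.2.1 := by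
          rintro f (rfl | rfl)
          · simp only [hb1]
            exact ⟨he1, hET ⟨e, he, .inl rfl⟩, hbT, by simp⟩
          · simp only [hb1]
            exact ⟨he2.symm, hbT, hET ⟨e, he, .inr rfl⟩, by simp⟩
        rcases mem_dbl.1 hf with hf | hf
        · exact key f hf
        · obtain ⟨h1, h2, h3, h4⟩ := key _ hf
          simp only [rv] at h1 h2 h3 h4
          refine ⟨?_, ?_, ?_, ?_⟩
          · simp only [tau] at h1
            exact fun h => h1 (by rw [h])
          · simpa [tau_tau] using hTτ _ h3
          · simpa [tau_tau] using hTτ _ h2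
          · simp only [tau] at h4; linarith
    obtain ⟨G, h1, h2, h3⟩ := ih {e ∈ F | e.1.1 * e.2.1 < 0}.ncard (by
        rw [← hn]
        refine ncard_lt_ncard ⟨?_, ?_⟩ (h.emb.fin.subset (sep_subset _ _))
        · rintro f ⟨hf, hfl⟩
          rcases hmem f hf with h | h
          · exact ⟨h.1, hfl⟩
          · exact absurd hfl h.2.2.2.not_gt
        · intro hsub
          have := hsub ⟨he, hlt⟩
          rcases hmem e this.1 with h | h
          · exact h.2 rfl
          · exact absurd hlt h.2.2.2.not_gt) hL
      (fun f hf => by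
        rcases hmem f hf with h | h
        exacts [hne f h.1, h.1])
      (by
        rintro v ⟨f, hf, hv⟩
        rcases hmem f hf with h | h
        · exact hET ⟨f, h.1, hv⟩
        · rcases hv with rfl | rfl
          exacts [h.2.1, h.2.2.1]) rfl
    exact ⟨G, h1, h2.trans hcar, h3⟩

/-- Every strongly involutive link is isotopic to one in normal form. -/
theorem IsLink.exists_normalForm {L : PolyLink} (hL : IsLink L) (hS : StronglyInvolutive L) :
    ∃ I, NormalForm I ∅ ∧ EquivIsotopicSets (carrier L) (car (I ∪ outerUnion ∅)) := by
  obtain ⟨E₁, ⟨hE₁, hi₁⟩, hne₁⟩ := (hL.lk hS).exists_ne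
  obtain ⟨M, hM, hMv⟩ := exists_norm_bound hE₁.emb.fin
  obtain ⟨c, hc, hcM⟩ : ∃ c > 0, c * M = 1/4 := ⟨1 / 4 / M, by positivity, by field_simp⟩
  obtain ⟨hE₂, hi₂⟩ := hE₁.rescale hc hc hc (-2)
  set E₂ := imgE (rescale c c (-2) c) E₁ with hE₂def
  set T : Set R3 := Ioo (-1/4) (1/4) ×ˢ Ioo (-5/2) (-3/2) ×ˢ univ with hT
  have hTc : Convex ℝ T := (convex_Ioo _ _).prod ((convex_Ioo _ _).prod convex_univ)
  have hTτ : ∀ v ∈ T, tau v ∈ T := by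
    rintro v ⟨h1, h2, -⟩
    refine ⟨?_, h2, trivial⟩
    simp only [tau, mem_Ioo] at h1 ⊢
    constructor <;> linarith [h1.1, h1.2]
  have hv₂ : ∀ v ∈ vts E₂, ∃ w ∈ vts E₁, v = rescale c c (-2) c w := by
    rintro v ⟨_, ⟨e, he, rfl⟩, rfl | rfl⟩
    exacts [⟨e.1, ⟨e, he, .inl rfl⟩, rfl⟩, ⟨e.2, ⟨e, he, .inr rfl⟩, rfl⟩]
  have hE₂T : vts E₂ ⊆ T := by
    intro v hv
    obtain ⟨w, hw, rfl⟩ := hv₂ v hv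
    have hn := hMv w hw
    have h1 := abs_lt.1 ((norm_fst_le w).trans_lt hn)
    have h2 := abs_lt.1 (((norm_fst_le w.2).trans (norm_snd_le w)).trans_lt hn)
    simp only [hT, mem_prod, rescale, mem_Ioo, mem_univ, and_true]
    refine ⟨⟨?_, ?_⟩, ?_, ?_⟩ <;> nlinarith [h1.1, h1.2, h2.1, h2.2]
  have hne₂ : ∀ e ∈ E₂, e.1.1 ≠ e.2.1 := by
    rintro _ ⟨e, he, rfl⟩ h
    exact hne₁ e he (mul_left_cancel₀ hc.ne' h)
  obtain ⟨I, hI, hcar, hne, hIT, hst⟩ := hE₂.exists_cut hne₂ hTc hTτ hE₂T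
  have hout : I ∪ outerUnion ∅ = I := by simp [outerUnion]
  have habs : ∀ v ∈ vts I, |v.1| < 1/4 := fun v hv => by
    have := (hIT hv).1
    exact abs_lt.2 ⟨by linarith [this.1], this.2⟩
  refine ⟨I, ⟨by rwa [hout], hI.sym, finite_empty, by simp, by simp, by simp, by simp, hne,
    fun v hv => (hIT hv).2.1, fun v hv => .inl (habs v hv), ?_⟩, ?_⟩
  · intro e he hlt
    refine ⟨habs _ ⟨e, he, .inl rfl⟩, habs _ ⟨e, he, .inr rfl⟩, ?_⟩
    have := hst e he
    by_contra hc
    push Not at hc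
    nlinarith [hc.1, hc.2]
  · rw [hout, hcar]
    have hcL : carrier L = car {e | e ∈ L} := rfl
    rw [hcL]
    exact hi₁.trans hi₂

/-- A path that is affine on every interval free of points of a finite set is piecewise linear. -/
theorem isPLPath_of_finite {T : Set ℝ} (hT : T.Finite) {f : ℝ → ℝ × ℝ}
    (h : ∀ c d : ℝ, 0 ≤ c → c < d → d ≤ 1 → (∀ x ∈ T, x ≤ c ∨ d ≤ x) →
      ∃ u v : ℝ × ℝ, ∀ s ∈ Icc c d, f s = u + s • v) : IsPLPath f := by
  classical
  set S : Finset ℝ := insert 0 (insert 1 (hT.toFinset.filter fun x => 0 ≤ x ∧ x ≤ 1)) with hS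
  have hmem : ∀ x ∈ S, 0 ≤ x ∧ x ≤ 1 := by
    intro x hx
    simp only [hS, Finset.mem_insert, Finset.mem_filter] at hx
    rcases hx with rfl | rfl | hx
    · norm_num
    · norm_num
    · exact hx.2
  have h0 : (0:ℝ) ∈ S := by simp [hS]
  have h1 : (1:ℝ) ∈ S := by simp [hS]
  obtain ⟨k, hk⟩ : ∃ k, S.card = k + 1 :=
    ⟨S.card - 1, by have := Finset.card_pos.2 ⟨0, h0⟩; omega⟩
  have hsurj : ∀ x ∈ S, ∃ j, S.orderEmbOfFin hk j = x := fun x hx => by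
    have : x ∈ range (S.orderEmbOfFin hk) := by rw [Finset.range_orderEmbOfFin]; exact hx
    exact this
  have hin : ∀ j, S.orderEmbOfFin hk j ∈ S := fun j => S.orderEmbOfFin_mem hk j
  refine ⟨k, S.orderEmbOfFin hk, ?_, ?_, (S.orderEmbOfFin hk).monotone, fun j => ?_⟩
  · obtain ⟨j, hj⟩ := hsurj 0 h0
    refine le_antisymm ?_ (hmem _ (hin _)).1
    rw [← hj]; exact (S.orderEmbOfFin hk).monotone (Fin.zero_le j)
  · obtain ⟨j, hj⟩ := hsurj 1 h1
    refine le_antisymm (hmem _ (hin _)).2 ?_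
    rw [← hj]; exact (S.orderEmbOfFin hk).monotone (Fin.le_last j)
  · refine h _ _ (hmem _ (hin _)).1 ((S.orderEmbOfFin hk).strictMono Fin.castSucc_lt_succ)
      (hmem _ (hin _)).2 fun x hx => ?_
    by_cases hx' : 0 ≤ x ∧ x ≤ 1
    · obtain ⟨i, rfl⟩ := hsurj x (by simp [hS, hx, hx'])
      rcases le_or_gt i j.castSucc with hi | hi
      · exact Or.inl ((S.orderEmbOfFin hk).monotone hi)
      · exact Or.inr ((S.orderEmbOfFin hk).monotone (Fin.castSucc_lt_iff_succ_le.1 hi))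
    · rcases lt_or_ge x 0 with h' | h'
      · exact Or.inl (h'.le.trans (hmem _ (hin _)).1)
      · exact Or.inr ((hmem _ (hin _)).2.trans (not_le.1 fun h'' => hx' ⟨h', h''⟩).le)

/-- The strand of `G` which starts at the vertex `v`. -/
inductive Strand (G : Set (R3 × R3)) (v : R3) : R3 × R3 → Prop
  | start (e : R3 × R3) (he : e ∈ G) (h : e.1 = v) : Strand G v e
  | step (e f : R3 × R3) (hs : Strand G v e) (hf : f ∈ G) (h : f.1 = e.2) : Strand G v f

theorem Strand.mem {G : Set (R3 × R3)} {v : R3} {e : R3 × R3} (h : Strand G v e) : e ∈ G := by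
  cases h <;> assumption

/-- A finite embedded graph all of whose edges run forward from the plane `x = -1/2` to the plane
`x = 1/2`. -/
structure FwdGraph (G : Set (R3 × R3)) : Prop where
  emb : Emb G
  fwd : ∀ e ∈ G, e.1.1 < e.2.1
  out : ∀ e ∈ G, ∀ f ∈ G, e.1 = f.1 → e = f
  inn : ∀ e ∈ G, ∀ f ∈ G, e.2 = f.2 → e = f
  lo : ∀ e ∈ G, -1/2 ≤ e.1.1
  hi : ∀ e ∈ G, e.2.1 ≤ 1/2
  next : ∀ e ∈ G, e.2.1 = 1/2 ∨ ∃ f ∈ G, f.1 = e.2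
  prev : ∀ e ∈ G, e.1.1 = -1/2 ∨ ∃ f ∈ G, f.2 = e.1

namespace FwdGraph

variable {G : Set (R3 × R3)}

theorem exists_strand (h : FwdGraph G) {e : R3 × R3} (he : e ∈ G) :
    ∃ v : R3, v.1 = -1/2 ∧ Strand G v e := by
  by_contra hcon
  obtain ⟨f, ⟨hf, hf'⟩, hmin⟩ := Set.exists_min_image
    {f ∈ G | ¬ ∃ v : R3, v.1 = -1/2 ∧ Strand G v f} (fun f => f.1.1)
    (h.emb.fin.subset fun f hf => hf.1) ⟨e, he, hcon⟩
  rcases h.prev f hf with h1 | ⟨g, hg, hgf⟩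
  · exact hf' ⟨f.1, h1, .start f hf rfl⟩
  · by_cases hg' : ∃ v : R3, v.1 = -1/2 ∧ Strand G v g
    · obtain ⟨v, hv, hs⟩ := hg'
      exact hf' ⟨v, hv, .step g f hs hf hgf.symm⟩
    · have h2 := hmin g ⟨hg, hg'⟩
      have h3 := h.fwd g hg
      rw [hgf] at h3
      exact absurd h2 (not_le.2 h3)

theorem strand_unique (h : FwdGraph G) {v w : R3} (hv : v.1 = -1/2) (hw : w.1 = -1/2)
    {e : R3 × R3} (h1 : Strand G v e) : Strand G w e → v = w := by
  induction h1 with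
  | start e he hev =>
    intro h2
    cases h2 with
    | start _ _ hew => exact hev.symm.trans hew
    | step g _ hs _ hge =>
      have h3 := h.fwd g hs.mem
      have h4 := h.lo g hs.mem
      rw [← hge, hev, hv] at h3
      linarith
  | step g e hs he hge ih =>
    intro h2
    cases h2 with
    | start _ _ hew =>
      have h3 := h.fwd g hs.mem
      have h4 := h.lo g hs.mem
      rw [← hge, hew, hw] at h3
      linarith
    | step g' _ hs' _ hge' =>
      have : g = g' := h.inn g hs.mem g' hs'.mem (hge.symm.trans hge')
      subst this
      exact ih hs'

theorem strand_compare (h : FwdGraph G) {v : R3} (hv : v.1 = -1/2) {e f : R3 × R3}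
    (he : Strand G v e) (hf : Strand G v f) :
    e = f ∨ (e.2 = f.1 ∨ e.2.1 < f.1.1) ∨ (f.2 = e.1 ∨ f.2.1 < e.1.1) := by
  induction he generalizing f with
  | start e he hev =>
    induction hf with
    | start f hf hfv => exact Or.inl (h.out e he f hf (hev.trans hfv.symm))
    | step g f hs hf hgf ih =>
      have hg := h.fwd g hs.mem
      have hlo := h.lo g hs.mem
      rcases ih with rfl | (h1 | h1) | (h1 | h1)
      · exact Or.inr (Or.inl (Or.inl hgf.symm))
      · rw [← h1, ← hgf] at hg; exact Or.inr (Or.inl (Or.inr hg))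
      · rw [← hgf] at hg; exact Or.inr (Or.inl (Or.inr (h1.trans hg)))
      · rw [h1, hev, hv] at hg; linarith
      · rw [hev, hv] at h1; linarith
  | step e₀ e hs he hee ih =>
    have h0 := h.fwd e₀ hs.mem
    have hlo := h.lo e₀ hs.mem
    induction hf with
    | start f hf hfv =>
      rcases ih (.start f hf hfv) with rfl | (h1 | h1) | (h1 | h1)
      · exact Or.inr (Or.inr (Or.inl hee.symm))
      · rw [h1, hfv, hv] at h0; linarith
      · rw [hfv, hv] at h1; linarith
      · rw [← h1, ← hee] at h0; exact Or.inr (Or.inr (Or.inr h0))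
      · rw [← hee] at h0; exact Or.inr (Or.inr (Or.inr (h1.trans h0)))
    | step f₀ f hs' hf hff ih' =>
      have h0' := h.fwd f₀ hs'.mem
      rcases ih hs' with rfl | h1 | h1
      · exact Or.inl (h.out e he f hf (hee.trans hff.symm))
      · have h1' : e.1.1 ≤ f₀.1.1 := by
          rw [hee]; rcases h1 with h1 | h1
          · rw [h1]
          · exact h1.le
        rcases ih' with rfl | (h2 | h2) | (h2 | h2)
        · exact Or.inr (Or.inl (Or.inl hff.symm))
        · rw [← h2, ← hff] at h0'; exact Or.inr (Or.inl (Or.inr h0'))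
        · rw [← hff] at h0'; exact Or.inr (Or.inl (Or.inr (h2.trans h0')))
        · rw [h2] at h0'; linarith
        · linarith
      · rcases ih (.step f₀ f hs' hf hff) with rfl | h2 | h2
        · exact Or.inr (Or.inr (Or.inl hee.symm))
        · have h3 : e₀.2.1 ≤ f.1.1 := by
            rcases h2 with h2 | h2
            · rw [h2]
            · exact h2.le
          have h4 : f.1.1 ≤ e₀.1.1 := by
            rw [hff]; rcases h1 with h1 | h1
            · rw [h1]
            · exact h1.le
          linarith
        · rw [← hee] at h0
          rcases h2 with h2 | h2
          · rw [← h2] at h0; exact Or.inr (Or.inr (Or.inr h0))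
          · exact Or.inr (Or.inr (Or.inr (h2.trans h0)))

theorem strand_eq_of_fst_eq (h : FwdGraph G) {v : R3} (hv : v.1 = -1/2) {e f : R3 × R3}
    (he : Strand G v e) (hf : Strand G v f) {p q : R3} (hp : p ∈ segment ℝ e.1 e.2)
    (hq : q ∈ segment ℝ f.1 f.2) (hpq : p.1 = q.1) : p = q := by
  have key : ∀ {e f : R3 × R3}, e ∈ G → f ∈ G → (e.2 = f.1 ∨ e.2.1 < f.1.1) → ∀ {p q : R3},
      p ∈ segment ℝ e.1 e.2 → q ∈ segment ℝ f.1 f.2 → p.1 = q.1 → p = q := by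
    intro e f he hf hef p q hp hq hpq
    have h1 : p.1 ≤ e.2.1 := by
      have := segment_fnl_le (fnl 1 0 0) hp (k := e.2.1)
        (by simpa [fnl_apply] using (h.fwd e he).le) (by simp [fnl_apply])
      simpa [fnl_apply] using this
    have h2 : f.1.1 ≤ q.1 := by
      have := segment_fnl_le (fnl (-1) 0 0) hq (k := -f.1.1) (by simp [fnl_apply])
        (by simpa [fnl_apply] using (h.fwd f hf).le)
      simpa [fnl_apply] using this
    rcases hef with hef | hef
    · have hpe : p = e.2 := eq_right_of_fnl (fnl 1 0 0) hp
        (by simpa [fnl_apply] using h.fwd e he)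
        (by simp only [fnl_apply]; rw [hef] at h1 ⊢; linarith)
      have hqf : q = f.1 := eq_left_of_fnl (fnl (-1) 0 0) hq
        (by simpa [fnl_apply] using h.fwd f hf)
        (by simp only [fnl_apply]; rw [hef] at h1; linarith)
      rw [hpe, hqf, hef]
    · linarith
  rcases h.strand_compare hv he hf with rfl | h1 | h1
  · have h2 := h.fwd e he.mem
    obtain ⟨s, -, rfl⟩ := mem_segment_iff_lin.1 hp
    obtain ⟨r, -, rfl⟩ := mem_segment_iff_lin.1 hq
    have : s = r := by
      simp only [lin, id, Prod.fst_add, Prod.smul_fst, Prod.fst_sub, smul_eq_mul] at hpq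
      have h3 : (s - r) * (e.2.1 - e.1.1) = 0 := by linarith
      rcases mul_eq_zero.1 h3 with h4 | h4 <;> linarith
    rw [this]
  · exact key he.mem hf.mem h1 hp hq hpq
  · exact (key hf.mem he.mem h1 hq hp hpq.symm).symm

theorem exists_span (h : FwdGraph G) {v : R3} (hv : v.1 = -1/2) (hG : ∃ e ∈ G, e.1 = v) {x : ℝ}
    (hx : x ∈ Icc (-1/2 : ℝ) (1/2)) : ∃ e, Strand G v e ∧ e.1.1 ≤ x ∧ x ≤ e.2.1 := by
  obtain ⟨e₀, he₀, hev⟩ := hG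
  obtain ⟨e, ⟨hs, hex⟩, hmax⟩ := Set.exists_max_image {e | Strand G v e ∧ e.1.1 ≤ x}
    (fun e => e.1.1) (h.emb.fin.subset fun e he => he.1.mem)
    ⟨e₀, .start e₀ he₀ hev, by rw [hev, hv]; exact hx.1⟩
  refine ⟨e, hs, hex, le_of_not_gt fun hlt => ?_⟩
  rcases h.next e hs.mem with h1 | ⟨f, hf, hfe⟩
  · rw [h1] at hlt; exact absurd hx.2 (not_le.2 hlt)
  · have h2 := hmax f ⟨.step e f hs hf hfe, by rw [hfe]; exact hlt.le⟩
    have h3 := h.fwd e hs.mem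
    simp only [hfe] at h2
    exact absurd h2 (not_le.2 h3)

end FwdGraph

/-- The point of the edge `e` with first coordinate `x`. -/
def atFst (e : R3 × R3) (x : ℝ) : R3 := lin id e ((x - e.1.1) / (e.2.1 - e.1.1))

theorem atFst_fst {e : R3 × R3} (h : e.1.1 < e.2.1) (x : ℝ) : (atFst e x).1 = x := by
  have : e.2.1 - e.1.1 ≠ 0 := by linarith
  simp only [atFst, lin, id, Prod.fst_add, Prod.smul_fst, Prod.fst_sub, smul_eq_mul]
  field_simp
  ring

theorem atFst_mem {e : R3 × R3} (h : e.1.1 < e.2.1) {x : ℝ} (h1 : e.1.1 ≤ x) (h2 : x ≤ e.2.1) :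
    atFst e x ∈ segment ℝ e.1 e.2 :=
  mem_segment_iff_lin.2 ⟨_, ⟨div_nonneg (by linarith) (by linarith),
    (div_le_one (by linarith)).2 (by linarith)⟩, rfl⟩

theorem exists_atFst_snd (e : R3 × R3) (w : ℝ × ℝ) (a : ℝ) :
    ∃ u v : ℝ × ℝ, ∀ s : ℝ, (atFst e (s - a)).2 + w = u + s • v := by
  refine ⟨e.1.2 + w - ((a + e.1.1) / (e.2.1 - e.1.1)) • (e.2.2 - e.1.2),
    (1 / (e.2.1 - e.1.1)) • (e.2.2 - e.1.2), fun s => ?_⟩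
  ext <;> simp [atFst, lin] <;> ring

theorem convex_inDisk : Convex ℝ {p : ℝ × ℝ | inDisk p} := by
  rintro ⟨p1, p2⟩ hp ⟨q1, q2⟩ hq a b ha hb hab
  simp only [inDisk, mem_ofPred_eq, Prod.smul_mk, Prod.mk_add_mk, smul_eq_mul] at hp hq ⊢
  have hb' : b = 1 - a := by linarith
  subst hb'
  nlinarith [mul_nonneg (mul_nonneg ha hb) (add_nonneg (sq_nonneg (p1 - q1)) (sq_nonneg (p2 - q2))),
    mul_le_mul_of_nonneg_left hp ha, mul_le_mul_of_nonneg_left hq hb]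

theorem inDisk_of_mem_segment {a b x : R3} (w : ℝ × ℝ) (ha : inDisk (a.2 + w))
    (hb : inDisk (b.2 + w)) (hx : x ∈ segment ℝ a b) : inDisk (x.2 + w) := by
  obtain ⟨s, r, hs, hr, hsr, rfl⟩ := hx
  have := convex_inDisk ha hb hs hr hsr
  have e : (s • a + r • b).2 + w = s • (a.2 + w) + r • (b.2 + w) := by
    have : w = (s + r) • w := by rw [hsr, one_smul]
    conv_lhs => rw [this]
    simp only [Prod.snd_add, Prod.smul_snd, smul_add, add_smul]
    abel
  rw [e]; exact this

theorem basePt_injective (m : ℕ) : Function.Injective (basePt m) := fun i j h => by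
  have hm : (m:ℝ) + 1 ≠ 0 := by positivity
  simp only [basePt] at h
  field_simp at h
  have : (i : ℝ) = j := by linarith
  exact Fin.ext (by exact_mod_cast this)

/-- A forward graph joining the base points in the boundary of the solid cylinder is the image
of a geometric braid. -/
theorem FwdGraph.exists_geomBraid {G : Set (R3 × R3)} (h : FwdGraph G) {m : ℕ}
    (hD : ∀ v ∈ vts G, inDisk (v.2 + (2, 0)))
    (h1 : ∀ e ∈ G, e.1.1 = -1/2 → ∃ i, e.1 = arcEnd m i)
    (h2 : ∀ i, ∃ e ∈ G, e.1 = arcEnd m i)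
    (h3 : ∀ e ∈ G, e.2.1 = 1/2 → ∃ i, e.2 = tau (arcEnd m i)) :
    ∃ a : GeomBraid m, iota1 '' a.carrier = car G := by
  have hfst : ∀ i : Fin m, (arcEnd m i).1 = -1/2 := fun i => rfl
  have hinj : ∀ i j : Fin m, arcEnd m i = arcEnd m j → i = j := fun i j hij => by
    have := congrArg (fun p : R3 => p.2.1) hij
    simp only [arcEnd, sub_left_inj] at this
    exact basePt_injective m this
  have hIcc : ∀ {t : ℝ}, t ∈ Icc (0:ℝ) 1 → t - 1/2 ∈ Icc (-1/2:ℝ) (1/2) := fun ht =>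
    ⟨by linarith [ht.1], by linarith [ht.2]⟩
  have hex : ∀ (i : Fin m) (t : ℝ), ∃ e, Strand G (arcEnd m i) e ∧
      (t ∈ Icc (0:ℝ) 1 → e.1.1 ≤ t - 1/2 ∧ t - 1/2 ≤ e.2.1) := by
    intro i t
    by_cases ht : t ∈ Icc (0:ℝ) 1
    · obtain ⟨e, he, he'⟩ := h.exists_span (hfst i) (h2 i) (hIcc ht)
      exact ⟨e, he, fun _ => he'⟩
    · obtain ⟨e, he, hei⟩ := h2 i
      exact ⟨e, .start e he hei, fun h => absurd h ht⟩
  choose E hE hEx using hex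
  have hat : ∀ i, ∀ t ∈ Icc (0:ℝ) 1, atFst (E i t) (t - 1/2) ∈ segment ℝ (E i t).1 (E i t).2 :=
    fun i t ht => atFst_mem (h.fwd _ (hE i t).mem) (hEx i t ht).1 (hEx i t ht).2
  have hat1 : ∀ i t, (atFst (E i t) (t - 1/2)).1 = t - 1/2 :=
    fun i t => atFst_fst (h.fwd _ (hE i t).mem) _
  have huniq : ∀ i, ∀ t ∈ Icc (0:ℝ) 1, ∀ e, Strand G (arcEnd m i) e → ∀ p ∈ segment ℝ e.1 e.2,
      p.1 = t - 1/2 → p = atFst (E i t) (t - 1/2) := fun i t ht e he p hp hpt =>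
    h.strand_eq_of_fst_eq (hfst i) he (hE i t) hp (hat i t ht) (hpt.trans (hat1 i t).symm)
  have hdisj : ∀ t ∈ Icc (0:ℝ) 1, ∀ i j : Fin m, i ≠ j →
      (atFst (E i t) (t - 1/2)).2 + (2, 0) ≠ (atFst (E j t) (t - 1/2)).2 + (2, 0) := by
    intro t ht i j hij heq
    have hpq : atFst (E i t) (t - 1/2) = atFst (E j t) (t - 1/2) :=
      Prod.ext ((hat1 i t).trans (hat1 j t).symm) (add_right_cancel heq)
    have hi := hat i t ht
    have hj := hat j t ht
    rw [← hpq] at hj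
    have hEi := hE i t
    have hEj := hE j t
    have hne : ∀ e, Strand G (arcEnd m i) e → ¬ Strand G (arcEnd m j) e := fun e he he' =>
      hij (hinj i j (h.strand_unique (hfst i) (hfst j) he he'))
    have hee : E i t ≠ E j t := fun hh => hne _ hEi (hh ▸ hEj)
    obtain ⟨ha, hb⟩ := h.emb.emb _ hEi.mem _ hEj.mem hee _ hi hj
    rcases ha with ha | ha <;> rcases hb with hb | hb <;> rw [ha] at hb
    · exact hee (h.out _ hEi.mem _ hEj.mem hb)
    · exact hne _ hEi (.step _ _ hEj hEi.mem hb)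
    · exact hne _ (.step _ _ hEi hEj.mem hb.symm) hEj
    · exact hee (h.inn _ hEi.mem _ hEj.mem hb)
  have hfin : ∀ i, ∃ j, (atFst (E i 1) (1 - 1/2)) = tau (arcEnd m j) := by
    intro i
    have hm := (hE i 1).mem
    have h4 := (hEx i 1 (by norm_num)).2
    have h5 := h.hi _ hm
    have h6 : atFst (E i 1) (1 - 1/2) = (E i 1).2 := eq_right_of_fnl (fnl 1 0 0)
      (hat i 1 (by norm_num)) (by simpa [fnl_apply] using h.fwd _ hm)
      (by simp only [fnl_apply, hat1]; linarith)
    rw [h6]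
    exact h3 _ hm (by linarith)
  choose σ hσ using hfin
  have hσinj : Function.Injective σ := fun i j hij => by
    by_contra hne
    refine hdisj 1 (by norm_num) i j hne ?_
    rw [hσ, hσ, hij]
  let a : GeomBraid m :=
    { f := fun i t => (atFst (E i t) (t - 1/2)).2 + (2, 0)
      pl := fun i => by
        have hTf : ((fun v : R3 => v.1 + 1/2) '' vts G).Finite := by
          refine Set.Finite.image _ ?_
          refine ((h.emb.fin.image Prod.fst).union (h.emb.fin.image Prod.snd)).subset ?_
          rintro v ⟨e, he, rfl | rfl⟩
          · exact Or.inl ⟨e, he, rfl⟩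
          · exact Or.inr ⟨e, he, rfl⟩
        refine isPLPath_of_finite hTf fun c d hc hcd hd hT => ?_
        obtain ⟨u, v, huv⟩ := exists_atFst_snd (E i ((c + d) / 2)) (2, 0) (1/2)
        refine ⟨u, v, fun s hs => ?_⟩
        have hmid := hEx i ((c + d) / 2) ⟨by linarith, by linarith⟩
        have hm := (hE i ((c + d) / 2)).mem
        have ha : (E i ((c + d) / 2)).1.1 ≤ s - 1/2 := by
          rcases hT _ ⟨_, ⟨_, hm, Or.inl rfl⟩, rfl⟩ with h' | h'
          · linarith [hs.1]
          · simp only at h'; linarith [hmid.1]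
        have hb : s - 1/2 ≤ (E i ((c + d) / 2)).2.1 := by
          rcases hT _ ⟨_, ⟨_, hm, Or.inr rfl⟩, rfl⟩ with h' | h'
          · simp only at h'; linarith [hmid.2]
          · linarith [hs.2]
        rw [← huv, huniq i s ⟨by linarith [hs.1], by linarith [hs.2]⟩ _ (hE i ((c + d) / 2)) _
          (atFst_mem (h.fwd _ hm) ha hb) (atFst_fst (h.fwd _ hm) _)]
      disj := hdisj
      inD := fun i t ht => inDisk_of_mem_segment _ (hD _ ⟨_, (hE i t).mem, Or.inl rfl⟩)
        (hD _ ⟨_, (hE i t).mem, Or.inr rfl⟩) (hat i t ht)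
      start := fun i => by
        obtain ⟨e, he, hei⟩ := h2 i
        rw [← huniq i 0 (by norm_num) e (.start e he hei) e.1 (left_mem_segment ℝ _ _)
          (by rw [hei]; simp [arcEnd]; norm_num), hei]
        simp [arcEnd]
      finish := ⟨Equiv.ofBijective σ (Finite.injective_iff_bijective.1 hσinj), fun i => by
        rw [hσ]; simp [arcEnd, tau]⟩ }
  have hio : ∀ i t, iota1 (t, (a.f i t).1, (a.f i t).2) = atFst (E i t) (t - 1/2) :=
    fun i t => Prod.ext (hat1 i t).symm (by ext <;> simp [iota1, a])
  refine ⟨a, Subset.antisymm ?_ ?_⟩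
  · rintro _ ⟨_, ⟨i, t, ht, rfl⟩, rfl⟩
    rw [hio]
    exact mem_car.2 ⟨_, (hE i t).mem, hat i t ht⟩
  · intro p hp
    obtain ⟨e, he, hpe⟩ := mem_car.1 hp
    obtain ⟨v, hv, hs⟩ := h.exists_strand he
    have hvi : ∃ i, v = arcEnd m i := by
      clear hpe he
      induction hs with
      | start e he hev => rw [← hev] at hv ⊢; exact h1 e he hv
      | step _ _ _ _ _ ih => exact ih
    obtain ⟨i, rfl⟩ := hvi
    have hp1 : -1/2 ≤ p.1 ∧ p.1 ≤ 1/2 := by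
      have h4 := segment_fnl_le (fnl 1 0 0) hpe (k := 1/2)
        (by simp only [fnl_apply]; linarith [h.fwd e he, h.hi e he])
        (by simp only [fnl_apply]; linarith [h.hi e he])
      have h5 := segment_fnl_le (fnl (-1) 0 0) hpe (k := 1/2)
        (by simp only [fnl_apply]; linarith [h.lo e he])
        (by simp only [fnl_apply]; linarith [h.fwd e he, h.lo e he])
      simp only [fnl_apply] at h4 h5
      constructor <;> linarith
    have ht : p.1 + 1/2 ∈ Icc (0:ℝ) 1 := ⟨by linarith, by linarith⟩
    have := huniq i (p.1 + 1/2) ht e hs p hpe (by ring)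
    refine ⟨_, ⟨i, p.1 + 1/2, ht, rfl⟩, ?_⟩
    rw [hio, ← this]

theorem iota1_injective : Function.Injective iota1 := fun p q h => by
  simp only [iota1, Prod.mk.injEq] at h
  exact Prod.ext (by linarith [h.1]) (Prod.ext (by linarith [h.2.1]) h.2.2)

theorem iota1_rho (p : R3) : iota1 (rho p) = tau (iota1 p) := by
  simp only [iota1, rho, tau]
  ext <;> simp
  ring

theorem GeomBraid.symmetric_of_tauSym {m : ℕ} {a : GeomBraid m} {G : Set (R3 × R3)}
    {ι : R3 → R3} (hι : Function.Injective ι) (hr : ∀ p, ι (rho p) = tau (ι p))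
    (hG : TauSym G) (h : ι '' a.carrier = car G) : a.Symmetric := by
  have key : ∀ p ∈ a.carrier, rho p ∈ a.carrier := fun p hp => by
    have h1 : ι p ∈ car G := h ▸ mem_image_of_mem _ hp
    have h2 := hG.tau_mem_car h1
    rw [← hr, ← h] at h2
    exact hι.mem_set_image.1 h2
  refine Subset.antisymm (image_subset_iff.2 key) fun p hp => ⟨rho p, key p hp, ?_⟩
  apply hι
  rw [hr, hr, tau_tau]

/-- The vertices of the left half of the `i`-th outer strand during the final motion: `s` is the
parameter of the planar motion and `r` that of the flattening of the connecting arc. -/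
def halfPos {m : ℕ} (y h : Fin m → ℝ) (s r : ℝ) (i : Fin m) : Fin 6 → R3 :=
  ![(-1/4, y i, h i), (-1/2, (1 - s) * y i + s * (basePt m i - 2), (1 - r) * h i),
    (-1/2 + s / 12 * (basePt m i - 3/2), -1/2, (1 - r) * h i),
    (-1/2 + s / 12 * (basePt m i + 3/2), 1/2, (1 - r) * h i),
    (-1/2, 2 + s * basePt m i, (1 - r) * h i), (0, 2 + s * (m / (m + 1)), h i)]

/-- Positions and levels of the outer strands, ordered by decreasing absolute level. -/
structure Heights {m : ℕ} (y h : Fin m → ℝ) : Prop where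
  ylo : ∀ i, -5/2 < y i
  yhi : ∀ i, y i < -3/2
  inj : ∀ i j, h i = h j → i = j
  ne : ∀ i, h i ≠ 0
  anti : ∀ i j, i < j → |h j| ≤ |h i|

theorem basePt_lt {m : ℕ} (i : Fin m) : basePt m i < 1 := by
  have hm : (0:ℝ) < m + 1 := by positivity
  have hi : (i:ℝ) + 1 ≤ m := by exact_mod_cast i.2
  have : ((i:ℝ) + 1) / (m + 1) < 1 := by rw [div_lt_one hm]; linarith
  simp only [basePt]
  rw [mul_div_assoc]; linarith

theorem lt_basePt {m : ℕ} (i : Fin m) : -1 < basePt m i := by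
  have : (0:ℝ) < 2 * ((i:ℝ) + 1) / (m + 1) := by positivity
  simp only [basePt]; linarith

theorem basePt_le {m : ℕ} (i : Fin m) : basePt m i ≤ m / (m + 1) := by
  have hm : (0:ℝ) < m + 1 := by positivity
  have hi : (i:ℝ) + 1 ≤ m := by exact_mod_cast i.2
  simp only [basePt]
  rw [← sub_nonneg]
  have : (m:ℝ) / (m + 1) - (-1 + 2 * ((i:ℝ) + 1) / (m + 1)) = (2 * (m - (i + 1)) + 1) / (m + 1) := by
    field_simp; ring
  rw [this]
  apply div_nonneg <;> linarith

theorem lt_of_basePt_lt {m : ℕ} {i j : Fin m} (h : basePt m i < basePt m j) : i < j := by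
  by_contra hij
  have h1 : ((j:ℕ):ℝ) ≤ i := by exact_mod_cast not_lt.1 hij
  have : 2 * ((j:ℝ) + 1) / (m + 1) ≤ 2 * ((i:ℝ) + 1) / (m + 1) := by gcongr
  simp only [basePt] at h
  linarith

/-- The point with parameter `u` on the `a`-th edge of the left half of a strand. -/
def halfPt {m : ℕ} (y h : Fin m → ℝ) (s r : ℝ) (i : Fin m) (a : Fin 5) (u : ℝ) : R3 :=
  (1 - u) • halfPos y h s r i a.castSucc + u • halfPos y h s r i a.succ

section
variable {m : ℕ} {y h : Fin m → ℝ} {s r : ℝ}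

theorem halfPt_zero (y h : Fin m → ℝ) (s r : ℝ) (i : Fin m) (u : ℝ) : halfPt y h s r i 0 u =
    (-1/4 - u/4, (1 - u) * y i + u * ((1 - s) * y i + s * (basePt m i - 2)), (1 - r * u) * h i) := by
  ext <;> simp [halfPt, halfPos] <;> ring

theorem halfPt_one (y h : Fin m → ℝ) (s r : ℝ) (i : Fin m) (u : ℝ) : halfPt y h s r i 1 u =
    (-1/2 + u * (s / 12 * (basePt m i - 3/2)),
      (1 - u) * ((1 - s) * y i + s * (basePt m i - 2)) - u / 2, (1 - r) * h i) := by
  ext <;> simp [halfPt, halfPos] <;> ring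

theorem halfPt_two (y h : Fin m → ℝ) (s r : ℝ) (i : Fin m) (u : ℝ) : halfPt y h s r i 2 u =
    (-1/2 + s / 12 * (basePt m i + 3 * (u - 1/2)), u - 1/2, (1 - r) * h i) := by
  ext <;> simp [halfPt, halfPos] <;> ring

theorem halfPt_three (y h : Fin m → ℝ) (s r : ℝ) (i : Fin m) (u : ℝ) : halfPt y h s r i 3 u =
    (-1/2 + (1 - u) * (s / 12 * (basePt m i + 3/2)), (1 - u) / 2 + u * (2 + s * basePt m i),
      (1 - r) * h i) := by
  ext <;> simp [halfPt, halfPos] <;> ring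

theorem halfPt_four (y h : Fin m → ℝ) (s r : ℝ) (i : Fin m) (u : ℝ) : halfPt y h s r i 4 u =
    (-1/2 + u / 2, 2 + s * ((1 - u) * basePt m i + u * (m / (m + 1))), (1 - r + r * u) * h i) := by
  ext <;> simp [halfPt, halfPos] <;> ring

/-- The levels of the arc of strand `i` and of the top of strand `j` are compatible. -/
theorem Heights.arc_top (H : Heights y h) (hr : r ∈ Icc (0:ℝ) 1) {i j : Fin m} {u v : ℝ}
    (hu : u ∈ Icc (0:ℝ) 1) (hv : v ∈ Icc (0:ℝ) 1)
    (e : halfPt y h 1 r i 3 u = halfPt y h 1 r j 4 v) : i = j := by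
  have hb := basePt_le j
  rw [halfPt_three, halfPt_four, Prod.mk.injEq, Prod.mk.injEq] at e
  obtain ⟨hx, hy, hz⟩ := e
  have hbi := lt_basePt i
  have h1 : basePt m j ≤ basePt m i := by
    nlinarith [mul_nonneg hv.1 (sub_nonneg.2 hb), hu.1, hu.2,
      mul_nonneg (sub_nonneg.2 hu.2) (by linarith : (0:ℝ) ≤ 3/2 + basePt m i)]
  rcases h1.eq_or_lt with h1 | h1
  · exact (basePt_injective m h1).symm
  exfalso
  have h2 := H.anti j i (lt_of_basePt_lt h1)
  have h3 : (1 - r) * |h i| = (1 - r + r * v) * |h j| := by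
    have := congrArg abs hz
    rwa [abs_mul, abs_mul, abs_of_nonneg (sub_nonneg.2 hr.2),
      abs_of_nonneg (add_nonneg (sub_nonneg.2 hr.2) (mul_nonneg hr.1 hv.1))] at this
  have h4 : 0 < |h j| := abs_pos.2 (H.ne j)
  have h5 : r * v = 0 := by
    by_contra hne
    have h6 : 0 < r * v := lt_of_le_of_ne (mul_nonneg hr.1 hv.1) (Ne.symm hne)
    nlinarith [mul_le_mul_of_nonneg_left h2 (sub_nonneg.2 hr.2), mul_pos h6 h4]
  rcases mul_eq_zero.1 h5 with h6 | h6
  · subst h6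
    have := H.inj i j (by linarith)
    rw [this] at h1; exact lt_irrefl _ h1
  · subst h6
    have h7 : (1 - u) * (basePt m i + 3/2) = 0 := by linarith
    rcases mul_eq_zero.1 h7 with h8 | h8
    · have : u = 1 := by linarith
      subst this; linarith
    · linarith

set_option maxHeartbeats 1000000 in
theorem Heights.eq_of_le (H : Heights y h) (hs : s ∈ Icc (0:ℝ) 1) (hr : r ∈ Icc (0:ℝ) 1)
    (hsr : r = 0 ∨ s = 1) {i j : Fin m} {a b : Fin 5} (hab : a ≤ b) {u v : ℝ}
    (hu : u ∈ Icc (0:ℝ) 1) (hv : v ∈ Icc (0:ℝ) 1)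
    (e : halfPt y h s r i a u = halfPt y h s r j b v) :
    i = j ∧ ((a : ℕ) : ℝ) + u = ((b : ℕ) : ℝ) + v := by
  have hbi := lt_basePt i
  have hbj := lt_basePt j
  have hbi' := basePt_lt i
  have hbj' := basePt_lt j
  have hci := basePt_le i
  have hcj := basePt_le j
  have hyi := H.ylo i
  have hyj := H.ylo j
  have hyi' := H.yhi i
  have hyj' := H.yhi j
  obtain ⟨hs0, hs1⟩ := hs
  obtain ⟨hr0, hr1⟩ := hr
  obtain ⟨hu0, hu1⟩ := hu
  obtain ⟨hv0, hv1⟩ := hv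
  have hL : ∀ k : Fin m, (1 - s) * y k + s * (basePt m k - 2) < -1 := fun k => by
    have := H.yhi k; have := basePt_lt k
    nlinarith [mul_nonneg (sub_nonneg.2 hs1) (by linarith : (0:ℝ) ≤ -3/2 - y k),
      mul_nonneg hs0 (by linarith : (0:ℝ) ≤ 1 - basePt m k)]
  have hT : ∀ k : Fin m, 1 < 2 + s * basePt m k := fun k => by
    have := lt_basePt k
    nlinarith [mul_nonneg hs0 (by linarith : (0:ℝ) ≤ 1 + basePt m k)]
  -- the strands are separated by their levels before the flattening starts
  have hz0 : r = 0 → (1 - r) * h i = (1 - r) * h j → i = j := fun hr hz => by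
    rw [hr] at hz; exact H.inj i j (by linarith)
  have hbb : basePt m i = basePt m j → i = j := fun h => basePt_injective m h
  have hseg : ∀ {p q : ℝ}, p < q → (1 - u) * p + u * q = (1 - v) * p + v * q → u = v :=
    fun {p q} hpq h => by
      have : (u - v) * (q - p) = 0 := by linarith
      rcases mul_eq_zero.1 this with h | h <;> linarith
  have hlow : ∀ {w p : ℝ}, 0 ≤ w → w ≤ 1 → p < -1 → (1 - w) * p - w / 2 ≤ -1/2 := fun h0 h1 hp => by
    nlinarith
  have hlow' : ∀ {w p : ℝ}, 0 ≤ w → w ≤ 1 → p < -1 → -1/2 ≤ (1 - w) * p - w / 2 → w = 1 :=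
    fun h0 h1 hp hle => by nlinarith
  have hup : ∀ {w p : ℝ}, 0 ≤ w → w ≤ 1 → 1 < p → 1/2 ≤ (1 - w) / 2 + w * p := fun h0 h1 hp => by
    nlinarith
  have hup' : ∀ {w p : ℝ}, 0 ≤ w → w ≤ 1 → 1 < p → (1 - w) / 2 + w * p ≤ 1/2 → w = 0 :=
    fun h0 h1 hp hle => by nlinarith
  have hcol : ∀ {w p q : ℝ}, 0 ≤ w → w ≤ 1 → p < -1 → q < -1 → (1 - w) * p + w * q < -1/2 :=
    fun h0 h1 hp hq => by nlinarith
  have htop : ∀ (w : ℝ) (k : Fin m), 0 ≤ w → w ≤ 1 →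
      2 + s * basePt m k ≤ 2 + s * ((1 - w) * basePt m k + w * (m / (m + 1))) := fun w k h0 h1 => by
    have := basePt_le k
    have : 0 ≤ s * (w * (m / (m + 1) - basePt m k)) :=
      mul_nonneg hs0 (mul_nonneg h0 (by linarith))
    linarith
  have hi := hL i
  have hj := hL j
  have hi' := hT i
  have hj' := hT j
  fin_cases a <;> fin_cases b <;>
    simp only [Fin.zero_eta, Fin.mk_one, Fin.reduceFinMk, Fin.isValue, Fin.reduceLE] at hab e ⊢
  · rw [halfPt_zero, halfPt_zero, Prod.mk.injEq, Prod.mk.injEq] at e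
    obtain ⟨hx, hy, hz⟩ := e
    have huv : u = v := by linarith
    subst huv
    refine ⟨?_, rfl⟩
    by_cases hru : 1 - r * u = 0
    · have h1 : r = 1 := by nlinarith
      have h2 : u = 1 := by nlinarith
      rcases hsr with h3 | h3
      · linarith
      · subst h3 h2; exact hbb (by linarith)
    · exact H.inj i j (mul_left_cancel₀ hru hz)
  · rw [halfPt_zero, halfPt_one, Prod.mk.injEq, Prod.mk.injEq] at e
    obtain ⟨hx, hy, hz⟩ := e
    have h1 : 0 ≤ v * (s / 12 * (3/2 - basePt m j)) :=
      mul_nonneg hv0 (mul_nonneg (by linarith) (by linarith))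
    have h2 : u = 1 := by linarith
    subst h2
    have h3 : v * (s * (3/2 - basePt m j)) = 0 := by linarith
    have h4 : v * s = 0 := by
      rw [← mul_assoc] at h3
      rcases mul_eq_zero.1 h3 with h4 | h4
      · exact h4
      · linarith
    rcases hsr with h5 | h5
    · have hij : i = j := hz0 h5 (by linarith)
      subst hij
      refine ⟨rfl, ?_⟩
      have h6 : v * (-1/2 - ((1 - s) * y i + s * (basePt m i - 2))) = 0 := by linarith
      have h7 : v = 0 := by
        rcases mul_eq_zero.1 h6 with h7 | h7
        · exact h7
        · linarith
      simp [h7]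
    · subst h5
      have h6 : v = 0 := by linarith
      subst h6
      exact ⟨hbb (by linarith), by simp⟩
  · rw [halfPt_zero, halfPt_two, Prod.mk.injEq, Prod.mk.injEq] at e
    obtain ⟨hx, hy, hz⟩ := e
    linarith [hcol hu0 hu1 (by linarith : y i < -1) hi]
  · rw [halfPt_zero, halfPt_three, Prod.mk.injEq, Prod.mk.injEq] at e
    obtain ⟨hx, hy, hz⟩ := e
    linarith [hcol hu0 hu1 (by linarith : y i < -1) hi, hup hv0 hv1 hj']
  · rw [halfPt_zero, halfPt_four, Prod.mk.injEq, Prod.mk.injEq] at e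
    obtain ⟨hx, hy, hz⟩ := e
    linarith [hcol hu0 hu1 (by linarith : y i < -1) hi, htop v j hv0 hv1]
  · rw [halfPt_one, halfPt_one, Prod.mk.injEq, Prod.mk.injEq] at e
    obtain ⟨hx, hy, hz⟩ := e
    have hij : i = j := by
      rcases hsr with h5 | h5
      · exact hz0 h5 hz
      · subst h5; exact hbb (by linarith)
    subst hij
    exact ⟨rfl, by rw [hseg (hi.trans (by norm_num : (-1:ℝ) < -1/2)) (by linarith)]⟩
  · rw [halfPt_one, halfPt_two, Prod.mk.injEq, Prod.mk.injEq] at e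
    obtain ⟨hx, hy, hz⟩ := e
    have h1 : u = 1 := hlow' hu0 hu1 hi (by linarith)
    subst h1
    have h2 : v = 0 := by linarith
    subst h2
    refine ⟨?_, by simp; norm_num⟩
    rcases hsr with h5 | h5
    · exact hz0 h5 hz
    · subst h5; exact hbb (by linarith)
  · rw [halfPt_one, halfPt_three, Prod.mk.injEq, Prod.mk.injEq] at e
    obtain ⟨hx, hy, hz⟩ := e
    linarith [hlow hu0 hu1 hi, hup hv0 hv1 hj']
  · rw [halfPt_one, halfPt_four, Prod.mk.injEq, Prod.mk.injEq] at e
    obtain ⟨hx, hy, hz⟩ := e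
    linarith [hlow hu0 hu1 hi, htop v j hv0 hv1]
  · rw [halfPt_two, halfPt_two, Prod.mk.injEq, Prod.mk.injEq] at e
    obtain ⟨hx, hy, hz⟩ := e
    have huv : u = v := by linarith
    subst huv
    refine ⟨?_, rfl⟩
    rcases hsr with h5 | h5
    · exact hz0 h5 hz
    · subst h5; exact hbb (by linarith)
  · rw [halfPt_two, halfPt_three, Prod.mk.injEq, Prod.mk.injEq] at e
    obtain ⟨hx, hy, hz⟩ := e
    have h1 : v = 0 := hup' hv0 hv1 hj' (by linarith)
    subst h1
    have h2 : u = 1 := by linarith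
    subst h2
    refine ⟨?_, by simp; norm_num⟩
    rcases hsr with h5 | h5
    · exact hz0 h5 hz
    · subst h5; exact hbb (by linarith)
  · rw [halfPt_two, halfPt_four, Prod.mk.injEq, Prod.mk.injEq] at e
    obtain ⟨hx, hy, hz⟩ := e
    linarith [htop v j hv0 hv1]
  · rw [halfPt_three, halfPt_three, Prod.mk.injEq, Prod.mk.injEq] at e
    obtain ⟨hx, hy, hz⟩ := e
    have hij : i = j := by
      rcases hsr with h5 | h5
      · exact hz0 h5 hz
      · subst h5; exact hbb (by linarith)
    subst hij
    exact ⟨rfl, by rw [hseg ((by norm_num : (1/2:ℝ) < 1).trans hi') (by linarith)]⟩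
  · have hij : i = j := by
      rcases hsr with h5 | h5
      · rw [halfPt_three, halfPt_four, Prod.mk.injEq, Prod.mk.injEq] at e
        refine hz0 h5 (e.2.2.trans ?_)
        rw [h5]; ring
      · subst h5; exact H.arc_top ⟨hr0, hr1⟩ ⟨hu0, hu1⟩ ⟨hv0, hv1⟩ e
    rw [halfPt_three, halfPt_four, Prod.mk.injEq, Prod.mk.injEq] at e
    obtain ⟨hx, hy, hz⟩ := e
    subst hij
    have h1 := htop v i hv0 hv1
    have h2 : (1 - u) * (2 + s * basePt m i - 1/2) ≤ 0 := by linarith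
    have h3 : u = 1 := by nlinarith
    subst h3
    exact ⟨rfl, by simp; linarith⟩
  · rw [halfPt_four, halfPt_four, Prod.mk.injEq, Prod.mk.injEq] at e
    obtain ⟨hx, hy, hz⟩ := e
    have huv : u = v := by linarith
    subst huv
    refine ⟨?_, rfl⟩
    by_cases hru : 1 - r + r * u = 0
    · have h1 : r = 1 := by nlinarith
      have h2 : u = 0 := by nlinarith
      rcases hsr with h3 | h3
      · linarith
      · subst h3 h2; exact hbb (by linarith)
    · exact H.inj i j (mul_left_cancel₀ hru hz)
end

section
variable {m : ℕ} {y h : Fin m → ℝ} {s r : ℝ}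

/-- The left halves of the outer strands. -/
def halves (y h : Fin m → ℝ) (s r : ℝ) : Set (R3 × R3) :=
  range fun p : Fin m × Fin 5 => (halfPos y h s r p.1 p.2.succ, halfPos y h s r p.1 p.2.castSucc)

theorem halfPt_left (i : Fin m) (a : Fin 5) :
    halfPt y h s r i a 0 = halfPos y h s r i a.castSucc := by simp [halfPt]

theorem halfPt_right (i : Fin m) (a : Fin 5) :
    halfPt y h s r i a 1 = halfPos y h s r i a.succ := by simp [halfPt]

theorem mem_segment_halfPos {i : Fin m} {a : Fin 5} {x : R3}
    (hx : x ∈ segment ℝ (halfPos y h s r i a.succ) (halfPos y h s r i a.castSucc)) :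
    ∃ u ∈ Icc (0:ℝ) 1, halfPt y h s r i a u = x := by
  rw [segment_symm, segment_eq_image] at hx
  exact hx

theorem Heights.eq_of_eq (H : Heights y h) (hs : s ∈ Icc (0:ℝ) 1) (hr : r ∈ Icc (0:ℝ) 1)
    (hsr : r = 0 ∨ s = 1) {i j : Fin m} {a b : Fin 5} {u v : ℝ}
    (hu : u ∈ Icc (0:ℝ) 1) (hv : v ∈ Icc (0:ℝ) 1)
    (e : halfPt y h s r i a u = halfPt y h s r j b v) :
    i = j ∧ ((a : ℕ) : ℝ) + u = ((b : ℕ) : ℝ) + v := by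
  rcases le_total a b with hab | hab
  · exact H.eq_of_le hs hr hsr hab hu hv e
  · have := H.eq_of_le hs hr hsr hab hv hu e.symm
    exact ⟨this.1.symm, this.2.symm⟩

theorem Heights.halfPos_injective (H : Heights y h) (hs : s ∈ Icc (0:ℝ) 1)
    (hr : r ∈ Icc (0:ℝ) 1) (hsr : r = 0 ∨ s = 1) {i j : Fin m} {a b : Fin 6}
    (e : halfPos y h s r i a = halfPos y h s r j b) : i = j ∧ a = b := by
  have key : ∀ (i : Fin m) (a : Fin 6), ∃ (a' : Fin 5) (u : ℝ), u ∈ Icc (0:ℝ) 1 ∧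
      halfPos y h s r i a = halfPt y h s r i a' u ∧ ((a : ℕ) : ℝ) = ((a' : ℕ) : ℝ) + u := by
    intro i a
    refine Fin.lastCases ?_ (fun a => ?_) a
    · exact ⟨4, 1, by norm_num, (halfPt_right i 4).symm, by simp; norm_num⟩
    · exact ⟨a, 0, by norm_num, (halfPt_left i a).symm, by simp⟩
  obtain ⟨a', u, hu, ha, hau⟩ := key i a
  obtain ⟨b', v, hv, hb, hbv⟩ := key j b
  obtain ⟨h1, h2⟩ := H.eq_of_eq hs hr hsr hu hv (ha ▸ hb ▸ e)
  refine ⟨h1, Fin.ext ?_⟩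
  rw [← hau, ← hbv] at h2
  exact_mod_cast h2

theorem Heights.emb_halves (H : Heights y h) (hs : s ∈ Icc (0:ℝ) 1)
    (hr : r ∈ Icc (0:ℝ) 1) (hsr : r = 0 ∨ s = 1) : Emb (halves y h s r) where
  fin := finite_range _
  ne := by
    rintro _ ⟨⟨i, a⟩, rfl⟩ he
    have := (H.halfPos_injective (i := i) (j := i) (a := a.succ) (b := a.castSucc) hs hr hsr he).2
    exact absurd this (Fin.castSucc_lt_succ).ne'
  emb := by
    have key : ∀ {a b : Fin 5} {u v : ℝ}, a < b → u ∈ Icc (0:ℝ) 1 → v ∈ Icc (0:ℝ) 1 →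
        ((a : ℕ) : ℝ) + u = ((b : ℕ) : ℝ) + v → u = 1 ∧ v = 0 := by
      intro a b u v hab hu hv h
      have : ((a : ℕ) : ℝ) + 1 ≤ ((b : ℕ) : ℝ) := by exact_mod_cast hab
      constructor <;> linarith [hu.2, hv.1]
    rintro _ ⟨⟨i, a⟩, rfl⟩ _ ⟨⟨j, b⟩, rfl⟩ hne x hx hx'
    obtain ⟨u, hu, rfl⟩ := mem_segment_halfPos hx
    obtain ⟨v, hv, hxv⟩ := mem_segment_halfPos hx'
    obtain ⟨rfl, h2⟩ := H.eq_of_eq hs hr hsr hu hv hxv.symm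
    rcases lt_trichotomy a b with hab | rfl | hab
    · obtain ⟨rfl, rfl⟩ := key hab hu hv h2
      exact ⟨Or.inl (halfPt_right i a), Or.inr (by rw [← hxv]; exact halfPt_left i b)⟩
    · exact absurd rfl hne
    · obtain ⟨rfl, rfl⟩ := key hab hv hu h2.symm
      exact ⟨Or.inr (halfPt_left i a), Or.inl (by rw [← hxv]; exact halfPt_right i b)⟩

theorem halfPt_region (y h : Fin m → ℝ) (r : ℝ) (hs : s ∈ Icc (0:ℝ) 1) (i : Fin m) (a : Fin 5)
    {u : ℝ} (hu : u ∈ Icc (0:ℝ) 1) :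
    ((halfPt y h s r i a u).1 < -1/4 ∨ a = 0 ∧ u = 0) ∨
    (a = 4 ∧ 1 < (halfPt y h s r i a u).2.1 ∧ (halfPt y h s r i a u).1 ≤ 0 ∧
      ((halfPt y h s r i a u).1 = 0 → u = 1)) := by
  have hb := basePt_lt i
  have hb' := lt_basePt i
  have hc := basePt_le i
  obtain ⟨hs0, hs1⟩ := hs
  obtain ⟨hu0, hu1⟩ := hu
  have h12 : ∀ {w p : ℝ}, 0 ≤ w → w ≤ 1 → p < 5/2 → -1/2 + w * (s / 12 * p) < -1/4 :=
    fun {w p} h0 h1 hp => by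
      have h2 : 0 ≤ w * (s * (5/2 - p)) := mul_nonneg h0 (mul_nonneg hs0 (by linarith))
      have h3 : w * s ≤ 1 := mul_le_one₀ h1 hs0 hs1
      linarith
  fin_cases a
  · simp only [Fin.zero_eta, halfPt_zero]
    rcases hu0.eq_or_lt with h | h
    · exact Or.inl (Or.inr ⟨trivial, h.symm⟩)
    · exact Or.inl (Or.inl (by linarith))
  · simp only [Fin.mk_one, halfPt_one]
    exact Or.inl (Or.inl (h12 hu0 hu1 (by linarith)))
  · simp only [Fin.reduceFinMk, halfPt_two]
    have := h12 zero_le_one le_rfl (by linarith : basePt m i + 3 * (u - 1/2) < 5/2)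
    exact Or.inl (Or.inl (by linarith))
  · simp only [Fin.reduceFinMk, halfPt_three]
    exact Or.inl (Or.inl (h12 (by linarith) (by linarith) (by linarith)))
  · simp only [Fin.reduceFinMk, halfPt_four]
    refine Or.inr ⟨trivial, ?_, by linarith, fun h => by linarith⟩
    have h1 : 0 ≤ s * (u * (m / (m + 1) - basePt m i)) :=
      mul_nonneg hs0 (mul_nonneg hu0 (by linarith))
    nlinarith [mul_nonneg hs0 (by linarith : (0:ℝ) ≤ 1 + basePt m i)]

/-- The inner part of a link whose edges all run forward, together with the data of the outer
strands. -/
structure InnerPart (y h : Fin m → ℝ) (I : Set (R3 × R3)) : Prop where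
  hts : Heights y h
  pair : ∀ i, ∃ j, y j = y i ∧ h j = -h i
  hle : ∀ i, |h i| ≤ 1 / (m + 1)
  emb : Emb I
  sym : TauSym I
  fwd : ∀ e ∈ I, e.1.1 < e.2.1
  vx : ∀ v ∈ vts I, |v.1| ≤ 1/4
  vy : ∀ v ∈ vts I, -5/2 < v.2.1 ∧ v.2.1 < -3/2
  vz : ∀ v ∈ vts I, |v.2.2| ≤ 1/2
  out : ∀ e ∈ I, ∀ f ∈ I, e.1 = f.1 → e = f
  next : ∀ e ∈ I, (∃ f ∈ I, f.1 = e.2) ∨ ∃ i, e.2 = (1/4, y i, h i)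
  start : ∀ i, ∃ e ∈ I, e.1 = (-1/4, y i, h i)

variable {I : Set (R3 × R3)}

theorem InnerPart.meet (hI : InnerPart y h I) (hs : s ∈ Icc (0:ℝ) 1) {e f : R3 × R3} (he : e ∈ I)
    (hf : f ∈ halves y h s r) : Meet e f := by
  obtain ⟨⟨i, a⟩, rfl⟩ := hf
  intro x hx hx'
  obtain ⟨u, hu, rfl⟩ := mem_segment_halfPos hx'
  have h1 := abs_le.1 (hI.vx e.1 ⟨e, he, Or.inl rfl⟩)
  have h2 := abs_le.1 (hI.vx e.2 ⟨e, he, Or.inr rfl⟩)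
  have h3 := hI.vy e.1 ⟨e, he, Or.inl rfl⟩
  have h4 := hI.vy e.2 ⟨e, he, Or.inr rfl⟩
  have hlo := segment_fnl_le (fnl (-1) 0 0) hx (k := 1/4)
    (by simp only [fnl_apply]; linarith) (by simp only [fnl_apply]; linarith)
  have hup := segment_fnl_le (fnl 0 1 0) hx (k := 0)
    (by simp only [fnl_apply]; linarith) (by simp only [fnl_apply]; linarith)
  simp only [fnl_apply] at hlo hup
  rcases halfPt_region y h r hs i a hu with (h5 | ⟨rfl, rfl⟩) | ⟨-, h5, -⟩
  · linarith
  · refine ⟨Or.inl ?_, Or.inr (halfPt_left i 0)⟩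
    refine eq_left_of_fnl (fnl (-1) 0 0) hx ?_ ?_
    · simp only [fnl_apply]; linarith [hI.fwd e he]
    · simp only [fnl_apply, halfPt_zero]; linarith
  · linarith

theorem InnerPart.emb_union (hI : InnerPart y h I) (hs : s ∈ Icc (0:ℝ) 1)
    (hr : r ∈ Icc (0:ℝ) 1) (hsr : r = 0 ∨ s = 1) : Emb (I ∪ dbl (halves y h s r)) := by
  refine hI.emb.union ((hI.hts.emb_halves hs hr hsr).dbl ?_) ?_
  · rintro _ ⟨⟨i, a⟩, rfl⟩ _ ⟨⟨j, b⟩, rfl⟩ x hx hx'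
    have hx'' := mem_segment_rv.1 hx'
    obtain ⟨u, hu, rfl⟩ := mem_segment_halfPos hx
    obtain ⟨v, hv, hxv⟩ := mem_segment_halfPos hx''
    have h1 : (halfPt y h s r j b v).1 = -(halfPt y h s r i a u).1 := by rw [hxv]; rfl
    have hm : (0:Fin 5) ≠ 4 := by decide
    have hc0 : ∀ k, (halfPt y h s r k 0 0).1 = -1/4 := fun k => by rw [halfPt_zero]; norm_num
    have key : ∀ k c w, w ∈ Icc (0:ℝ) 1 → (halfPt y h s r k c w).1 < 0 ∨
        c = 4 ∧ (halfPt y h s r k c w).1 = 0 ∧ w = 1 := by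
      intro k c w hw
      rcases halfPt_region y h r hs k c hw with (h5 | ⟨rfl, rfl⟩) | ⟨h5, -, h6, h7⟩
      · exact Or.inl (by linarith)
      · exact Or.inl (by rw [hc0]; norm_num)
      · rcases h6.lt_or_eq with h6 | h6
        · exact Or.inl h6
        · exact Or.inr ⟨h5, h6, h7 h6⟩
    rcases key i a u hu with h2 | ⟨rfl, h2, rfl⟩ <;>
      rcases key j b v hv with h3 | ⟨rfl, h3, rfl⟩ <;> try linarith
    refine ⟨Or.inl (halfPt_right i 4), Or.inr ?_⟩
    rw [halfPt_right j 4] at hxv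
    exact (tau_eq_iff.1 hxv.symm)
  · intro e he f hf
    rcases mem_dbl.1 hf with hf | hf
    · exact hI.meet hs he hf
    · have := (hI.meet hs (hI.sym e he) hf).rv
      rw [rv_rv] at this
      change Meet (rv (rv e)) f at this
      rwa [rv_rv] at this
end

/-- The vertices of the link during the final motion. -/
inductive Vtx (m : ℕ) : Type
  | base (v : R3)
  | lft (i : Fin m) (a : Fin 4)
  | rgt (i : Fin m) (a : Fin 4)
  | mid (i : Fin m)

namespace Vtx
variable {m : ℕ}

/-- The involution on vertices, where `p` pairs the strands. -/
def inv (p : Fin m → Fin m) : Vtx m → Vtx m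
  | base v => base (tau v)
  | lft i a => rgt i a
  | rgt i a => lft i a
  | mid i => mid (p i)

theorem inv_inv {p : Fin m → Fin m} (hp : ∀ i, p (p i) = i) (v : Vtx m) :
    inv p (inv p v) = v := by
  cases v <;> simp [inv, hp, tau_tau]

/-- The position of a vertex. -/
def pos (y h : Fin m → ℝ) (s r : ℝ) : Vtx m → R3
  | base v => v
  | lft i a => halfPos y h s r i a.succ.castSucc
  | rgt i a => tau (halfPos y h s r i a.succ.castSucc)
  | mid i => halfPos y h s r i 5

/-- The vertices of the left half of a strand. -/
def strand (y h : Fin m → ℝ) (i : Fin m) : Fin 6 → Vtx m :=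
  ![base (-1/4, y i, h i), lft i 0, lft i 1, lft i 2, lft i 3, mid i]

theorem pos_strand (y h : Fin m → ℝ) (s r : ℝ) (i : Fin m) (a : Fin 6) :
    pos y h s r (strand y h i a) = halfPos y h s r i a := by
  fin_cases a <;> rfl

theorem pos_inv {y h : Fin m → ℝ} {p : Fin m → Fin m} (hp : ∀ i, h (p i) = -h i) (s r : ℝ)
    (v : Vtx m) : pos y h s r (inv p v) = tau (pos y h s r v) := by
  cases v with
  | base v => rfl
  | lft i a => rfl
  | rgt i a => exact (tau_tau _).symm
  | mid i => simp [pos, inv, halfPos, tau, hp]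

/-- The edges of the link. -/
def edges (y h : Fin m → ℝ) (p : Fin m → Fin m) (I : Set (R3 × R3)) : Set (Vtx m × Vtx m) :=
  {e | (∃ f ∈ I, e = (base f.1, base f.2)) ∨
    ∃ (i : Fin m) (a : Fin 5), e = (strand y h i a.succ, strand y h i a.castSucc) ∨
      e = (inv p (strand y h i a.castSucc), inv p (strand y h i a.succ))}

theorem imgE_edges {y h : Fin m → ℝ} {p : Fin m → Fin m} (hp : ∀ i, h (p i) = -h i) (s r : ℝ)
    (I : Set (R3 × R3)) :
    imgE (pos y h s r) (edges y h p I) = I ∪ dbl (halves y h s r) := by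
  ext e
  constructor
  · rintro ⟨_, ⟨f, hf, rfl⟩ | ⟨i, a, rfl | rfl⟩, rfl⟩
    · exact Or.inl hf
    · refine Or.inr (Or.inl ⟨(i, a), ?_⟩)
      simp [pos_strand]
    · refine Or.inr (Or.inr ⟨_, ⟨(i, a), rfl⟩, ?_⟩)
      simp [pos_strand, pos_inv hp, rv]
  · rintro (he | ⟨⟨i, a⟩, rfl⟩ | ⟨_, ⟨⟨i, a⟩, rfl⟩, rfl⟩)
    · exact ⟨(base e.1, base e.2), Or.inl ⟨e, he, rfl⟩, rfl⟩
    · exact ⟨_, Or.inr ⟨i, a, Or.inl rfl⟩, by simp [pos_strand]⟩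
    · exact ⟨_, Or.inr ⟨i, a, Or.inr rfl⟩, by simp [pos_strand, pos_inv hp, rv]⟩

theorem inv_mem_edges {y h : Fin m → ℝ} {p : Fin m → Fin m} (hp : ∀ i, p (p i) = i)
    {I : Set (R3 × R3)} (hI : TauSym I) {e : Vtx m × Vtx m} (he : e ∈ edges y h p I) :
    (inv p e.2, inv p e.1) ∈ edges y h p I := by
  rcases he with ⟨f, hf, rfl⟩ | ⟨i, a, rfl | rfl⟩
  · exact Or.inl ⟨_, hI f hf, rfl⟩
  · exact Or.inr ⟨i, a, Or.inr rfl⟩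
  · exact Or.inr ⟨i, a, Or.inl (by simp [inv_inv hp])⟩

/-- Base vertices occurring in the link are the vertices of the inner part and the endpoints of
the outer strands. -/
theorem base_of_mem_edges {y h : Fin m → ℝ} {p : Fin m → Fin m} {I : Set (R3 × R3)}
    (hI : InnerPart y h I) {v : R3}
    (hv : ∃ e ∈ edges y h p I, base v = e.1 ∨ base v = e.2) : |v.1| ≤ 1/4 ∧ v.2.1 < -3/2 := by
  have key : ∀ i a, base v = strand y h i a → |v.1| ≤ 1/4 ∧ v.2.1 < -3/2 := by
    intro i a hva
    have hy := hI.hts.yhi i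
    fin_cases a <;> simp [strand] at hva
    subst hva
    exact ⟨by norm_num [abs_le], hy⟩
  have key' : ∀ i a, base v = inv p (strand y h i a) → |v.1| ≤ 1/4 ∧ v.2.1 < -3/2 := by
    intro i a hva
    have hy := hI.hts.yhi i
    fin_cases a <;> simp [strand, inv] at hva
    subst hva
    exact ⟨by norm_num [abs_le, tau], hy⟩
  obtain ⟨_, ⟨f, hf, rfl⟩ | ⟨i, a, rfl | rfl⟩, hv | hv⟩ := hv
  · have := base.inj hv
    subst this
    exact ⟨hI.vx _ ⟨f, hf, Or.inl rfl⟩, (hI.vy _ ⟨f, hf, Or.inl rfl⟩).2⟩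
  · have := base.inj hv
    subst this
    exact ⟨hI.vx _ ⟨f, hf, Or.inr rfl⟩, (hI.vy _ ⟨f, hf, Or.inr rfl⟩).2⟩
  · exact key i a.succ hv
  · exact key i a.castSucc hv
  · exact key' i a.castSucc hv
  · exact key' i a.succ hv

theorem halfPos_lt (y h : Fin m → ℝ) (r : ℝ) {s : ℝ} (hs : s ∈ Icc (0:ℝ) 1) (i : Fin m)
    (a : Fin 4) : (halfPos y h s r i a.succ.castSucc).1 < -1/4 := by
  have hb := basePt_lt i
  have : ∀ q : ℝ, q < 3 → -1/2 + s / 12 * q < -1/4 := fun q hq => by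
    nlinarith [hs.1, hs.2, mul_nonneg hs.1 (by linarith : 0 ≤ 3 - q)]
  fin_cases a
  · simp [halfPos]; norm_num
  · simpa [halfPos] using this _ (by linarith)
  · simpa [halfPos] using this _ (by linarith)
  · simp [halfPos]; norm_num

theorem pos_injOn {y h : Fin m → ℝ} {p : Fin m → Fin m} {I : Set (R3 × R3)}
    (hI : InnerPart y h I) {s r : ℝ} (hs : s ∈ Icc (0:ℝ) 1) (hr : r ∈ Icc (0:ℝ) 1)
    (hsr : r = 0 ∨ s = 1) :
    InjOn (pos y h s r) {v | ∃ e ∈ edges y h p I, v = e.1 ∨ v = e.2} := by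
  have hinj := fun {i j : Fin m} {a b : Fin 6} =>
    hI.hts.halfPos_injective hs hr hsr (i := i) (j := j) (a := a) (b := b)
  have hlt := halfPos_lt y h r hs
  have hmid : ∀ i : Fin m, (halfPos y h s r i 5).1 = 0 ∧ 0 ≤ (halfPos y h s r i 5).2.1 :=
    fun i => ⟨rfl, by
      change (0:ℝ) ≤ 2 + s * (m / (m + 1))
      have := hs.1
      positivity⟩
  have hbase := fun {v : R3} => base_of_mem_edges (p := p) hI (v := v)
  have hfin : ∀ a b : Fin 4, a.succ.castSucc = b.succ.castSucc → a = b := by decide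
  intro v hv w hw e
  cases v with
  | base v =>
    obtain ⟨h1, h2⟩ := hbase hv
    rw [abs_le] at h1
    cases w with
    | base w => exact congrArg base e
    | lft j b => have := hlt j b; simp only [pos] at e; rw [← e] at this; linarith
    | rgt j b =>
      have := hlt j b
      simp only [pos, ← tau_eq_iff (p := v)] at e
      rw [← e] at this; simp only [tau] at this; linarith
    | mid j => have := hmid j; simp only [pos] at e; rw [← e] at this; linarith [this.2]
  | lft i a =>
    have ha := hlt i a
    cases w with
    | base w =>
      have := abs_le.1 (hbase hw).1
      simp only [pos] at e; rw [e] at ha; linarith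
    | lft j b =>
      obtain ⟨rfl, h2⟩ := hinj e
      rw [hfin a b h2]
    | rgt j b =>
      have := hlt j b
      simp only [pos] at e; rw [e] at ha; simp only [tau] at ha; linarith
    | mid j =>
      have := hmid j
      simp only [pos] at e; rw [e] at ha; linarith
  | rgt i a =>
    have ha := hlt i a
    cases w with
    | base w =>
      have := abs_le.1 (hbase hw).1
      simp only [pos, tau_eq_iff] at e; rw [e] at ha; simp only [tau] at ha; linarith
    | lft j b =>
      have := hlt j b
      simp only [pos, tau_eq_iff] at e; rw [e] at ha; simp only [tau] at ha; linarith
    | rgt j b =>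
      obtain ⟨rfl, h2⟩ := hinj (tau_injective e)
      rw [hfin a b h2]
    | mid j =>
      have := hmid j
      simp only [pos, tau_eq_iff] at e; rw [e] at ha; simp only [tau] at ha; linarith
  | mid i =>
    have ha := hmid i
    cases w with
    | base w =>
      have := hbase hw
      simp only [pos] at e; rw [e] at ha; linarith [ha.2]
    | lft j b =>
      have := hlt j b
      simp only [pos] at e; rw [e] at ha; linarith
    | rgt j b =>
      have := hlt j b
      simp only [pos] at e; rw [e] at ha; simp only [tau] at ha; linarith
    | mid j =>
      obtain ⟨rfl, -⟩ := hinj e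
      rfl

theorem continuous_pos (y h : Fin m → ℝ) {s r : ℝ → ℝ} (hs : Continuous s) (hr : Continuous r)
    (v : Vtx m) : Continuous fun t => pos y h (s t) (r t) v := by
  have key : ∀ (i : Fin m) (a : Fin 6), Continuous fun t => halfPos y h (s t) (r t) i a := by
    intro i a
    fin_cases a <;> simp [halfPos] <;> refine ⟨?_, ?_, ?_⟩ <;> fun_prop
  cases v with
  | base v => exact continuous_const
  | lft i a => exact key _ _
  | rgt i a => exact continuous_tau.comp (key _ _)
  | mid i => exact key _ _

end Vtx

section
variable {m : ℕ} {y h : Fin m → ℝ} {I : Set (R3 × R3)}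

/-- The pairing of the strands by the involution. -/
theorem InnerPart.exists_pairing (hI : InnerPart y h I) :
    ∃ p : Fin m → Fin m, (∀ i, p (p i) = i) ∧ (∀ i, y (p i) = y i) ∧ ∀ i, h (p i) = -h i := by
  choose p hp using hI.pair
  refine ⟨p, fun i => hI.hts.inj _ _ ?_, fun i => (hp i).1, fun i => (hp i).2⟩
  rw [(hp _).2, (hp i).2, neg_neg]

theorem InnerPart.equivIsotopic (hI : InnerPart y h I) :
    EquivIsotopicSets (car (I ∪ dbl (halves y h 0 0))) (car (I ∪ dbl (halves y h 1 1))) := by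
  obtain ⟨p, hp, -, hph⟩ := hI.exists_pairing
  have hmem : ∀ t, clamp t ∈ Icc (0:ℝ) 1 := fun t => ⟨clamp_nonneg t, clamp_le_one t⟩
  have hsr : ∀ t : ℝ, clamp (2 * t - 1) = 0 ∨ clamp (2 * t) = 1 := by
    intro t
    rcases le_total (2 * t) 1 with ht | ht
    · left; simp only [clamp]; rw [min_eq_left (by linarith), max_eq_left (by linarith)]
    · right; simp only [clamp]; rw [min_eq_right ht, max_eq_right zero_le_one]
  have key := equivIsotopic_of_family (Vtx.inv p) (Vtx.edges y h p I)
    (fun t => Vtx.pos y h (clamp (2 * t)) (clamp (2 * t - 1)))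
    (fun e he => Vtx.inv_mem_edges hp hI.sym he)
    (Vtx.continuous_pos y h (continuous_clamp.comp (by fun_prop))
      (continuous_clamp.comp (by fun_prop)))
    (fun t => Vtx.pos_inv hph _ _)
    (fun t _ => Vtx.pos_injOn hI (hmem _) (hmem _) (hsr t))
    (fun t _ => by
      rw [Vtx.imgE_edges hph]
      exact hI.emb_union (hmem _) (hmem _) (hsr t))
  simp only [Vtx.imgE_edges hph] at key
  norm_num [clamp] at key
  exact key
end

theorem mem_segment_vertical {a b b₀ b₁ c : ℝ} (h0 : b ≤ b₀) (h1 : b₁ ≤ b) (h : b₁ < b₀) :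
    ((a, b, c) : R3) ∈ segment ℝ ((a, b₀, c) : R3) (a, b₁, c) := by
  have hd : b₀ - b₁ ≠ 0 := by linarith
  refine ⟨(b - b₁) / (b₀ - b₁), (b₀ - b) / (b₀ - b₁), div_nonneg (by linarith) (by linarith),
    div_nonneg (by linarith) (by linarith), by field_simp; ring, ?_⟩
  ext <;> simp <;> field_simp <;> ring

theorem tau_mem_segment_iff {a b x : R3} :
    tau x ∈ segment ℝ a b ↔ x ∈ segment ℝ (tau a) (tau b) :=
  ⟨fun h => by simpa [tau_tau] using tau_mem_segment h,
    fun h => by simpa [tau_tau] using tau_mem_segment h⟩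

/-- The left half of an outer arc. -/
def leftArc (y h : ℝ) : Set R3 :=
  segment ℝ ((-1/2, y, h) : R3) (-1/4, y, h) ∪ segment ℝ ((-1/2, 2, h) : R3) (-1/2, y, h) ∪
    segment ℝ ((0, 2, h) : R3) (-1/2, 2, h)

theorem mem_car_outer {y h : ℝ} {x : R3} :
    x ∈ car (outer y h) ↔ x ∈ leftArc y h ∨ tau x ∈ leftArc y (-h) := by
  have h1 : segment ℝ ((1/2, 2, h) : R3) (-1/2, 2, h) =
      segment ℝ ((1/2, 2, h) : R3) (0, 2, h) ∪ segment ℝ ((0, 2, h) : R3) (-1/2, 2, h) :=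
    (segment_union_of_mem ⟨1/2, 1/2, by norm_num, by norm_num, by norm_num, by
      ext <;> simp <;> ring⟩).symm
  have h2 : segment ℝ (tau (-1/2, y, -h)) (tau (-1/4, y, -h)) =
      segment ℝ ((1/4, y, h) : R3) (1/2, y, h) := by
    rw [segment_symm]; norm_num [tau]
  have h3 : segment ℝ (tau (-1/2, 2, -h)) (tau (-1/2, y, -h)) =
      segment ℝ ((1/2, y, h) : R3) (1/2, 2, h) := by
    rw [segment_symm]; norm_num [tau]
  have h4 : segment ℝ (tau (0, 2, -h)) (tau (-1/2, 2, -h)) =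
      segment ℝ ((1/2, 2, h) : R3) (0, 2, h) := by
    rw [segment_symm]; norm_num [tau]
  simp only [outer, car_insert, car_singleton, leftArc, mem_union, tau_mem_segment_iff, h1, h2, h3,
    h4]
  tauto

section
variable {m : ℕ} {y h : Fin m → ℝ}

theorem mem_car_halves {s r : ℝ} {x : R3} : x ∈ car (halves y h s r) ↔
    ∃ (i : Fin m) (a : Fin 5),
      x ∈ segment ℝ (halfPos y h s r i a.succ) (halfPos y h s r i a.castSucc) := by
  simp [mem_car, halves]

theorem Heights.mem_car_halves_zero (H : Heights y h) {x : R3} :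
    x ∈ car (halves y h 0 0) ↔ ∃ i, x ∈ leftArc (y i) (h i) := by
  rw [mem_car_halves]
  refine exists_congr fun i => ?_
  have hy := H.yhi i
  have h1 : segment ℝ ((-1/2, 2, h i) : R3) (-1/2, y i, h i) =
      segment ℝ ((-1/2, 2, h i) : R3) (-1/2, 1/2, h i) ∪
        (segment ℝ ((-1/2, 1/2, h i) : R3) (-1/2, -1/2, h i) ∪
          segment ℝ ((-1/2, -1/2, h i) : R3) (-1/2, y i, h i)) := by
    rw [segment_union_of_mem (mem_segment_vertical (by norm_num) (by linarith) (by linarith)),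
      segment_union_of_mem (mem_segment_vertical (by norm_num) (by linarith) (by linarith))]
  simp only [leftArc, h1, mem_union]
  simp [Fin.exists_fin_succ, halfPos, -one_div]
  tauto

theorem InnerPart.car_dbl_halves_zero {I : Set (R3 × R3)} (hI : InnerPart y h I) :
    car (dbl (halves y h 0 0)) = car (outerUnion (range fun i => (y i, h i))) := by
  obtain ⟨p, hp, hpy, hph⟩ := hI.exists_pairing
  ext x
  have h1 : x ∈ car (outerUnion (range fun i => (y i, h i))) ↔ ∃ i, x ∈ car (outer (y i) (h i)) := by
    simp only [mem_car, mem_outerUnion, exists_range_iff]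
    tauto
  rw [mem_car_dbl, hI.hts.mem_car_halves_zero, hI.hts.mem_car_halves_zero, h1]
  simp only [mem_car_outer]
  constructor
  · rintro (⟨i, hi⟩ | ⟨i, hi⟩)
    · exact ⟨i, Or.inl hi⟩
    · exact ⟨p i, Or.inr (by rwa [hpy, hph, neg_neg])⟩
  · rintro ⟨i, hi | hi⟩
    · exact Or.inl ⟨i, hi⟩
    · exact Or.inr ⟨p i, by rwa [hpy, hph]⟩
end

/-- The outer arcs listed by decreasing absolute level. -/
theorem exists_heights {K : Set (ℝ × ℝ)} (hK : K.Finite) (ky : ∀ k ∈ K, -5/2 < k.1 ∧ k.1 < -3/2)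
    (kz : ∀ k ∈ K, k.2 ≠ 0) (kinj : ∀ k ∈ K, ∀ k' ∈ K, k.2 = k'.2 → k = k') :
    ∃ y h : Fin K.ncard → ℝ, Heights y h ∧ (range fun i => (y i, h i)) = K := by
  have := hK.to_subtype
  let e : K ≃ Fin K.ncard := Finite.equivFinOfCardEq (Nat.card_coe_set_eq K)
  let w := Tuple.sort fun i => -|(e.symm i : ℝ × ℝ).2|
  let k : Fin K.ncard → ℝ × ℝ := fun i => e.symm (w i)
  have hk : ∀ i, k i ∈ K := fun i => (e.symm (w i)).2
  refine ⟨fun i => (k i).1, fun i => (k i).2, ⟨fun i => (ky _ (hk i)).1, fun i => (ky _ (hk i)).2,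
    fun i j hij => ?_, fun i => kz _ (hk i), fun i j hij => ?_⟩, ?_⟩
  · have := kinj _ (hk i) _ (hk j) hij
    exact w.injective (e.symm.injective (Subtype.ext this))
  · have := Tuple.monotone_sort (fun i => -|(e.symm i : ℝ × ℝ).2|) hij.le
    simpa using this
  · ext x
    constructor
    · rintro ⟨i, rfl⟩
      exact hk i
    · intro hx
      exact ⟨w.symm (e ⟨x, hx⟩), by simp [k]⟩

/-- A link in normal form whose inner edges run forward and which is close to the plane `z = 0`
has the required shape. -/
theorem NormalForm.exists_innerPart {I : Set (R3 × R3)} {K : Set (ℝ × ℝ)} (hN : NormalForm I K)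
    (hf : ∀ e ∈ I, e.1.1 < e.2.1) (hz : ∀ v ∈ vts (I ∪ outerUnion K), |v.2.2| ≤ 1 / (K.ncard + 2)) :
    ∃ y h : Fin K.ncard → ℝ, InnerPart y h I ∧ (range fun i => (y i, h i)) = K := by
  obtain ⟨y, h, H, hK⟩ := exists_heights hN.kfin hN.ky hN.kz hN.kinj
  have hmem : ∀ i, (y i, h i) ∈ K := fun i => hK ▸ ⟨i, rfl⟩
  have hex : ∀ k ∈ K, ∃ i, (y i, h i) = k := fun k hk => by rw [← hK] at hk; exact hk
  have h0 : (0:ℝ) ≤ K.ncard := Nat.cast_nonneg _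
  have hout : ∀ {e}, e ∈ outerUnion K → e.1.1 ≠ -1/4 := by
    intro e he h1
    obtain ⟨k, hk, he⟩ := mem_outerUnion.1 he
    simp only [outer, mem_insert_iff, mem_singleton_iff] at he
    rcases he with rfl | rfl | rfl | rfl | rfl <;> norm_num at h1
  refine ⟨y, h, ⟨H, fun i => ?_, fun i => ?_, hN.lk.emb.mono subset_union_left, hN.isym, hf,
    fun v hv => ?_, hN.vy, fun v hv => ?_,
    fun e he f hf => hN.lk.comb.out e (Or.inl he) f (Or.inl hf), fun e he => ?_, fun i => ?_⟩, hK⟩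
  · obtain ⟨j, hj⟩ := hex _ (hN.ksym _ (hmem i))
    exact ⟨j, (Prod.ext_iff.1 hj).1, (Prod.ext_iff.1 hj).2⟩
  · refine (hz (1/4, y i, h i) ⟨((1/4, y i, h i), (1/2, y i, h i)),
      Or.inr (mem_outerUnion.2 ⟨_, hmem i, by simp [outer]⟩), Or.inl rfl⟩).trans ?_
    gcongr; norm_num
  · rcases hN.vx v hv with h1 | ⟨k, -, rfl | rfl⟩
    · exact h1.le
    · norm_num
    · norm_num [abs_le]
  · obtain ⟨e, he, hv⟩ := hv
    refine (hz v ⟨e, Or.inl he, hv⟩).trans ?_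
    rw [div_le_div_iff₀ (by positivity) (by norm_num)]
    linarith
  · obtain ⟨f, hf | hf, hfe⟩ := hN.lk.comb.next e (Or.inl he)
    · exact Or.inl ⟨f, hf, hfe⟩
    · right
      obtain ⟨k, hk, hf'⟩ := mem_outerUnion.1 hf
      have h1 := (outer_snd hf').2.2.1
      rcases hN.vx e.2 ⟨e, he, Or.inr rfl⟩ with h2 | ⟨k', hk', h2 | h2⟩
      · rw [hfe] at h1; linarith
      · obtain ⟨i, rfl⟩ := hex k' hk'
        exact ⟨i, h2⟩
      · exact absurd (by rw [hfe, h2]) (hout hf)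
  · obtain ⟨f, hf | hf, hfe⟩ := hN.lk.comb.next ((-1/2, y i, h i), (-1/4, y i, h i))
      (Or.inr (mem_outerUnion.2 ⟨_, hmem i, by simp [outer]⟩))
    · exact ⟨f, hf, hfe⟩
    · exact absurd (by rw [hfe]) (hout hf)

theorem imgE_union {V : Type*} (P : V → R3) (A B : Set (V × V)) :
    imgE P (A ∪ B) = imgE P A ∪ imgE P B := image_union _ _ _

theorem vts_imgE {P : R3 → R3} {E : Set (R3 × R3)} {v : R3} (hv : v ∈ vts (imgE P E)) :
    ∃ w ∈ vts E, P w = v := by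
  obtain ⟨_, ⟨e, he, rfl⟩, rfl | rfl⟩ := hv
  · exact ⟨e.1, ⟨e, he, Or.inl rfl⟩, rfl⟩
  · exact ⟨e.2, ⟨e, he, Or.inr rfl⟩, rfl⟩

/-- Scaling the third coordinate. -/
theorem imgE_outer (c y h : ℝ) : imgE (rescale 1 1 0 c) (outer y h) = outer y (c * h) := by
  simp [imgE, outer, image_insert_eq, rescale]

theorem imgE_outerUnion (c : ℝ) (K : Set (ℝ × ℝ)) : imgE (rescale 1 1 0 c) (outerUnion K) =
    outerUnion ((fun k => (k.1, c * k.2)) '' K) := by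
  simp only [outerUnion, biUnion_image, ← imgE_outer, imgE, image_iUnion]

theorem NormalForm.scale {I : Set (R3 × R3)} {K : Set (ℝ × ℝ)} (hN : NormalForm I K) {c : ℝ}
    (hc : 0 < c) : NormalForm (imgE (rescale 1 1 0 c) I) ((fun k => (k.1, c * k.2)) '' K) where
  lk := by
    rw [← imgE_outerUnion, ← imgE_union]
    exact (hN.lk.rescale one_pos one_pos hc 0).1
  isym := hN.isym.imgE fun v _ => rescale_tau _ _ _ _ v
  kfin := hN.kfin.image _
  ksym := by
    rintro _ ⟨k, hk, rfl⟩
    exact ⟨_, hN.ksym k hk, by simp⟩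
  ky := by
    rintro _ ⟨k, hk, rfl⟩
    exact hN.ky k hk
  kz := by
    rintro _ ⟨k, hk, rfl⟩
    exact mul_ne_zero hc.ne' (hN.kz k hk)
  kinj := by
    rintro _ ⟨k, hk, rfl⟩ _ ⟨k', hk', rfl⟩ h
    rw [hN.kinj k hk k' hk' (mul_left_cancel₀ hc.ne' h)]
  ne := by
    rintro _ ⟨e, he, rfl⟩
    simpa [rescale] using hN.ne e he
  vy := by
    intro v hv
    obtain ⟨w, hw, rfl⟩ := vts_imgE hv
    simpa [rescale] using hN.vy w hw
  vx := by
    intro v hv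
    obtain ⟨w, hw, rfl⟩ := vts_imgE hv
    rcases hN.vx w hw with h | ⟨k, hk, h | h⟩
    · left; simpa [rescale] using h
    · exact Or.inr ⟨_, ⟨k, hk, rfl⟩, Or.inl (by rw [h]; simp [rescale])⟩
    · exact Or.inr ⟨_, ⟨k, hk, rfl⟩, Or.inr (by rw [h]; simp [rescale])⟩
  bad := by
    rintro _ ⟨e, he, rfl⟩ h
    simpa [rescale] using hN.bad e he (by simpa [rescale] using h)

theorem NormalForm.equivIsotopic_scale {I : Set (R3 × R3)} {K : Set (ℝ × ℝ)} (hN : NormalForm I K)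
    {c : ℝ} (hc : 0 < c) : EquivIsotopicSets (car (I ∪ outerUnion K))
      (car (imgE (rescale 1 1 0 c) I ∪ outerUnion ((fun k => (k.1, c * k.2)) '' K))) := by
  rw [← imgE_outerUnion, ← imgE_union]
  exact (hN.lk.rescale one_pos one_pos hc 0).2

/-- Every strongly involutive link can be brought into the shape described by `InnerPart`. -/
theorem IsLink.exists_innerPart {L : PolyLink} (hL : IsLink L) (hS : StronglyInvolutive L) :
    ∃ (m : ℕ) (y h : Fin m → ℝ) (I : Set (R3 × R3)), InnerPart y h I ∧
      EquivIsotopicSets (carrier L) (car (I ∪ dbl (halves y h 1 1))) := by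
  obtain ⟨I₀, hN₀, h0⟩ := hL.exists_normalForm hS
  obtain ⟨I, K, hN, h1, hfwd⟩ := hN₀.exists_forward
  obtain ⟨M, hM, hb⟩ := exists_norm_bound hN.lk.emb.fin
  have hc : 0 < 1 / ((K.ncard + 2) * M) := by positivity
  generalize hcdef : 1 / ((K.ncard + 2) * M) = c at hc
  have hcard : ((fun k : ℝ × ℝ => (k.1, c * k.2)) '' K).ncard = K.ncard := by
    refine ncard_image_of_injective _ fun k k' h => ?_
    simp only [Prod.mk.injEq] at h
    exact Prod.ext h.1 (mul_left_cancel₀ hc.ne' h.2)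
  obtain ⟨y, h, hI, hK⟩ := (hN.scale hc).exists_innerPart
    (by
      rintro _ ⟨e, he, rfl⟩
      simpa [rescale] using hfwd e he)
    (by
      intro v hv
      rw [← imgE_outerUnion, ← imgE_union] at hv
      obtain ⟨w, hw, rfl⟩ := vts_imgE hv
      have h2 : |w.2.2| ≤ M :=
        ((norm_snd_le w.2).trans (norm_snd_le w)).trans (hb w hw).le
      rw [hcard]
      simp only [rescale, abs_mul, abs_of_pos hc]
      calc c * |w.2.2| ≤ c * M := by gcongr
        _ = 1 / (K.ncard + 2) := by rw [← hcdef]; field_simp)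
  refine ⟨_, y, h, _, hI, h0.trans (h1.trans ((hN.equivIsotopic_scale hc).trans ?_))⟩
  have := hI.equivIsotopic
  rwa [car_union, hI.car_dbl_halves_zero, hK, ← car_union] at this

section
variable {m : ℕ} {y h : Fin m → ℝ} {I : Set (R3 × R3)}

/-- The segments joining the endpoints of the first braid to the inner part. -/
def collars (y h : Fin m → ℝ) : Set (R3 × R3) :=
  range fun i => (arcEnd m i, ((-1/4, y i, h i) : R3))

theorem halfPos_one_one (y h : Fin m → ℝ) (i : Fin m) : halfPos y h 1 1 i 1 = arcEnd m i := by
  simp [halfPos, arcEnd]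

theorem halfPos_four_one (y h : Fin m → ℝ) (i : Fin m) : halfPos y h 1 1 i 4 = arcStart m i := by
  simp [halfPos, arcStart, add_comm]

theorem collars_subset (y h : Fin m → ℝ) : collars y h ⊆ halves y h 1 1 := by
  rintro _ ⟨i, rfl⟩
  refine ⟨(i, 0), ?_⟩
  simp only [← halfPos_one_one y h i]
  rfl

theorem dbl_mono {A B : Set (R3 × R3)} (h : A ⊆ B) : dbl A ⊆ dbl B :=
  union_subset_union h (image_mono h)

theorem InnerPart.tauSym_union (hI : InnerPart y h I) : TauSym (I ∪ dbl (collars y h)) :=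
  hI.sym.union (tauSym_dbl _)

theorem arcEnd_injective : Function.Injective (arcEnd m) := fun i j hij =>
  basePt_injective m (by
    have := congrArg (fun p : R3 => p.2.1) hij
    simpa [arcEnd] using this)

theorem InnerPart.mem_cases {P : R3 × R3 → Prop} (h0 : ∀ e ∈ I, P e)
    (h1 : ∀ i, P (arcEnd m i, ((-1/4, y i, h i) : R3)))
    (h2 : ∀ i, P (((1/4, y i, -h i) : R3), tau (arcEnd m i))) :
    ∀ e ∈ I ∪ dbl (collars y h), P e := by
  rintro e (he | ⟨i, rfl⟩ | ⟨_, ⟨i, rfl⟩, rfl⟩)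
  · exact h0 e he
  · exact h1 i
  · have := h2 i
    simp only [rv, tau, neg_div, neg_neg] at this ⊢
    exact this

theorem InnerPart.mem_I (hI : InnerPart y h I) {e : R3 × R3} (he : e ∈ I) :
    -1/4 ≤ e.1.1 ∧ e.1.1 < e.2.1 ∧ e.2.1 ≤ 1/4 := by
  have h1 := abs_le.1 (hI.vx e.1 ⟨e, he, Or.inl rfl⟩)
  have h2 := abs_le.1 (hI.vx e.2 ⟨e, he, Or.inr rfl⟩)
  exact ⟨by linarith, hI.fwd e he, h2.2⟩

theorem InnerPart.fwdGraph (hI : InnerPart y h I) : FwdGraph (I ∪ dbl (collars y h)) := by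
  have hfst : ∀ i : Fin m, (arcEnd m i).1 = -1/2 := fun i => rfl
  have hsnd : ∀ i : Fin m, (tau (arcEnd m i)).1 = 1/2 := fun i => by norm_num [tau, arcEnd]
  have hsym := hI.tauSym_union
  obtain ⟨p, hp, hpy, hph⟩ := hI.exists_pairing
  have hout : ∀ e ∈ I ∪ dbl (collars y h), ∀ f ∈ I ∪ dbl (collars y h), e.1 = f.1 → e = f := by
    refine InnerPart.mem_cases (fun e he => ?_) (fun i => ?_) fun i => ?_
    all_goals refine InnerPart.mem_cases (fun f hf => ?_) (fun j => ?_) fun j => ?_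
    all_goals intro hef
    all_goals have hx := congrArg Prod.fst hef
    all_goals try simp only [hfst] at hx
    · exact hI.out e he f hf hef
    · have := hI.mem_I he; linarith
    · have := hI.mem_I he; linarith
    · have := hI.mem_I hf; linarith
    · rw [arcEnd_injective hef]
    · norm_num at hx
    · have := hI.mem_I hf; linarith
    · norm_num at hx
    · have := congrArg (fun p : R3 => p.2.2) hef
      rw [hI.hts.inj i j (by simpa using this)]
  have hhi : ∀ e ∈ I ∪ dbl (collars y h), e.2.1 ≤ 1/2 := by
    refine InnerPart.mem_cases (fun e he => ?_) (fun i => ?_) fun i => ?_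
    · have := hI.mem_I he; linarith
    · norm_num
    · exact (hsnd i).le
  have hnext : ∀ e ∈ I ∪ dbl (collars y h), e.2.1 = 1/2 ∨ ∃ f ∈ I ∪ dbl (collars y h), f.1 = e.2 := by
    refine InnerPart.mem_cases (fun e he => ?_) (fun i => ?_) fun i => ?_
    · right
      rcases hI.next e he with ⟨f, hf, hfe⟩ | ⟨i, hi⟩
      · exact ⟨f, Or.inl hf, hfe⟩
      · refine ⟨_, Or.inr (Or.inr ⟨_, ⟨p i, rfl⟩, rfl⟩), ?_⟩
        rw [hi]
        simp only [rv, tau, hpy, hph]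
        norm_num
    · obtain ⟨e, he, h1⟩ := hI.start i
      exact Or.inr ⟨e, Or.inl he, h1⟩
    · exact Or.inl (hsnd i)
  refine ⟨(hI.emb_union (s := 1) (r := 1) (by simp) (by simp) (Or.inr rfl)).mono
    (union_subset_union_right _ (dbl_mono (collars_subset y h))), ?_, hout, ?_, ?_, hhi, hnext, ?_⟩
  · refine InnerPart.mem_cases hI.fwd (fun i => ?_) fun i => ?_
    · norm_num [hfst]
    · norm_num [hsnd]
  · intro e he f hf hef
    have := hout _ (hsym e he) _ (hsym f hf) (by rw [hef])
    rw [← rv_rv e, ← rv_rv f]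
    exact congrArg rv this
  · intro e he
    have := hhi _ (hsym e he)
    simp only [tau] at this
    linarith
  · intro e he
    rcases hnext _ (hsym e he) with h1 | ⟨f, hf, h1⟩
    · left
      simp only [tau] at h1
      linarith
    · exact Or.inr ⟨rv f, hsym f hf, by simp [rv, h1, tau_tau]⟩

/-- The first braid of the closure. -/
theorem InnerPart.exists_first (hI : InnerPart y h I) : ∃ a : GeomBraid m, a.Symmetric ∧
    iota1 '' a.carrier = car (I ∪ dbl (collars y h)) := by
  have hfst : ∀ i : Fin m, (arcEnd m i).1 = -1/2 := fun i => rfl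
  have hsnd : ∀ i : Fin m, (tau (arcEnd m i)).1 = 1/2 := fun i => by norm_num [tau, arcEnd]
  have htau : ∀ v : R3, inDisk (v.2 + (2, 0)) → inDisk ((tau v).2 + (2, 0)) := fun v hv => by
    simpa [inDisk, tau] using hv
  have hvI : ∀ v ∈ vts I, inDisk (v.2 + (2, 0)) := fun v hv => by
    have h1 := hI.vy v hv
    have h2 := abs_le.1 (hI.vz v hv)
    simp only [inDisk, Prod.fst_add, Prod.snd_add]
    nlinarith
  have hend : ∀ i, inDisk ((arcEnd m i).2 + (2, 0)) := fun i => by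
    have h1 := basePt_lt i
    have h2 := lt_basePt i
    simp only [inDisk, arcEnd, Prod.fst_add, Prod.snd_add]
    nlinarith
  have hin : ∀ i, ((-1/4, y i, h i) : R3) ∈ vts I := fun i => by
    obtain ⟨e, he, h1⟩ := hI.start i
    exact ⟨e, he, Or.inl h1.symm⟩
  have htin : ∀ i, inDisk (((1/4, y i, -h i) : R3).2 + (2, 0)) := fun i => by
    have := htau _ (hvI _ (hin i))
    simpa [tau] using this
  have hD : ∀ e ∈ I ∪ dbl (collars y h), inDisk (e.1.2 + (2, 0)) ∧ inDisk (e.2.2 + (2, 0)) :=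
    InnerPart.mem_cases
      (fun e he => ⟨hvI _ ⟨e, he, Or.inl rfl⟩, hvI _ ⟨e, he, Or.inr rfl⟩⟩)
      (fun i => ⟨hend i, hvI _ (hin i)⟩) (fun i => ⟨htin i, htau _ (hend i)⟩)
  have h1 : ∀ e ∈ I ∪ dbl (collars y h), e.1.1 = -1/2 → ∃ i, e.1 = arcEnd m i := by
    refine InnerPart.mem_cases (fun e he hx => ?_) (fun i _ => ⟨i, rfl⟩) fun i hx => ?_
    · have := hI.mem_I he; linarith
    · norm_num at hx
  have h3 : ∀ e ∈ I ∪ dbl (collars y h), e.2.1 = 1/2 → ∃ i, e.2 = tau (arcEnd m i) := by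
    refine InnerPart.mem_cases (fun e he hx => ?_) (fun i hx => ?_) fun i _ => ⟨i, rfl⟩
    · have := hI.mem_I he; linarith
    · norm_num at hx
  obtain ⟨a, ha⟩ := hI.fwdGraph.exists_geomBraid (m := m)
    (by
      rintro v ⟨e, he, rfl | rfl⟩
      · exact (hD e he).1
      · exact (hD e he).2)
    h1 (fun i => ⟨_, Or.inr (Or.inl ⟨i, rfl⟩), rfl⟩) h3
  exact ⟨a, GeomBraid.symmetric_of_tauSym iota1_injective iota1_rho hI.tauSym_union ha, ha⟩
end

theorem iota2_injective : Function.Injective iota2 := fun p q h => by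
  simp only [iota2, Prod.mk.injEq] at h
  exact Prod.ext (by linarith [h.1]) (Prod.ext (by linarith [h.2.1]) h.2.2)

theorem iota2_rho (p : R3) : iota2 (rho p) = tau (iota2 p) := by
  simp only [iota2, rho, tau]
  ext <;> simp
  ring

section
variable {m : ℕ} {y h : Fin m → ℝ} {I : Set (R3 × R3)}

/-- The left halves of the strands of the second braid. -/
def caps (y h : Fin m → ℝ) : Set (R3 × R3) :=
  range fun i => (halfPos y h 1 1 i 5, halfPos y h 1 1 i 4)

theorem mem_segment_halfPos_iff {s r : ℝ} {i : Fin m} {a : Fin 5} {x : R3} :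
    x ∈ segment ℝ (halfPos y h s r i a.succ) (halfPos y h s r i a.castSucc) ↔
      ∃ u ∈ Icc (0:ℝ) 1, halfPt y h s r i a u = x := by
  rw [segment_symm, segment_eq_image]
  exact Iff.rfl

theorem mem_car_caps {x : R3} :
    x ∈ car (caps y h) ↔ ∃ i, ∃ u ∈ Icc (0:ℝ) 1, halfPt y h 1 1 i 4 u = x := by
  simp only [mem_car, caps, exists_range_iff]
  exact exists_congr fun i => mem_segment_halfPos_iff (a := 4)

theorem mem_car_collars {x : R3} :
    x ∈ car (collars y h) ↔ ∃ i, ∃ u ∈ Icc (0:ℝ) 1, halfPt y h 1 1 i 0 u = x := by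
  simp only [mem_car, collars, exists_range_iff, ← halfPos_one_one y h]
  exact exists_congr fun i => mem_segment_halfPos_iff (a := 0)

/-- A strand of the second braid up to the middle. -/
def capPath (h : Fin m → ℝ) (i : Fin m) (u : ℝ) : ℝ × ℝ :=
  ((1 - u) * basePt m i + u * (m / (m + 1)), u * h i)

theorem halfPt_four_eq (y h : Fin m → ℝ) (i : Fin m) (u : ℝ) :
    halfPt y h 1 1 i 4 u = iota2 (u / 2, capPath h i u) := by
  rw [halfPt_four]
  ext <;> simp [iota2, capPath] <;> ring

/-- The strands of the second braid, where `p` pairs the strands. -/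
def capStrand (h : Fin m → ℝ) (p : Fin m → Fin m) (i : Fin m) (t : ℝ) : ℝ × ℝ :=
  if t ≤ 1/2 then capPath h i (2 * t)
  else ((capPath h (p i) (2 * (1 - t))).1, -(capPath h (p i) (2 * (1 - t))).2)

theorem capStrand_of_le (h : Fin m → ℝ) (p : Fin m → Fin m) (i : Fin m) {t : ℝ} (ht : t ≤ 1/2) :
    capStrand h p i t = capPath h i (2 * t) := if_pos ht

theorem capStrand_of_ge {p : Fin m → Fin m} (hp : ∀ i, h (p i) = -h i) (i : Fin m) {t : ℝ}
    (ht : 1/2 ≤ t) : capStrand h p i t =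
      ((capPath h (p i) (2 * (1 - t))).1, -(capPath h (p i) (2 * (1 - t))).2) := by
  rcases ht.eq_or_lt with rfl | ht
  · rw [capStrand_of_le _ _ _ le_rfl]
    norm_num [capPath, hp]
  · exact if_neg ht.not_ge

theorem InnerPart.inDisk_capPath (hI : InnerPart y h I) (i : Fin m) {u : ℝ}
    (hu : u ∈ Icc (0:ℝ) 1) : inDisk (capPath h i u) := by
  have hm : (0:ℝ) < m + 1 := by positivity
  have h1 := basePt_lt i
  have h2 := lt_basePt i
  have hb : inDisk (basePt m i, 0) := by simp only [inDisk]; nlinarith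
  have hc : inDisk ((m:ℝ) / (m + 1), h i) := by
    have h3 : h i ^ 2 ≤ (1 / (m + 1)) ^ 2 := sq_le_sq.2 ((hI.hle i).trans (le_abs_self _))
    have h4 : ((m:ℝ) / (m + 1)) ^ 2 + (1 / (m + 1)) ^ 2 ≤ 1 := by
      rw [div_pow, div_pow, ← add_div, div_le_one (by positivity)]
      nlinarith [(Nat.cast_nonneg m : (0:ℝ) ≤ m)]
    simp only [inDisk]; linarith
  have := convex_inDisk hb hc (by linarith [hu.2] : 0 ≤ 1 - u) hu.1 (by ring)
  simpa [capPath] using this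

/-- The second braid of the closure. -/
theorem InnerPart.exists_second (hI : InnerPart y h I) : ∃ b : GeomBraid m, b.Symmetric ∧
    iota2 '' b.carrier = car (dbl (caps y h)) := by
  obtain ⟨p, hp, hpy, hph⟩ := hI.exists_pairing
  have hinj : ∀ {i j : Fin m} {u : ℝ}, u ∈ Icc (0:ℝ) 1 → capPath h i u = capPath h j u → i = j := by
    intro i j u hu he
    refine (hI.hts.eq_of_eq (s := 1) (r := 1) (by simp) (by simp) (Or.inr rfl) hu hu
      (a := 4) (b := 4) ?_).1
    rw [halfPt_four_eq, halfPt_four_eq, he]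
  have hpl : ∀ i, IsPLPath (capStrand h p i) := by
    intro i
    refine isPLPath_of_finite (finite_singleton (1/2 : ℝ)) fun c d _ _ _ hcd => ?_
    rcases hcd _ rfl with hc | hd
    · refine ⟨(2 * (m / (m + 1)) - basePt m (p i), 2 * h i),
        (2 * basePt m (p i) - 2 * (m / (m + 1)), -2 * h i), fun s hs => ?_⟩
      rw [capStrand_of_ge hph i (hc.trans hs.1)]
      ext <;> simp [capPath, hph] <;> ring
    · refine ⟨(basePt m i, 0), (2 * (m / (m + 1)) - 2 * basePt m i, 2 * h i), fun s hs => ?_⟩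
      rw [capStrand_of_le _ _ _ (hs.2.trans hd)]
      ext <;> simp [capPath] <;> ring
  let b : GeomBraid m :=
    { f := capStrand h p
      pl := hpl
      disj := fun t ht i j hij he => by
        rcases le_total t (1/2) with h1 | h1
        · rw [capStrand_of_le _ _ _ h1, capStrand_of_le _ _ _ h1] at he
          exact hij (hinj ⟨by linarith [ht.1], by linarith⟩ he)
        · rw [capStrand_of_ge hph _ h1, capStrand_of_ge hph _ h1, Prod.mk.injEq, neg_inj] at he
          have := hinj ⟨by linarith [ht.2], by linarith⟩ (Prod.ext he.1 he.2)
          exact hij (by rw [← hp i, this, hp])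
      inD := fun i t ht => by
        rcases le_total t (1/2) with h1 | h1
        · rw [capStrand_of_le _ _ _ h1]
          exact hI.inDisk_capPath i ⟨by linarith [ht.1], by linarith⟩
        · rw [capStrand_of_ge hph _ h1]
          have := hI.inDisk_capPath (p i) (u := 2 * (1 - t)) ⟨by linarith [ht.2], by linarith⟩
          simpa [inDisk] using this
      start := fun i => by
        rw [capStrand_of_le _ _ _ (by norm_num)]
        simp [capPath]
      finish := ⟨⟨p, p, hp, hp⟩, fun i => by
        rw [capStrand_of_ge hph _ (by norm_num)]
        simp [capPath]⟩ }
  have hb : iota2 '' b.carrier = car (dbl (caps y h)) := by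
    ext x
    rw [mem_car_dbl, mem_car_caps, mem_car_caps]
    constructor
    · rintro ⟨_, ⟨i, t, ht, rfl⟩, rfl⟩
      change (∃ j, ∃ u ∈ Icc (0:ℝ) 1, halfPt y h 1 1 j 4 u = iota2 (t, capStrand h p i t)) ∨
        ∃ j, ∃ u ∈ Icc (0:ℝ) 1, halfPt y h 1 1 j 4 u = tau (iota2 (t, capStrand h p i t))
      rcases le_total t (1/2) with h1 | h1
      · refine Or.inl ⟨i, 2 * t, ⟨by linarith [ht.1], by linarith⟩, ?_⟩
        rw [halfPt_four_eq, capStrand_of_le _ _ _ h1, mul_div_cancel_left₀ _ two_ne_zero]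
      · refine Or.inr ⟨p i, 2 * (1 - t), ⟨by linarith [ht.2], by linarith⟩, ?_⟩
        rw [halfPt_four_eq, capStrand_of_ge hph _ h1, ← iota2_rho,
          mul_div_cancel_left₀ _ two_ne_zero]
        simp [rho]
    · rintro (⟨i, u, hu, rfl⟩ | ⟨i, u, hu, hx⟩)
      · refine ⟨_, ⟨i, u / 2, ⟨by linarith [hu.1], by linarith [hu.2]⟩, rfl⟩, ?_⟩
        change iota2 (u / 2, capStrand h p i (u / 2)) = _
        rw [halfPt_four_eq, capStrand_of_le _ _ _ (by linarith [hu.2]),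
          mul_div_cancel₀ _ two_ne_zero]
      · refine ⟨_, ⟨p i, 1 - u / 2, ⟨by linarith [hu.2], by linarith [hu.1]⟩, rfl⟩, ?_⟩
        change iota2 (1 - u / 2, capStrand h p (p i) (1 - u / 2)) = _
        rw [halfPt_four_eq, eq_comm, tau_eq_iff, ← iota2_rho] at hx
        rw [hx, capStrand_of_ge hph _ (by linarith [hu.2]), hp, sub_sub_cancel,
          mul_div_cancel₀ _ two_ne_zero]
        rfl
  exact ⟨b, GeomBraid.symmetric_of_tauSym iota2_injective iota2_rho (tauSym_dbl _) hb, hb⟩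
end

section
variable {m : ℕ} {y h : Fin m → ℝ} {I : Set (R3 × R3)}

/-- The connecting arcs of the closure. -/
def connArc (y h : Fin m → ℝ) (i : Fin m) : List R3 :=
  [halfPos y h 1 1 i 4, halfPos y h 1 1 i 3, halfPos y h 1 1 i 2, halfPos y h 1 1 i 1]

theorem isConnArc_connArc (y h : Fin m → ℝ) (i : Fin m) : IsConnArc m i (connArc y h i) := by
  have h1 := basePt_lt i
  have h2 := lt_basePt i
  refine ⟨by simp [connArc, halfPos_four_one], by simp [connArc, halfPos_one_one],
    by simp [connArc, halfPos], ?_⟩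
  refine .cons_cons ?_ (.cons_cons ?_ (.cons_cons ?_ (.singleton _))) <;> simp [halfPos] <;> linarith

theorem mem_pathCarrier_connArc {i : Fin m} {x : R3} : x ∈ pathCarrier (connArc y h i) ↔
    ∃ a : Fin 5, a ≠ 0 ∧ a ≠ 4 ∧ ∃ u ∈ Icc (0:ℝ) 1, halfPt y h 1 1 i a u = x := by
  have h1 : x ∈ pathCarrier (connArc y h i) ↔
      x ∈ segment ℝ (halfPos y h 1 1 i (3 : Fin 5).succ) (halfPos y h 1 1 i (3 : Fin 5).castSucc) ∨
      x ∈ segment ℝ (halfPos y h 1 1 i (2 : Fin 5).succ) (halfPos y h 1 1 i (2 : Fin 5).castSucc) ∨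
      x ∈ segment ℝ (halfPos y h 1 1 i (1 : Fin 5).succ) (halfPos y h 1 1 i (1 : Fin 5).castSucc) := by
    simp [pathCarrier, pathSegs, connArc]
  simp only [h1, mem_segment_halfPos_iff]
  constructor
  · rintro (h2 | h2 | h2)
    exacts [⟨3, by decide, by decide, h2⟩, ⟨2, by decide, by decide, h2⟩,
      ⟨1, by decide, by decide, h2⟩]
  · rintro ⟨a, ha, ha', h2⟩
    have : a = 3 ∨ a = 2 ∨ a = 1 := by clear h2; revert a; decide
    rcases this with rfl | rfl | rfl
    exacts [Or.inl h2, Or.inr (Or.inl h2), Or.inr (Or.inr h2)]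

theorem fst_lt_of_mem_connArc {i : Fin m} {x : R3} (hx : x ∈ pathCarrier (connArc y h i)) :
    x.1 < -1/4 := by
  obtain ⟨a, ha, ha', u, hu, rfl⟩ := mem_pathCarrier_connArc.1 hx
  rcases halfPt_region y h 1 (s := 1) (by simp) i a hu with (h1 | h1) | h1
  exacts [h1, absurd h1.1 ha, absurd h1.1 ha']

theorem fst_nonpos_of_mem_halves {x : R3} (hx : x ∈ car (halves y h 1 1)) : x.1 ≤ 0 := by
  obtain ⟨i, a, hx⟩ := mem_car_halves.1 hx
  obtain ⟨u, hu, rfl⟩ := mem_segment_halfPos_iff.1 hx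
  rcases halfPt_region y h 1 (s := 1) (by simp) i a hu with (h1 | ⟨rfl, rfl⟩) | h1
  · linarith
  · rw [halfPt_zero]; norm_num
  · exact h1.2.2.1

theorem caps_subset (y h : Fin m → ℝ) : caps y h ⊆ halves y h 1 1 := by
  rintro _ ⟨i, rfl⟩
  exact ⟨(i, 4), rfl⟩

theorem mem_car_halves_one {x : R3} : x ∈ car (halves y h 1 1) ↔
    x ∈ car (collars y h) ∨ x ∈ car (caps y h) ∨ ∃ i, x ∈ pathCarrier (connArc y h i) := by
  simp only [mem_car_halves, mem_segment_halfPos_iff, mem_car_collars, mem_car_caps,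
    mem_pathCarrier_connArc]
  constructor
  · rintro ⟨i, a, h1⟩
    by_cases ha : a = 0
    · subst ha
      exact Or.inl ⟨i, h1⟩
    · by_cases ha' : a = 4
      · subst ha'
        exact Or.inr (Or.inl ⟨i, h1⟩)
      · exact Or.inr (Or.inr ⟨i, a, ha, ha', h1⟩)
  · rintro (⟨i, h1⟩ | ⟨i, h1⟩ | ⟨i, a, -, -, h1⟩)
    exacts [⟨i, 0, h1⟩, ⟨i, 4, h1⟩, ⟨i, a, h1⟩]

theorem InnerPart.le_fst (hI : InnerPart y h I) {x : R3} (hx : x ∈ car I) : -1/4 ≤ x.1 := by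
  obtain ⟨e, he, hx⟩ := mem_car.1 hx
  have h1 := hI.mem_I he
  have := segment_fnl_le (fnl (-1) 0 0) hx (k := 1/4)
    (by simp only [fnl_apply]; linarith) (by simp only [fnl_apply]; linarith)
  simp only [fnl_apply] at this
  linarith

theorem InnerPart.connArc_inter (hI : InnerPart y h I) (i : Fin m) {x : R3}
    (hx : x ∈ pathCarrier (connArc y h i))
    (hx' : x ∈ car (I ∪ dbl (collars y h)) ∪ car (dbl (caps y h))) :
    x = arcStart m i ∨ x = arcEnd m i := by
  have hlt := fst_lt_of_mem_connArc hx
  have hpos : ∀ W ⊆ halves y h 1 1, tau x ∉ car W := fun W hW h1 => by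
    have := fst_nonpos_of_mem_halves (car_mono hW h1)
    simp only [tau] at this
    linarith
  obtain ⟨a, ha, ha', u, hu, rfl⟩ := mem_pathCarrier_connArc.1 hx
  have heq : ∀ {j b v}, v ∈ Icc (0:ℝ) 1 → halfPt y h 1 1 j b v = halfPt y h 1 1 i a u →
      ((a : ℕ) : ℝ) + u = ((b : ℕ) : ℝ) + v := fun hv he =>
    (hI.hts.eq_of_eq (by simp) (by simp) (Or.inr rfl) hu hv he.symm).2
  have ha1 : 1 ≤ ((a : ℕ) : ℝ) := by
    exact_mod_cast Nat.one_le_iff_ne_zero.2 fun h0 => ha (Fin.ext h0)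
  have ha3 : ((a : ℕ) : ℝ) ≤ 3 := by
    have : (a : ℕ) ≠ 4 := fun h0 => ha' (Fin.ext h0)
    exact_mod_cast (by omega : (a : ℕ) ≤ 3)
  rw [car_union] at hx'
  rcases hx' with (h1 | h1) | h1
  · have := hI.le_fst h1
    linarith
  · rcases mem_car_dbl.1 h1 with h1 | h1
    · obtain ⟨j, v, hv, h2⟩ := mem_car_collars.1 h1
      have h3 := heq hv h2
      simp only [Fin.val_zero, Nat.cast_zero, zero_add] at h3
      have hu0 : u = 0 := by linarith [hu.1, hv.2]
      have ha0 : a = 1 := Fin.ext (by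
        have : ((a : ℕ) : ℝ) = 1 := by linarith [hu.1, hv.2]
        exact_mod_cast this)
      subst hu0 ha0
      right
      rw [halfPt_left]
      exact halfPos_one_one y h i
    · exact absurd h1 (hpos _ (collars_subset y h))
  · rcases mem_car_dbl.1 h1 with h1 | h1
    · obtain ⟨j, v, hv, h2⟩ := mem_car_caps.1 h1
      have h3 := heq hv h2
      have h4 : (((4 : Fin 5) : ℕ) : ℝ) = 4 := by norm_num
      rw [h4] at h3
      have hu0 : u = 1 := by linarith [hu.2, hv.1]
      have ha0 : a = 3 := Fin.ext (by
        have : ((a : ℕ) : ℝ) = 3 := by linarith [hu.2, hv.1]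
        exact_mod_cast this)
      subst hu0 ha0
      left
      rw [halfPt_right]
      exact halfPos_four_one y h i
    · exact absurd h1 (hpos _ (caps_subset y h))

theorem InnerPart.isEqClosure (hI : InnerPart y h I) {A B : Set R3}
    (hA : iota1 '' A = car (I ∪ dbl (collars y h))) (hB : iota2 '' B = car (dbl (caps y h))) :
    IsEqClosure m A B (car (I ∪ dbl (halves y h 1 1))) := by
  refine ⟨connArc y h, isConnArc_connArc y h, fun i j hij => ?_, fun i j => ?_, fun i x hx => ?_, ?_⟩
  · refine eq_empty_of_forall_notMem fun x ⟨h1, h2⟩ => hij ?_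
    obtain ⟨a, -, -, u, hu, rfl⟩ := mem_pathCarrier_connArc.1 h1
    obtain ⟨b, -, -, v, hv, h3⟩ := mem_pathCarrier_connArc.1 h2
    exact (hI.hts.eq_of_eq (by simp) (by simp) (Or.inr rfl) hu hv h3.symm).1
  · refine eq_empty_of_forall_notMem ?_
    rintro _ ⟨h1, x, h2, rfl⟩
    have h3 := fst_lt_of_mem_connArc h1
    have h4 := fst_lt_of_mem_connArc h2
    simp only [tau] at h3
    linarith
  · rw [hA, hB] at hx
    exact hI.connArc_inter i hx.1 hx.2
  · ext x
    have htau : ∀ S : Set R3, x ∈ tau '' S ↔ tau x ∈ S := fun S =>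
      ⟨by rintro ⟨w, hw, rfl⟩; rwa [tau_tau], fun hx => ⟨_, hx, tau_tau x⟩⟩
    simp only [hA, hB, car_union, mem_union, mem_iUnion, htau, mem_car_dbl, mem_car_halves_one]
    tauto
end

/-- **Equivariant Alexander theorem**: every strongly involutive link is equivariantly
isotopic to the equivariant closure of two palindromic braids (i.e. of two
`ρ`-symmetric geometric braids); in particular the equivariant closure map is
surjective up to Sakuma equivalence. -/
theorem stmt_1 (L : PolyLink) (hL : IsLink L) (hSI : StronglyInvolutive L) :
    ∃ (m : ℕ) (a b : GeomBraid m) (C : Set R3),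
      a.Symmetric ∧ b.Symmetric ∧
      IsEqClosure m a.carrier b.carrier C ∧
      EquivIsotopicSets (carrier L) C := by
  obtain ⟨m, y, h, I, hI, hiso⟩ := hL.exists_innerPart hSI
  obtain ⟨a, ha, hA⟩ := hI.exists_first
  obtain ⟨b, hb, hB⟩ := hI.exists_second
  exact ⟨m, a, b, _, ha, hb, hI.isEqClosure hA hB, hiso⟩

end
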